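/- The problem TR-NCRSP_> is undecidable for each of the following four strategy classes: pure finite-state strategies, finite-state strategies, pure strategies, and unrestricted strategies. That is, for each such class S there is no algorithm that, given an SMG G in which every player has a terminal reachability objective and a rational μ ∈ [0,1], decides whether there exists a system strategy σ₀ in class S such that for every profile σ̄₋₀ of environment strategies in class S, if the combined profile σ̄ is a 0-fixed Nash equilibrium then Pay₀(σ̄) > μ. -/

import Mathlib

/- Common infrastructure for formalizing statements about stochastic
   multiplayer non-zero-sum games (SMGs) and the non-cooperative rational
   synthesis problem (NCRSP), following the paper's definitions. -/

open scoped ENNReal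

namespace NCRSPPaper

/-! ### Game arenas -/

/-- A stochastic multiplayer game arena with players `Fin (k+1)` (player `0`
is the system) over vertex type `V`.  A vertex with `owner v = none` is a
nature vertex; its outgoing transition probabilities are given by `prob`.
Player-controlled vertices have their possible moves given by `edge`. -/
structure Arena (k : ℕ) (V : Type) where
  owner : V → Option (Fin (k + 1))
  edge : V → V → Bool
  prob : V → V → ℚ
  init : V

variable {k : ℕ} {V : Type}

/-- The set of successors of a vertex. -/
def Arena.next (A : Arena k V) (u : V) : Set V :=
  {v | (A.owner u = none ∧ 0 < A.prob u v) ∨ (A.owner u ≠ none ∧ A.edge u v = true)}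

/-- A terminal vertex: its only outgoing edge is the self loop. -/
def Arena.terminal (A : Arena k V) (v : V) : Prop := A.next v = {v}

/-- Well-formedness of an arena: every vertex has a successor and the
nature rows are probability distributions. -/
def Arena.WF [Fintype V] (A : Arena k V) : Prop :=
  (∀ u, (A.next u).Nonempty) ∧
  ∀ u, A.owner u = none → (∀ v, 0 ≤ A.prob u v) ∧ (∑ v, A.prob u v) = 1

/-! ### Plays -/

/-- A play is an infinite sequence of vertices. -/
abbrev Play (V : Type) := ℕ → V

/-- `infSet π` is the set of vertices occurring infinitely often in `π`. -/
def infSet (π : Play V) : Set V := {v | ∀ m, ∃ l, m ≤ l ∧ π l = v}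

/-! ### Strategies -/

/-- A (behavioral, possibly history-dependent, probabilistic) strategy:
given the history of vertices strictly preceding the current one and the
current vertex, it yields a probability distribution over vertices. -/
abbrev Strategy (V : Type) := List V → V → PMF V

/-- A strategy is valid for an arena if it only assigns positive
probability to successors of the current vertex. -/
def Strategy.Valid (A : Arena k V) (σ : Strategy V) : Prop :=
  ∀ hist u v, σ hist u v ≠ 0 → v ∈ A.next u

/-- A stationary (memoryless) strategy depends only on the current vertex. -/
def Strategy.Stationary (σ : Strategy V) : Prop :=
  ∀ h h' u, σ h u = σ h' u

/-- A pure (deterministic) strategy assigns probability 1 to a single move. -/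
def Strategy.Pure (σ : Strategy V) : Prop :=
  ∀ h u, ∃ v, σ h u v = 1

/-- A positional strategy is pure and stationary. -/
def Strategy.Positional (σ : Strategy V) : Prop :=
  Strategy.Stationary σ ∧ Strategy.Pure σ

/-- A finite-state strategy is realized by a Mealy machine with finitely
many memory states. -/
def Strategy.FiniteState (σ : Strategy V) : Prop :=
  ∃ (M : Type) (_ : Finite M) (m0 : M) (upd : M → V → M) (out : M → V → PMF V),
    ∀ h u, σ h u = out (h.foldl upd m0) u

/-- A `t`-memory strategy only depends on the most recent `t` vertices of
the history (plus the current vertex). -/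
def Strategy.TMemory (t : ℕ) (σ : Strategy V) : Prop :=
  ∀ h u, σ h u = σ (h.drop (h.length - t)) u

/-- A strategy profile assigns a strategy to every player. -/
abbrev Profile (k : ℕ) (V : Type) := Fin (k + 1) → Strategy V

def Profile.Valid (A : Arena k V) (σ : Profile k V) : Prop :=
  ∀ i, Strategy.Valid A (σ i)

/-! ### The induced probability of a set of plays -/

/-- One-step transition probability at vertex `u` with preceding history
`hist`, under strategy profile `σ`. -/
noncomputable def Arena.stepProb (A : Arena k V) (σ : Profile k V)
    (hist : List V) (u v : V) : ℝ≥0∞ :=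
  match A.owner u with
  | none => ENNReal.ofReal ((A.prob u v : ℚ) : ℝ)
  | some i => σ i hist u v

/-- Probability that, starting from current vertex `u` with preceding
history `hist`, the play continues with the given finite word. -/
noncomputable def extProb (A : Arena k V) (σ : Profile k V) :
    List V → V → List V → ℝ≥0∞
  | _, _, [] => 1
  | hist, u, v :: rest => A.stepProb σ hist u v * extProb A σ (hist ++ [u]) v rest

/-- Probability that a play starting at `s` begins with the finite word `w`. -/
noncomputable def wordProbFrom [DecidableEq V] (A : Arena k V) (σ : Profile k V)
    (s : V) : List V → ℝ≥0∞
  | [] => 1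
  | v :: rest => (if v = s then 1 else 0) * extProb A σ [] v rest

/-- The cylinder of plays extending a finite word. -/
def cyl (w : List V) : Set (Play V) :=
  {π | ∀ i (h : i < w.length), π i = w.get ⟨i, h⟩}

open scoped Classical in
/-- `PrFrom A σ s O` is the probability, under the strategy profile `σ`
(and nature's probabilities), that a play starting at `s` belongs to `O`.
It is defined as the Carathéodory outer measure generated by the natural
premeasure on cylinder sets. -/
noncomputable def PrFrom [DecidableEq V] (A : Arena k V) (σ : Profile k V)
    (s : V) : Set (Play V) → ℝ≥0∞ :=
  fun O =>
    MeasureTheory.OuterMeasure.ofFunction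
      (fun S => if S = ∅ then 0
                else ⨅ (w : List V) (_ : S ⊆ cyl w), wordProbFrom A σ s w)
      (by simp) O

/-- The payoff of player `i`: probability that the objective `O i` is met,
for the play started at the initial vertex. -/
noncomputable def Pay [DecidableEq V] (A : Arena k V)
    (O : Fin (k + 1) → Set (Play V)) (σ : Profile k V) (i : Fin (k + 1)) : ℝ≥0∞ :=
  PrFrom A σ A.init (O i)

/-! ### Equilibria and synthesis problems -/

/-- Nash equilibrium: no player has a profitable unilateral deviation. -/
def NE [DecidableEq V] (A : Arena k V) (O : Fin (k + 1) → Set (Play V))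
    (σ : Profile k V) : Prop :=
  ∀ i, ∀ τ : Strategy V, Strategy.Valid A τ →
    Pay A O (Function.update σ i τ) i ≤ Pay A O σ i

/-- 0-fixed Nash equilibrium: no environment player (`i ≠ 0`) has a
profitable unilateral deviation. -/
def ZeroNE [DecidableEq V] (A : Arena k V) (O : Fin (k + 1) → Set (Play V))
    (σ : Profile k V) : Prop :=
  ∀ i, i ≠ 0 → ∀ τ : Strategy V, Strategy.Valid A τ →
    Pay A O (Function.update σ i τ) i ≤ Pay A O σ i

/-- The (yes-instances of the) cooperative rational synthesis problem, with
all strategies restricted to class `C`: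
`∃ σ̄. NE(σ̄) ∧ Pay₀(σ̄) ≥ μ`. -/
def CRSPAnswer [DecidableEq V] (A : Arena k V) (O : Fin (k + 1) → Set (Play V))
    (C : Strategy V → Prop) (μ : ℚ) : Prop :=
  ∃ σ : Profile k V, Profile.Valid A σ ∧ (∀ i, C (σ i)) ∧ NE A O σ ∧
    ENNReal.ofReal (μ : ℝ) ≤ Pay A O σ 0

/-- The (yes-instances of the) non-cooperative rational synthesis problem,
with the system's strategy restricted to class `C0` and the environment
players' strategies restricted to class `Cenv`:
`∃ σ₀. ∀ σ̄₋₀. (0NE(σ̄) ⇒ Pay₀(σ̄) ≥ μ)`. -/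
def NCRSPAnswer [DecidableEq V] (A : Arena k V) (O : Fin (k + 1) → Set (Play V))
    (C0 Cenv : Strategy V → Prop) (μ : ℚ) : Prop :=
  ∃ σ0 : Strategy V, Strategy.Valid A σ0 ∧ C0 σ0 ∧
    ∀ σ : Profile k V, σ 0 = σ0 → Profile.Valid A σ →
      (∀ i, i ≠ 0 → Cenv (σ i)) →
      ZeroNE A O σ → ENNReal.ofReal (μ : ℝ) ≤ Pay A O σ 0

/-- The variant `NCRSP>` with strict payoff threshold. -/
def NCRSPgtAnswer [DecidableEq V] (A : Arena k V) (O : Fin (k + 1) → Set (Play V))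
    (C0 Cenv : Strategy V → Prop) (μ : ℚ) : Prop :=
  ∃ σ0 : Strategy V, Strategy.Valid A σ0 ∧ C0 σ0 ∧
    ∀ σ : Profile k V, σ 0 = σ0 → Profile.Valid A σ →
      (∀ i, i ≠ 0 → Cenv (σ i)) →
      ZeroNE A O σ → ENNReal.ofReal (μ : ℝ) < Pay A O σ 0

/-- The complement problem of `NCRSP>`:
`∀ σ₀. ∃ σ̄₋₀. (0NE(σ̄) ∧ Pay₀(σ̄) ≤ μ)`. -/
def CoNCRSPgtAnswer [DecidableEq V] (A : Arena k V) (O : Fin (k + 1) → Set (Play V))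
    (C0 Cenv : Strategy V → Prop) (μ : ℚ) : Prop :=
  ∀ σ0 : Strategy V, Strategy.Valid A σ0 → C0 σ0 →
    ∃ σ : Profile k V, σ 0 = σ0 ∧ Profile.Valid A σ ∧
      (∀ i, i ≠ 0 → Cenv (σ i)) ∧
      ZeroNE A O σ ∧ Pay A O σ 0 ≤ ENNReal.ofReal (μ : ℝ)

/-! ### Objectives -/

/-- Boolean formulas with variables drawn from `α`. -/
inductive BForm (α : Type) : Type
  | tru : BForm α
  | fls : BForm α
  | var : α → BForm α
  | not : BForm α → BForm α
  | and : BForm α → BForm α → BForm α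
  | or : BForm α → BForm α → BForm α

namespace BForm

def holds {α : Type} (θ : α → Prop) : BForm α → Prop
  | tru => True
  | fls => False
  | var a => θ a
  | not f => ¬ holds θ f
  | and f g => holds θ f ∧ holds θ g
  | or f g => holds θ f ∨ holds θ g

def map {α β : Type} (f : α → β) : BForm α → BForm β
  | tru => tru
  | fls => fls
  | var a => var (f a)
  | not g => not (map f g)
  | and g h => and (map f g) (map f h)
  | or g h => or (map f g) (map f h)

def subst {α β : Type} (f : α → BForm β) : BForm α → BForm β
  | tru => tru
  | fls => fls
  | var a => f a
  | not g => not (subst f g)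
  | and g h => and (subst f g) (subst f h)
  | or g h => or (subst f g) (subst f h)

def bigOr {α : Type} : List (BForm α) → BForm α
  | [] => fls
  | f :: fs => or f (bigOr fs)

/-- An (arbitrary but fixed) encoding of Boolean formulas over `ℕ` into `ℕ`. -/
def toNat : BForm ℕ → ℕ
  | tru => Nat.pair 0 0
  | fls => Nat.pair 1 0
  | var i => Nat.pair 2 i
  | not f => Nat.pair 3 (toNat f)
  | and f g => Nat.pair 4 (Nat.pair (toNat f) (toNat g))
  | or f g => Nat.pair 5 (Nat.pair (toNat f) (toNat g))

end BForm

/-- The Muller objective given by a Boolean formula over the vertices: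
the set of plays `π` such that `inf(π) ⊨ φ`. -/
def mullerObj (φ : BForm V) : Set (Play V) :=
  {π | BForm.holds (· ∈ infSet π) φ}

/-- Terminal-reachability objective for a set `F` of (terminal) vertices. -/
def trObjS (F : Set V) : Set (Play V) := {π | ∃ m, π m ∈ F}

/-- Terminal-reachability objective, Boolean-valued version. -/
def trObj (F : V → Bool) : Set (Play V) := trObjS {v | F v = true}

/-! ### End components -/

/-- `E` is an end component of the arena `A` regarded as an MDP of
player `i`: it is nonempty, strongly connected, every vertex of `E`
has a successor in `E`, and vertices not controlled by `i` have all
their successors in `E`. -/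
def IsEndComponent (A : Arena k V) (i : Fin (k + 1)) (E : Set V) : Prop :=
  E.Nonempty ∧
  (∀ u ∈ E, ∀ v ∈ E,
    Relation.ReflTransGen (fun a b => a ∈ E ∧ b ∈ E ∧ b ∈ A.next a) u v) ∧
  (∀ v ∈ E, (A.next v ∩ E).Nonempty) ∧
  (∀ v ∈ E, A.owner v ≠ some i → A.next v ⊆ E)

end NCRSPPaper

namespace NCRSPPaper

/-! ### A concrete machine model, resource-bounded classes, encodings -/

/-- A configuration of a machine with `s+1` states and tape alphabet
`Fin (a+3)` (symbol `0` is the blank, symbols `1`/`2` encode the input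
bits `false`/`true`), on a one-way infinite tape. -/
structure Cfg (s a : ℕ) where
  q : Fin (s + 1)
  tape : ℕ → Fin (a + 3)
  pos : ℕ

def blankSym (a : ℕ) : Fin (a + 3) := ⟨0, by omega⟩

def bitSym (a : ℕ) (b : Bool) : Fin (a + 3) :=
  if b then ⟨2, by omega⟩ else ⟨1, by omega⟩

def initCfg (s a : ℕ) (q0 : Fin (s + 1)) (x : List Bool) : Cfg s a :=
  ⟨q0, fun i => if h : i < x.length then bitSym a (x.get ⟨i, h⟩) else blankSym a, 0⟩

/-- The tape holds the output `y` (as bits, followed by a blank). -/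
def readsOff {a : ℕ} (tape : ℕ → Fin (a + 3)) (y : List Bool) : Prop :=
  (∀ i : Fin y.length, tape (i : ℕ) = bitSym a (y.get i)) ∧
  tape y.length = blankSym a

/-- A deterministic Turing machine (one-way infinite single tape). -/
structure TM where
  states : ℕ
  symbols : ℕ
  start : Fin (states + 1)
  accept : Fin (states + 1)
  step : Fin (states + 1) → Fin (symbols + 3) →
    Option (Fin (states + 1) × Fin (symbols + 3) × Bool)

namespace TM

def stepCfg (M : TM) (c : Cfg M.states M.symbols) : Option (Cfg M.states M.symbols) :=
  match M.step c.q (c.tape c.pos) with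
  | none => none
  | some (q', a, mv) =>
      some ⟨q', Function.update c.tape c.pos a, if mv then c.pos + 1 else c.pos - 1⟩

def run (M : TM) (x : List Bool) : ℕ → Option (Cfg M.states M.symbols)
  | 0 => some (initCfg M.states M.symbols M.start x)
  | t + 1 => (M.run x t).bind M.stepCfg

def Halted (M : TM) (c : Cfg M.states M.symbols) : Prop := M.stepCfg c = none

/-- `M` decides the language `L` (with no resource bound): on every input it
halts, and it halts in the accepting state iff the input is in `L`. -/
def Decides (M : TM) (L : Set (List Bool)) : Prop :=
  ∀ x, ∃ t c, M.run x t = some c ∧ M.Halted c ∧ (x ∈ L ↔ c.q = M.accept)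

/-- `M` decides `L` within time `T` (as a function of the input length). -/
def DecidesInTime (M : TM) (L : Set (List Bool)) (T : ℕ → ℕ) : Prop :=
  ∀ x, ∃ t ≤ T x.length, ∃ c, M.run x t = some c ∧ M.Halted c ∧
    (x ∈ L ↔ c.q = M.accept)

/-- `M` decides `L` within space `S`: it halts with the correct verdict and
never moves its head beyond cell `S(|x|)`. -/
def DecidesInSpace (M : TM) (L : Set (List Bool)) (S : ℕ → ℕ) : Prop :=
  ∀ x, (∃ t c, M.run x t = some c ∧ M.Halted c ∧ (x ∈ L ↔ c.q = M.accept)) ∧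
    ∀ t c, M.run x t = some c → c.pos < S x.length

/-- `M` computes, on the encoded inputs `g x`, the encoded outputs `h x`,
within time `T`. -/
def ComputesOn {I : Type} (M : TM) (g h : I → List Bool) (T : ℕ → ℕ) : Prop :=
  ∀ x, ∃ t ≤ T (g x).length, ∃ c, M.run (g x) t = some c ∧ M.Halted c ∧
    readsOff c.tape (h x)

/-- `M` computes the function `f` on all inputs within time `T`. -/
def ComputesInTime (M : TM) (f : List Bool → List Bool) (T : ℕ → ℕ) : Prop :=
  M.ComputesOn id f T

end TM

/-- A nondeterministic Turing machine. -/
structure NTM where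
  states : ℕ
  symbols : ℕ
  start : Fin (states + 1)
  accept : Fin (states + 1)
  step : Fin (states + 1) → Fin (symbols + 3) →
    Finset (Fin (states + 1) × Fin (symbols + 3) × Bool)

namespace NTM

def stepRel (M : NTM) (c c' : Cfg M.states M.symbols) : Prop :=
  ∃ r ∈ M.step c.q (c.tape c.pos),
    c' = ⟨r.1, Function.update c.tape c.pos r.2.1,
          if r.2.2 then c.pos + 1 else c.pos - 1⟩

/-- `M` has an accepting run on `x` staying within space `S`. -/
def AcceptsInSpace (M : NTM) (x : List Bool) (S : ℕ) : Prop :=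
  ∃ (t : ℕ) (cs : ℕ → Cfg M.states M.symbols),
    cs 0 = initCfg M.states M.symbols M.start x ∧
    (∀ i < t, M.stepRel (cs i) (cs (i + 1))) ∧
    (cs t).q = M.accept ∧
    ∀ i ≤ t, (cs i).pos < S

/-- The nondeterministic machine `M` decides `L` within space `S`. -/
def DecidesInSpace (M : NTM) (L : Set (List Bool)) (S : ℕ → ℕ) : Prop :=
  ∀ x, x ∈ L ↔ M.AcceptsInSpace x (S x.length)

end NTM

/-! #### Complexity classes -/

def In2EXPTIME (L : Set (List Bool)) : Prop :=
  ∃ (M : TM) (c : ℕ), M.DecidesInTime L (fun n => 2 ^ 2 ^ (n ^ c + c))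

def In3EXPTIME (L : Set (List Bool)) : Prop :=
  ∃ (M : TM) (c : ℕ), M.DecidesInTime L (fun n => 2 ^ 2 ^ 2 ^ (n ^ c + c))

def InPSPACE (L : Set (List Bool)) : Prop :=
  ∃ (M : TM) (c : ℕ), M.DecidesInSpace L (fun n => n ^ c + c)

def InEXPSPACE (L : Set (List Bool)) : Prop :=
  ∃ (M : TM) (c : ℕ), M.DecidesInSpace L (fun n => 2 ^ (n ^ c + c))

def InNEXPSPACE (L : Set (List Bool)) : Prop :=
  ∃ (M : NTM) (c : ℕ), M.DecidesInSpace L (fun n => 2 ^ (n ^ c + c))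

/-- A language is undecidable if no machine decides it. -/
def Undecidable (L : Set (List Bool)) : Prop := ¬ ∃ M : TM, M.Decides L

def PolytimeComputable (f : List Bool → List Bool) : Prop :=
  ∃ (M : TM) (c : ℕ), M.ComputesInTime f (fun n => n ^ c + c)

def PolytimeReducible (L L' : Set (List Bool)) : Prop :=
  ∃ f, PolytimeComputable f ∧ ∀ x, x ∈ L ↔ f x ∈ L'

def PSPACEHard (L' : Set (List Bool)) : Prop :=
  ∀ L, InPSPACE L → PolytimeReducible L L'

/-- The language of (the encodings of) the yes-instances of a decision
problem `P` on instances of type `I`, for an encoding `enc`. -/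
def langOf {I : Type} (enc : I → List Bool) (P : I → Prop) : Set (List Bool) :=
  {w | ∃ x, enc x = w ∧ P x}

/-! #### Encoding of game instances -/

/-- A concrete encoding of an arena over `Fin n` as a natural number. -/
def encodeArena {k n : ℕ} (A : Arena k (Fin n)) : ℕ :=
  Encodable.encode
    ( k, n,
      List.ofFn (fun v : Fin n => (A.owner v).map Fin.val),
      List.ofFn (fun v : Fin n => List.ofFn (fun w : Fin n => A.edge v w)),
      List.ofFn (fun v : Fin n => List.ofFn (fun w : Fin n => A.prob v w)),
      (A.init : ℕ) )

/-- An instance of NCRSP with Muller objectives: an SMG over vertices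
`Fin n` with players `Fin (k+1)`, Muller objectives given by Boolean
formulas, and a threshold `μ ∈ [0,1]`. -/
structure MullerInstance where
  k : ℕ
  n : ℕ
  A : Arena k (Fin n)
  obj : Fin (k + 1) → BForm (Fin n)
  μ : ℚ
  wf : A.WF
  hμ0 : 0 ≤ μ
  hμ1 : μ ≤ 1

def encodeMullerInstance (I : MullerInstance) : List Bool :=
  Nat.bits (Encodable.encode
    ( encodeArena I.A,
      List.ofFn (fun i => (BForm.map Fin.val (I.obj i)).toNat),
      Encodable.encode I.μ ))

/-- An instance of NCRSP with terminal-reachability objectives. -/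
structure TRInstance where
  k : ℕ
  n : ℕ
  A : Arena k (Fin n)
  F : Fin (k + 1) → Fin n → Bool
  μ : ℚ
  wf : A.WF
  hterm : ∀ i v, F i v = true → A.terminal v
  hμ0 : 0 ≤ μ
  hμ1 : μ ≤ 1

def encodeTRInstance (I : TRInstance) : List Bool :=
  Nat.bits (Encodable.encode
    ( encodeArena I.A,
      List.ofFn (fun i => List.ofFn (fun v => I.F i v)),
      Encodable.encode I.μ ))

/-- An instance of `t`-memory NCRSP with Muller objectives. -/
structure MullerTInstance where
  k : ℕ
  n : ℕ
  A : Arena k (Fin n)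
  obj : Fin (k + 1) → BForm (Fin n)
  t : ℕ
  μ : ℚ
  wf : A.WF
  hμ0 : 0 ≤ μ
  hμ1 : μ ≤ 1

def encodeMullerTInstance (I : MullerTInstance) : List Bool :=
  Nat.bits (Encodable.encode
    ( encodeArena I.A,
      List.ofFn (fun i => (BForm.map Fin.val (I.obj i)).toNat),
      I.t,
      Encodable.encode I.μ ))

/-- An instance of `t`-memory NCRSP on a non-stochastic game (NSMG,
no nature vertices) with terminal-reachability objectives. -/
structure TRTInstance where
  k : ℕ
  n : ℕ
  A : Arena k (Fin n)
  F : Fin (k + 1) → Fin n → Bool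
  t : ℕ
  μ : ℚ
  wf : A.WF
  nonature : ∀ v, A.owner v ≠ none
  hterm : ∀ i v, F i v = true → A.terminal v
  hμ0 : 0 ≤ μ
  hμ1 : μ ≤ 1

def encodeTRTInstance (I : TRTInstance) : List Bool :=
  Nat.bits (Encodable.encode
    ( encodeArena I.A,
      List.ofFn (fun i => List.ofFn (fun v => I.F i v)),
      I.t,
      Encodable.encode I.μ ))

end NCRSPPaper

namespace NCRSPPaper

/-! ### First-order logic over the ordered field of real numbers -/

/-- Terms over the signature `(+, ×, 0, 1)`, with de Bruijn variables. -/
inductive RTerm : Type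
  | var : ℕ → RTerm
  | zero : RTerm
  | one : RTerm
  | add : RTerm → RTerm → RTerm
  | mul : RTerm → RTerm → RTerm

namespace RTerm

noncomputable def eval (ρ : ℕ → ℝ) : RTerm → ℝ
  | var i => ρ i
  | zero => 0
  | one => 1
  | add s t => eval ρ s + eval ρ t
  | mul s t => eval ρ s * eval ρ t

def toNat : RTerm → ℕ
  | var i => Nat.pair 0 i
  | zero => Nat.pair 1 0
  | one => Nat.pair 2 0
  | add s t => Nat.pair 3 (Nat.pair (toNat s) (toNat t))
  | mul s t => Nat.pair 4 (Nat.pair (toNat s) (toNat t))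

end RTerm

/-- First-order formulas over the signature `(+, ×, 0, 1, ≤)`, with de
Bruijn variables. -/
inductive RForm : Type
  | le : RTerm → RTerm → RForm
  | not : RForm → RForm
  | and : RForm → RForm → RForm
  | or : RForm → RForm → RForm
  | ex : RForm → RForm
  | all : RForm → RForm

namespace RForm

/-- Satisfaction in the structure `(ℝ, +, ×, 0, 1, ≤)`. -/
def holds : (ℕ → ℝ) → RForm → Prop
  | ρ, le s t => RTerm.eval ρ s ≤ RTerm.eval ρ t
  | ρ, not f => ¬ holds ρ f
  | ρ, and f g => holds ρ f ∧ holds ρ g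
  | ρ, or f g => holds ρ f ∨ holds ρ g
  | ρ, ex f => ∃ x : ℝ, holds (fun i => match i with | 0 => x | j + 1 => ρ j) f
  | ρ, all f => ∀ x : ℝ, holds (fun i => match i with | 0 => x | j + 1 => ρ j) f

/-- Validity (truth in `(ℝ, +, ×, 0, 1, ≤)` under every assignment;
for sentences this is just truth). -/
def valid (f : RForm) : Prop := ∀ ρ, holds ρ f

/-- Quantifier-free formulas. -/
def QFree : RForm → Prop
  | le _ _ => True
  | not f => QFree f
  | and f g => QFree f ∧ QFree g
  | or f g => QFree f ∧ QFree g
  | ex _ => False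
  | all _ => False

/-- Existential formulas: a block of existential quantifiers applied to a
quantifier-free formula (prenex form with only existential quantifiers). -/
inductive IsExistential : RForm → Prop
  | qf {f : RForm} : QFree f → IsExistential f
  | ex {f : RForm} : IsExistential f → IsExistential (RForm.ex f)

def toNat : RForm → ℕ
  | le s t => Nat.pair 0 (Nat.pair s.toNat t.toNat)
  | not f => Nat.pair 1 (toNat f)
  | and f g => Nat.pair 2 (Nat.pair (toNat f) (toNat g))
  | or f g => Nat.pair 3 (Nat.pair (toNat f) (toNat g))
  | ex f => Nat.pair 4 (toNat f)
  | all f => Nat.pair 5 (toNat f)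

end RForm

def encodeRForm (f : RForm) : List Bool := Nat.bits f.toNat

/-! ### Quantified Boolean formulas -/

/-- Truth of a prenex QBF: `qs` is the (outermost-first) list of
quantifiers (`true` = `∀`, `false` = `∃`); the quantifier at the head of a
suffix of length `j+1` binds variable `j`. -/
def qbfHolds (φ : BForm ℕ) : List Bool → (ℕ → Bool) → Prop
  | [], ρ => BForm.holds (fun i => ρ i = true) φ
  | q :: qs, ρ =>
      if q then ∀ b : Bool, qbfHolds φ qs (Function.update ρ qs.length b)
      else ∃ b : Bool, qbfHolds φ qs (Function.update ρ qs.length b)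

/-- Variables of a Boolean formula are `< m`. -/
def BForm.varsLT (m : ℕ) : BForm ℕ → Prop
  | BForm.tru => True
  | BForm.fls => True
  | BForm.var i => i < m
  | BForm.not f => f.varsLT m
  | BForm.and f g => f.varsLT m ∧ g.varsLT m
  | BForm.or f g => f.varsLT m ∧ g.varsLT m

/-- A prenex quantified Boolean formula with `quants.length` variables. -/
structure QBFInst where
  quants : List Bool
  matrix : BForm ℕ
  wf : matrix.varsLT quants.length

def QBFInst.IsTrue (Q : QBFInst) : Prop :=
  qbfHolds Q.matrix Q.quants (fun _ => false)

def encodeQBFInst (Q : QBFInst) : List Bool :=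
  Nat.bits (Encodable.encode (Q.quants, Q.matrix.toNat))

end NCRSPPaper

namespace NCRSPPaper

/-- The yes-instances of TR-NCRSP_> with all strategies (of the system, of
the environment players, and for deviations) in the class `C`. -/
def TRInstance.AnswerGt (C : {n : ℕ} → Strategy (Fin n) → Prop)
    (I : TRInstance) : Prop :=
  NCRSPgtAnswer I.A (fun i => trObj (I.F i))
    (fun σ => C σ) (fun σ => C σ) I.μ

end NCRSPPaper

open scoped ENNReal

namespace NCRSPPaper

section ReachProb

variable {k : ℕ} {V : Type}

theorem stepProb_sum [Fintype V] {A : Arena k V} (hA : A.WF) (σ : Profile k V) (h : List V) (u : V) :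
    ∑ v, A.stepProb σ h u v = 1 := by
  unfold Arena.stepProb
  cases ho : A.owner u with
  | none =>
    have := hA.2 u ho
    simp only
    rw [← ENNReal.ofReal_sum_of_nonneg (fun v _ => by exact_mod_cast this.1 v)]
    rw [← Rat.cast_sum, this.2]; simp
  | some i =>
    simp only
    rw [← tsum_fintype (L := .unconditional V)]
    exact (σ i h u).tsum_coe

theorem extProb_snoc (A : Arena k V) (σ : Profile k V) (v u' : V) (rest : List V) :
    ∀ (hist : List V) (u : V) (l : List V), u :: rest = l ++ [u'] →
      extProb A σ hist u (rest ++ [v]) = extProb A σ hist u rest * A.stepProb σ (hist ++ l) u' v := by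
  induction rest with
  | nil =>
    intro hist u l h
    rcases l with _ | ⟨a, l⟩
    · simp at h; subst h; simp [extProb]
    · simp at h
  | cons x r ih =>
    intro hist u l h
    rcases l with _ | ⟨a, l⟩
    · simp at h
    · simp only [List.cons_append, List.cons.injEq] at h
      obtain ⟨rfl, h⟩ := h
      have := ih (hist ++ [u]) x l h
      simp only [List.cons_append, extProb, this]
      simp [mul_assoc]

variable [DecidableEq V]

theorem wordProbFrom_snoc (A : Arena k V) (σ : Profile k V) (s : V) (h : List V) (u v : V) :
    wordProbFrom A σ s (h ++ [u] ++ [v]) =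
      wordProbFrom A σ s (h ++ [u]) * A.stepProb σ h u v := by
  obtain ⟨x, rest, hx⟩ : ∃ x rest, h ++ [u] = x :: rest := by
    cases h <;> simp
  rw [hx, List.cons_append]
  simp only [wordProbFrom]
  rw [extProb_snoc A σ v u rest [] x h hx.symm]
  simp [mul_assoc]

variable [Fintype V]

/-- `n`-step expectation of a function of the history and the current vertex. -/
noncomputable def iterExp (A : Arena k V) (σ : Profile k V) (f : List V → V → ℝ≥0∞) :
    ℕ → List V → V → ℝ≥0∞
  | 0, h, u => f h u
  | n + 1, h, u => ∑ v, A.stepProb σ h u v * iterExp A σ f n (h ++ [u]) v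

open scoped Classical in
/-- Indicator of a vertex set as a function of the history and the current vertex. -/
noncomputable def indF (F : Set V) : List V → V → ℝ≥0∞ := fun _ u => if u ∈ F then 1 else 0

open scoped Classical in
/-- Probability of entering `F` in the next step from outside. -/
noncomputable def crossF (A : Arena k V) (σ : Profile k V) (F : Set V) : List V → V → ℝ≥0∞ :=
  fun h u => if u ∈ F then 0 else iterExp A σ (indF F) 1 h u

/-- Probability of reaching `F` from the current vertex after the given history. -/
noncomputable def reachVal (A : Arena k V) (σ : Profile k V) (F : Set V) (h : List V) (u : V) : ℝ≥0∞ :=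
  ⨆ n, iterExp A σ (indF F) n h u

theorem iterExp_add (A : Arena k V) (σ : Profile k V) (f g : List V → V → ℝ≥0∞) (n : ℕ) :
    ∀ h u, iterExp A σ (fun h u => f h u + g h u) n h u =
      iterExp A σ f n h u + iterExp A σ g n h u := by
  induction n with
  | zero => intro h u; rfl
  | succ n ih => intro h u; simp [iterExp, ih, mul_add, Finset.sum_add_distrib]

theorem iterExp_congr (A : Arena k V) (σ : Profile k V) {f g : List V → V → ℝ≥0∞}
    (hfg : ∀ h u, f h u = g h u) (n : ℕ) (h : List V) (u : V) :
    iterExp A σ f n h u = iterExp A σ g n h u := by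
  have : f = g := by funext h u; exact hfg h u
  rw [this]

theorem iterExp_shift (A : Arena k V) (σ : Profile k V) (f : List V → V → ℝ≥0∞) (n : ℕ) :
    ∀ h u, iterExp A σ (iterExp A σ f 1) n h u = iterExp A σ f (n + 1) h u := by
  induction n with
  | zero => intro h u; rfl
  | succ n ih =>
    intro h u
    rw [iterExp, iterExp]
    exact Finset.sum_congr rfl fun v _ => by rw [ih]

theorem iterExp_le_one {A : Arena k V} (hA : A.WF) (σ : Profile k V) {f : List V → V → ℝ≥0∞}
    (hf : ∀ h u, f h u ≤ 1) (n : ℕ) : ∀ h u, iterExp A σ f n h u ≤ 1 := by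
  induction n with
  | zero => exact hf
  | succ n ih =>
    intro h u
    rw [iterExp, ← stepProb_sum hA σ h u]
    exact Finset.sum_le_sum fun v _ => mul_le_of_le_one_right' (ih _ _)

theorem indF_le_one (F : Set V) (h : List V) (u : V) : indF F h u ≤ 1 := by
  unfold indF; split_ifs <;> simp

theorem Profile.Valid.step_mem {A : Arena k V} {σ : Profile k V} (hσ : Profile.Valid A σ)
    {h : List V} {u v : V} (hp : A.stepProb σ h u v ≠ 0) : v ∈ A.next u := by
  unfold Arena.stepProb at hp
  rcases ho : A.owner u with _ | i
  · rw [ho] at hp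
    refine Or.inl ⟨ho, ?_⟩
    simp only at hp
    by_contra hc
    apply hp
    apply ENNReal.ofReal_of_nonpos
    exact_mod_cast not_lt.mp hc
  · rw [ho] at hp
    exact hσ i h u v hp

theorem stepProb_terminal {A : Arena k V} (hA : A.WF) {σ : Profile k V} (hσ : Profile.Valid A σ)
    {h : List V} {u : V} (hu : A.terminal u) (v : V) :
    A.stepProb σ h u v = if v = u then 1 else 0 := by
  have h0 : ∀ v, v ≠ u → A.stepProb σ h u v = 0 := by
    intro v hv
    by_contra hc
    have := Profile.Valid.step_mem hσ hc
    rw [hu] at this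
    exact hv this
  split_ifs with hv
  · subst hv
    rw [← stepProb_sum hA σ h v, Finset.sum_eq_single v] <;> simp_all
  · exact h0 v hv

theorem iterExp_terminal {A : Arena k V} (hA : A.WF) {σ : Profile k V} (hσ : Profile.Valid A σ)
    (F : Set V) {u : V} (hu : A.terminal u) (n : ℕ) :
    ∀ h, iterExp A σ (indF F) n h u = indF F h u := by
  induction n with
  | zero => intro h; rfl
  | succ n ih =>
    intro h
    simp [iterExp, stepProb_terminal hA hσ hu, ih]
    rfl

theorem indF_add_crossF {A : Arena k V} (hA : A.WF) {σ : Profile k V} (hσ : Profile.Valid A σ)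
    {F : Set V} (hF : ∀ v ∈ F, A.terminal v) (h : List V) (u : V) :
    indF F h u + crossF A σ F h u = iterExp A σ (indF F) 1 h u := by
  unfold crossF
  split_ifs with hu
  · rw [iterExp_terminal hA hσ F (hF u hu)]; simp
  · simp [indF, hu]

theorem iterExp_succ_eq {A : Arena k V} (hA : A.WF) {σ : Profile k V} (hσ : Profile.Valid A σ)
    {F : Set V} (hF : ∀ v ∈ F, A.terminal v) (n : ℕ) (h : List V) (u : V) :
    iterExp A σ (indF F) n h u + iterExp A σ (crossF A σ F) n h u =
      iterExp A σ (indF F) (n + 1) h u := by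
  rw [← iterExp_add, ← iterExp_shift]
  exact iterExp_congr A σ (indF_add_crossF hA hσ hF) n h u

theorem iterExp_mono {A : Arena k V} (hA : A.WF) {σ : Profile k V} (hσ : Profile.Valid A σ)
    {F : Set V} (hF : ∀ v ∈ F, A.terminal v) (h : List V) (u : V) :
    Monotone fun n => iterExp A σ (indF F) n h u :=
  monotone_nat_of_le_succ fun n => by
    rw [← iterExp_succ_eq hA hσ hF]; exact le_self_add

theorem reachVal_le_one {A : Arena k V} (hA : A.WF) (σ : Profile k V) (F : Set V) (h : List V) (u : V) :
    reachVal A σ F h u ≤ 1 :=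
  iSup_le fun n => iterExp_le_one hA σ (indF_le_one F) n h u

theorem reachVal_terminal {A : Arena k V} (hA : A.WF) {σ : Profile k V} (hσ : Profile.Valid A σ)
    (F : Set V) {u : V} (hu : A.terminal u) (h : List V) :
    reachVal A σ F h u = indF F h u := by
  unfold reachVal
  simp [iterExp_terminal hA hσ F hu]

theorem reachVal_step {A : Arena k V} (hA : A.WF) {σ : Profile k V} (hσ : Profile.Valid A σ)
    {F : Set V} (hF : ∀ v ∈ F, A.terminal v) (h : List V) (u : V) :
    reachVal A σ F h u = ∑ v, A.stepProb σ h u v * reachVal A σ F (h ++ [u]) v := by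
  have h1 : reachVal A σ F h u = ⨆ n, iterExp A σ (indF F) (n + 1) h u := by
    unfold reachVal
    exact ((iterExp_mono hA hσ hF h u).iSup_nat_add 1).symm
  rw [h1]
  simp only [iterExp, reachVal, ENNReal.mul_iSup]
  rw [ENNReal.finsetSum_iSup_of_monotone]
  intro v m n hmn
  exact mul_le_mul_right (iterExp_mono hA hσ hF (h ++ [u]) v hmn) _

theorem mem_cyl_snoc {w : List V} {v : V} {π : Play V} :
    π ∈ cyl (w ++ [v]) ↔ π ∈ cyl w ∧ π w.length = v := by
  simp only [cyl, Set.mem_ofPred_eq, List.get_eq_getElem]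
  constructor
  · intro h
    refine ⟨fun i hi => ?_, ?_⟩
    · rw [h i (by simp; omega), List.getElem_append_left hi]
    · rw [h w.length (by simp)]; simp
  · rintro ⟨h1, h2⟩ i hi
    by_cases hiw : i < w.length
    · rw [h1 i hiw, List.getElem_append_left hiw]
    · have : i = w.length := by simp at hi; omega
      subst this; simp [h2]

theorem PrFrom_cyl_le (A : Arena k V) (σ : Profile k V) (s : V) (w : List V) :
    PrFrom A σ s (cyl w) ≤ wordProbFrom A σ s w := by
  unfold PrFrom
  refine (MeasureTheory.OuterMeasure.ofFunction_le _).trans ?_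
  split_ifs
  · simp
  · exact iInf₂_le w (Set.Subset.refl _)

theorem PrFrom_mono (A : Arena k V) (σ : Profile k V) (s : V) {S T : Set (Play V)} (h : S ⊆ T) :
    PrFrom A σ s S ≤ PrFrom A σ s T := by
  unfold PrFrom; exact MeasureTheory.measure_mono h

theorem PrFrom_empty (A : Arena k V) (σ : Profile k V) (s : V) : PrFrom A σ s ∅ = 0 := by
  unfold PrFrom; exact MeasureTheory.measure_empty

theorem PrFrom_union_le (A : Arena k V) (σ : Profile k V) (s : V) (S T : Set (Play V)) :
    PrFrom A σ s (S ∪ T) ≤ PrFrom A σ s S + PrFrom A σ s T := by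
  unfold PrFrom; exact MeasureTheory.measure_union_le _ _

theorem PrFrom_iUnion_nat_le (A : Arena k V) (σ : Profile k V) (s : V) (S : ℕ → Set (Play V)) :
    PrFrom A σ s (⋃ n, S n) ≤ ∑' n, PrFrom A σ s (S n) := by
  unfold PrFrom; exact MeasureTheory.measure_iUnion_le _

theorem PrFrom_iUnion_fintype_le (A : Arena k V) (σ : Profile k V) (s : V) (S : V → Set (Play V)) :
    PrFrom A σ s (⋃ n, S n) ≤ ∑ n, PrFrom A σ s (S n) := by
  unfold PrFrom
  exact MeasureTheory.measure_iUnion_fintype_le _ _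

theorem PrFrom_inter_le_iterExp (A : Arena k V) (σ : Profile k V) (s : V)
    (E : ℕ → Set (Play V)) (f : List V → V → ℝ≥0∞)
    (hE : ∀ h u, PrFrom A σ s (cyl (h ++ [u]) ∩ E h.length) ≤
      wordProbFrom A σ s (h ++ [u]) * f h u) (n : ℕ) :
    ∀ h u, PrFrom A σ s (cyl (h ++ [u]) ∩ E (h.length + n)) ≤
      wordProbFrom A σ s (h ++ [u]) * iterExp A σ f n h u := by
  induction n with
  | zero => exact hE
  | succ n ih =>
    intro h u
    have hsub : cyl (h ++ [u]) ∩ E (h.length + (n + 1)) ⊆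
        ⋃ v, (cyl (h ++ [u] ++ [v]) ∩ E ((h ++ [u]).length + n)) := by
      rintro π ⟨h1, h2⟩
      simp only [Set.mem_iUnion]
      refine ⟨π (h ++ [u]).length, mem_cyl_snoc.2 ⟨h1, rfl⟩, ?_⟩
      have : (h ++ [u]).length + n = h.length + (n + 1) := by simp; omega
      rw [this]; exact h2
    refine (PrFrom_mono A σ s hsub).trans ((PrFrom_iUnion_fintype_le A σ s _).trans ?_)
    rw [iterExp, Finset.mul_sum]
    refine Finset.sum_le_sum fun v _ => (ih _ _).trans ?_
    rw [wordProbFrom_snoc, mul_assoc]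

theorem PrFrom_reach_le {A : Arena k V} (hA : A.WF) {σ : Profile k V} (hσ : Profile.Valid A σ)
    {F : Set V} (hF : ∀ v ∈ F, A.terminal v) (s : V) :
    PrFrom A σ s (trObjS F) ≤ reachVal A σ F [] s := by
  classical
  have hs : wordProbFrom A σ s [s] = 1 := by simp [wordProbFrom, extProb]
  set E0 : ℕ → Set (Play V) := fun n => {π | π n ∈ F}
  set E : ℕ → Set (Play V) := fun n => {π | π n ∉ F ∧ π (n + 1) ∈ F}
  have hE0 : ∀ h u, PrFrom A σ s (cyl (h ++ [u]) ∩ E0 h.length) ≤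
      wordProbFrom A σ s (h ++ [u]) * indF F h u := by
    intro h u
    by_cases hu : u ∈ F
    · simp only [indF, hu, if_true, mul_one]
      exact (PrFrom_mono A σ s Set.inter_subset_left).trans (PrFrom_cyl_le _ _ _ _)
    · have : cyl (h ++ [u]) ∩ E0 h.length = ∅ := by
        ext π
        simp only [Set.mem_inter_iff, mem_cyl_snoc, Set.mem_empty_iff_false, iff_false, E0,
          Set.mem_ofPred_eq]
        rintro ⟨⟨_, h1⟩, h2⟩
        rw [h1] at h2; exact hu h2
      rw [this, PrFrom_empty]; simp
  have hE : ∀ h u, PrFrom A σ s (cyl (h ++ [u]) ∩ E h.length) ≤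
      wordProbFrom A σ s (h ++ [u]) * crossF A σ F h u := by
    intro h u
    by_cases hu : u ∈ F
    · have : cyl (h ++ [u]) ∩ E h.length = ∅ := by
        ext π
        simp only [Set.mem_inter_iff, mem_cyl_snoc, Set.mem_empty_iff_false, iff_false, E,
          Set.mem_ofPred_eq]
        rintro ⟨⟨_, h1⟩, h2, _⟩
        rw [h1] at h2; exact h2 hu
      rw [this, PrFrom_empty]; simp
    · simp only [crossF, hu, if_false]
      refine le_trans (PrFrom_mono A σ s ?_)
        (PrFrom_inter_le_iterExp A σ s E0 (indF F) hE0 1 h u)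
      rintro π ⟨h1, _, h3⟩
      exact ⟨h1, h3⟩
  have hcov : trObjS F ⊆ (⋃ v, if v = s then ∅ else cyl [v]) ∪
      ((cyl ([] ++ [s]) ∩ E0 ([] : List V).length) ∪ ⋃ n, (cyl ([] ++ [s]) ∩ E (([] : List V).length + n))) := by
    rintro π ⟨m, hm⟩
    by_cases h0 : π 0 = s
    · right
      have hc : π ∈ cyl ([] ++ [s]) := by
        rw [mem_cyl_snoc]
        refine ⟨?_, h0⟩
        intro i hi; simp at hi
      by_cases hF0 : π 0 ∈ F
      · exact Or.inl ⟨hc, hF0⟩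
      · right
        have hex : ∃ m, π m ∈ F := ⟨m, hm⟩
        have h1 := Nat.find_spec hex
        have hpos : Nat.find hex ≠ 0 := by
          intro h; rw [h] at h1; exact hF0 h1
        obtain ⟨j, hj⟩ := Nat.exists_eq_succ_of_ne_zero hpos
        simp only [Set.mem_iUnion]
        refine ⟨j, hc, ?_⟩
        simp only [E, Set.mem_ofPred_eq, List.length_nil, zero_add]
        refine ⟨Nat.find_min hex (by omega), ?_⟩
        rw [hj] at h1; exact h1
    · left
      simp only [Set.mem_iUnion]
      refine ⟨π 0, ?_⟩
      simp only [h0, if_false]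
      exact (mem_cyl_snoc (w := []) ).2 ⟨by intro i hi; simp at hi, rfl⟩
  refine (PrFrom_mono A σ s hcov).trans ((PrFrom_union_le A σ s _ _).trans ?_)
  have hz : PrFrom A σ s (⋃ v, if v = s then ∅ else cyl [v]) = 0 := by
    refine le_antisymm ((PrFrom_iUnion_fintype_le A σ s _).trans ?_) bot_le
    refine le_of_eq (Finset.sum_eq_zero fun v _ => ?_)
    split_ifs with hv
    · exact PrFrom_empty _ _ _
    · refine le_antisymm ((PrFrom_cyl_le A σ s [v]).trans ?_) bot_le
      simp [wordProbFrom, hv]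
  rw [hz, zero_add]
  refine (PrFrom_union_le A σ s _ _).trans ?_
  refine (add_le_add (hE0 [] s) (PrFrom_iUnion_nat_le A σ s _)).trans ?_
  refine (add_le_add le_rfl (ENNReal.tsum_le_tsum fun n =>
    PrFrom_inter_le_iterExp A σ s E _ hE n [] s)).trans ?_
  simp only [List.nil_append, hs, one_mul]
  rw [ENNReal.tsum_eq_iSup_nat, ENNReal.add_iSup]
  refine iSup_le fun n => ?_
  have : indF F [] s + ∑ i ∈ Finset.range n, iterExp A σ (crossF A σ F) i [] s =
      iterExp A σ (indF F) n [] s := by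
    induction n with
    | zero => simp [iterExp]
    | succ n ih => rw [Finset.sum_range_succ, ← add_assoc, ih, iterExp_succ_eq hA hσ hF]
  rw [this]
  exact le_iSup (fun n => iterExp A σ (indF F) n [] s) n

/-- Mass of the intersection of the cylinders of `w` and of an optional word. -/
noncomputable def interMass (A : Arena k V) (σ : Profile k V) (s : V) (w : List V) :
    Option (List V) → ℝ≥0∞
  | none => 0
  | some w' => if w' <+: w then wordProbFrom A σ s w
      else if w <+: w' then wordProbFrom A σ s w' else 0

theorem sum_interMass_le {A : Arena k V} (hA : A.WF) (σ : Profile k V) (s : V)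
    (h : List V) (u : V) (o : Option (List V)) :
    ∑ v, interMass A σ s (h ++ [u] ++ [v]) o ≤ interMass A σ s (h ++ [u]) o := by
  cases o with
  | none => simp [interMass]
  | some w' =>
    by_cases h1 : w' <+: h ++ [u]
    · have : ∀ v, w' <+: h ++ [u] ++ [v] := fun v => h1.trans (List.prefix_append _ _)
      simp only [interMass, this, h1, if_true, wordProbFrom_snoc]
      rw [← Finset.mul_sum, stepProb_sum hA, mul_one]
    · by_cases h2 : h ++ [u] <+: w'
      · obtain ⟨t, ht⟩ := h2
        rcases t with _ | ⟨x, t⟩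
        · exact absurd (by simp [← ht]) h1
        · have hx : ∀ v, v ≠ x → interMass A σ s (h ++ [u] ++ [v]) (some w') = 0 := by
            intro v hv
            have e1 : ¬ w' <+: h ++ [u] ++ [v] := by
              rw [← ht]
              intro hp
              rw [List.prefix_append_right_inj] at hp
              have := List.cons_prefix_cons.1 hp
              exact hv this.1.symm
            have e2 : ¬ h ++ [u] ++ [v] <+: w' := by
              rw [← ht]
              intro hp
              rw [List.prefix_append_right_inj] at hp
              have := List.cons_prefix_cons.1 hp
              exact hv this.1
            simp [interMass, -List.append_assoc, e1, e2]
          rw [Finset.sum_eq_single x (fun v _ hv => hx v hv) (by simp)]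
          have e3 : h ++ [u] ++ [x] <+: w' := by
            rw [← ht, List.prefix_append_right_inj]
            simp
          have e4 : h ++ [u] <+: w' := ⟨_, ht⟩
          simp only [interMass, h1, e4, e3, if_true, if_false]
          split_ifs with h5
          · have : w' = h ++ [u] ++ [x] := h5.eq_of_length (le_antisymm h5.length_le e3.length_le)
            rw [this]
          · exact le_rfl
      · have e1 : ∀ v, ¬ h ++ [u] ++ [v] <+: w' :=
          fun v hp => h2 ((List.prefix_append _ _).trans hp)
        have e2 : ∀ v, ¬ w' <+: h ++ [u] ++ [v] := by
          intro v hp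
          rcases List.prefix_concat_iff.1 hp with h3 | h3
          · exact h2 (h3 ▸ List.prefix_append _ _)
          · exact h1 h3
        simp [interMass, -List.append_assoc, e1, e2]

theorem sum_coverMass_le {A : Arena k V} (hA : A.WF) (σ : Profile k V) (s : V)
    (c : ℕ → Option (List V)) (h : List V) (u : V) :
    ∑ v, ∑' i, interMass A σ s (h ++ [u] ++ [v]) (c i) ≤ ∑' i, interMass A σ s (h ++ [u]) (c i) := by
  rw [← Summable.tsum_finsetSum (fun _ _ => ENNReal.summable)]
  exact ENNReal.tsum_le_tsum fun i => sum_interMass_le hA σ s h u (c i)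

theorem exists_lt_of_sum_lt_sum' {ι : Type*} [Fintype ι] {f g : ι → ℝ≥0∞}
    (h : ∑ i, f i < ∑ i, g i) : ∃ i, f i < g i := by
  by_contra hc
  push Not at hc
  exact absurd h (not_lt.2 (Finset.sum_le_sum fun i _ => hc i))

theorem exists_play_avoiding {A : Arena k V} (hA : A.WF) (σ : Profile k V) (s : V)
    (c : ℕ → Option (List V)) (h : List V) (u : V)
    (hlt : ∑' i, interMass A σ s (h ++ [u]) (c i) < wordProbFrom A σ s (h ++ [u])) :
    ∃ π ∈ cyl (h ++ [u]), ∀ i w, c i = some w → π ∉ cyl w := by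
  classical
  let good : List V × V → Prop := fun p =>
    ∑' i, interMass A σ s (p.1 ++ [p.2]) (c i) < wordProbFrom A σ s (p.1 ++ [p.2])
  have hstep : ∀ p : {p // good p}, ∃ v, good (p.1.1 ++ [p.1.2], v) := by
    rintro ⟨⟨h, u⟩, hp⟩
    apply exists_lt_of_sum_lt_sum'
    refine (sum_coverMass_le hA σ s c h u).trans_lt ?_
    simp only [wordProbFrom_snoc]
    rw [← Finset.mul_sum, stepProb_sum hA, mul_one]
    exact hp
  choose nx hnx using hstep
  let seq : ℕ → {p // good p} := fun n =>
    Nat.rec ⟨(h, u), hlt⟩ (fun _ p => ⟨(p.1.1 ++ [p.1.2], nx p), hnx p⟩) n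
  have hseq : ∀ n, (seq (n + 1)).1 = ((seq n).1.1 ++ [(seq n).1.2], nx (seq n)) := fun n => rfl
  let W : ℕ → List V := fun n => (seq n).1.1 ++ [(seq n).1.2]
  have hW : ∀ n, W (n + 1) = W n ++ [nx (seq n)] := fun n => by
    simp only [W, hseq]
  have hlen : ∀ n, (W n).length = h.length + 1 + n := by
    intro n
    induction n with
    | zero => simp [W, seq]
    | succ n ih => rw [hW]; simp [ih, add_assoc]
  have hpre : ∀ m n, m ≤ n → W m <+: W n := by
    intro m n hmn
    induction n, hmn using Nat.le_induction with
    | base => exact List.prefix_rfl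
    | succ n _ ih => rw [hW]; exact ih.trans (List.prefix_append _ _)
  let π : Play V := fun i => (W i)[i]'(by rw [hlen]; omega)
  have hπ : ∀ n, π ∈ cyl (W n) := by
    intro n i hi
    simp only [π, List.get_eq_getElem]
    rcases le_total i n with hin | hin
    · exact (hpre i n hin).getElem _
    · exact ((hpre n i hin).getElem hi).symm
  refine ⟨π, hπ 0, fun i w hw hmem => ?_⟩
  have hg := (seq w.length).2
  have hpw : w <+: W w.length := by
    rw [List.prefix_iff_eq_take]
    apply List.ext_getElem
    · simp [hlen]
    · intro j h1 h2
      rw [List.getElem_take]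
      have e1 := hmem j h1
      have e2 := hπ w.length j (by rw [hlen]; omega)
      simp only [List.get_eq_getElem] at e1 e2
      rw [← e1, e2]
  have : wordProbFrom A σ s (W w.length) ≤ ∑' i, interMass A σ s (W w.length) (c i) := by
    refine le_trans ?_ (ENNReal.le_tsum i)
    rw [hw]; simp [interMass, hpw]
  exact absurd hg (not_lt.2 this)

theorem exists_extension_of_lt_iterExp {A : Arena k V} (hA : A.WF) (σ : Profile k V) (s : V)
    (c : ℕ → Option (List V)) (F : Set V) (n : ℕ) : ∀ (h : List V) (u : V)
    (_ : ∑' i, interMass A σ s (h ++ [u]) (c i) <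
      wordProbFrom A σ s (h ++ [u]) * iterExp A σ (indF F) n h u),
    ∃ h' u', u' ∈ F ∧
      ∑' i, interMass A σ s (h' ++ [u']) (c i) < wordProbFrom A σ s (h' ++ [u']) := by
  induction n with
  | zero =>
    intro h u hlt
    by_cases hu : u ∈ F
    · exact ⟨h, u, hu, by simpa [iterExp, indF, hu] using hlt⟩
    · simp [iterExp, indF, hu] at hlt
  | succ n ih =>
    intro h u hlt
    rw [iterExp, Finset.mul_sum] at hlt
    obtain ⟨v, hv⟩ := exists_lt_of_sum_lt_sum' ((sum_coverMass_le hA σ s c h u).trans_lt hlt)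
    rw [← mul_assoc, ← wordProbFrom_snoc] at hv
    exact ih _ v hv

theorem interMass_singleton_le (A : Arena k V) (σ : Profile k V) (s : V) (w : List V) :
    interMass A σ s [s] (some w) ≤ wordProbFrom A σ s w := by
  simp only [interMass]
  split_ifs with h1 h2
  · rcases w with _ | ⟨x, w⟩
    · simp [wordProbFrom, extProb]
    · have := List.cons_prefix_cons.1 h1
      obtain ⟨rfl, h⟩ := this
      have : w = [] := List.prefix_nil.1 h
      subst this; exact le_rfl
  · exact le_rfl
  · exact bot_le

theorem reachVal_le_PrFrom {A : Arena k V} (hA : A.WF) (σ : Profile k V) (F : Set V) (s : V) :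
    reachVal A σ F [] s ≤ PrFrom A σ s (trObjS F) := by
  classical
  refine iSup_le fun n => ?_
  unfold PrFrom
  rw [MeasureTheory.OuterMeasure.ofFunction_apply]
  refine le_iInf₂ fun t ht => ?_
  by_contra hlt
  push Not at hlt
  obtain ⟨δ, hδ, hδs⟩ : ∃ δ : ℝ≥0∞, δ ≠ 0 ∧ (∑' i, (if t i = ∅ then 0
      else ⨅ (w : List V) (_ : t i ⊆ cyl w), wordProbFrom A σ s w)) + δ < iterExp A σ (indF F) n [] s := by
    obtain ⟨b, h1, h2⟩ := exists_between hlt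
    refine ⟨b - _, (tsub_pos_of_lt h1).ne', ?_⟩
    rw [add_tsub_cancel_of_le h1.le]; exact h2
  obtain ⟨ε, hε, hεs⟩ := ENNReal.exists_pos_sum_of_countable hδ ℕ
  have hc : ∀ i, ∃ o : Option (List V), (t i = ∅ ∨ ∃ w, o = some w ∧ t i ⊆ cyl w) ∧
      interMass A σ s [s] o ≤ (if t i = ∅ then 0
      else ⨅ (w : List V) (_ : t i ⊆ cyl w), wordProbFrom A σ s w) + ε i := by
    intro i
    by_cases he : t i = ∅
    · exact ⟨none, Or.inl he, by simp [interMass]⟩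
    · simp only [he, if_false]
      have hfin : (⨅ (w : List V) (_ : t i ⊆ cyl w), wordProbFrom A σ s w) ≠ ⊤ := by
        refine ne_top_of_le_ne_top ENNReal.one_ne_top (iInf₂_le [] ?_)
        intro π _ j hj; simp at hj
      have hlt := ENNReal.lt_add_right hfin (ENNReal.coe_ne_zero.2 (hε i).ne')
      obtain ⟨w, hw⟩ := iInf_lt_iff.1 hlt
      obtain ⟨hw1, hw2⟩ := iInf_lt_iff.1 hw
      exact ⟨some w, Or.inr ⟨w, rfl, hw1⟩, (interMass_singleton_le A σ s w).trans hw2.le⟩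
  choose c hc1 hc2 using hc
  have hsum : ∑' i, interMass A σ s ([] ++ [s]) (c i) <
      wordProbFrom A σ s ([] ++ [s]) * iterExp A σ (indF F) n [] s := by
    have hs : wordProbFrom A σ s ([] ++ [s]) = 1 := by simp [wordProbFrom, extProb]
    rw [hs, one_mul]
    refine lt_of_le_of_lt (ENNReal.tsum_le_tsum hc2) ?_
    rw [ENNReal.tsum_add]
    exact lt_of_le_of_lt (add_le_add le_rfl hεs.le) hδs
  obtain ⟨h', u', hu', hlt'⟩ := exists_extension_of_lt_iterExp hA σ s c F n [] s hsum
  obtain ⟨π, hπ, hav⟩ := exists_play_avoiding hA σ s c h' u' hlt'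
  have hO : π ∈ trObjS F := by
    refine ⟨h'.length, ?_⟩
    rw [(mem_cyl_snoc.1 hπ).2]; exact hu'
  obtain ⟨i, hi⟩ := Set.mem_iUnion.1 (ht hO)
  rcases hc1 i with he | ⟨w, hw1, hw2⟩
  · rw [he] at hi; exact hi
  · exact hav i w hw1 (hw2 hi)

theorem PrFrom_reach {A : Arena k V} (hA : A.WF) {σ : Profile k V} (hσ : Profile.Valid A σ)
    {F : Set V} (hF : ∀ v ∈ F, A.terminal v) (s : V) :
    PrFrom A σ s (trObjS F) = reachVal A σ F [] s :=
  le_antisymm (PrFrom_reach_le hA hσ hF s) (reachVal_le_PrFrom hA σ F s)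

end ReachProb

section RealValues

variable {k : ℕ} {V : Type} [Fintype V]

/-- Real-valued transition probability. -/
noncomputable def rstep (A : Arena k V) (σ : Profile k V) (h : List V) (u v : V) : ℝ :=
  (A.stepProb σ h u v).toReal

/-- Real-valued reachability probability. -/
noncomputable def rval (A : Arena k V) (σ : Profile k V) (F : Set V) (h : List V) (u : V) : ℝ :=
  (reachVal A σ F h u).toReal

/-- Positions visited with positive probability. -/
inductive Visited (A : Arena k V) (σ : Profile k V) : List V → V → Prop
  | init : Visited A σ [] A.init
  | step {h u v} : Visited A σ h u → rstep A σ h u v ≠ 0 → Visited A σ (h ++ [u]) v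

theorem rstep_nonneg (A : Arena k V) (σ : Profile k V) (h : List V) (u v : V) :
    0 ≤ rstep A σ h u v := ENNReal.toReal_nonneg

theorem rval_nonneg (A : Arena k V) (σ : Profile k V) (F : Set V) (h : List V) (u : V) :
    0 ≤ rval A σ F h u := ENNReal.toReal_nonneg

variable {A : Arena k V} (hA : A.WF) {σ : Profile k V} (hσ : Profile.Valid A σ)

include hA in
theorem stepProb_ne_top (σ : Profile k V) (h : List V) (u v : V) : A.stepProb σ h u v ≠ ⊤ := by
  refine ne_top_of_le_ne_top ENNReal.one_ne_top ?_
  rw [← stepProb_sum hA σ h u]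
  exact Finset.single_le_sum (f := fun v => A.stepProb σ h u v) (fun _ _ => bot_le) (Finset.mem_univ v)

include hA in
theorem reachVal_ne_top (σ : Profile k V) (F : Set V) (h : List V) (u : V) :
    reachVal A σ F h u ≠ ⊤ := by
  classical
  exact ne_top_of_le_ne_top ENNReal.one_ne_top (reachVal_le_one hA σ F h u)

include hA in
theorem rstep_sum (σ : Profile k V) (h : List V) (u : V) : ∑ v, rstep A σ h u v = 1 := by
  unfold rstep
  rw [← ENNReal.toReal_sum (fun v _ => stepProb_ne_top hA σ h u v), stepProb_sum hA]
  rfl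

include hA in
theorem rval_le_one (σ : Profile k V) (F : Set V) (h : List V) (u : V) : rval A σ F h u ≤ 1 := by
  classical
  exact ENNReal.toReal_le_of_le_ofReal zero_le_one (by simpa using reachVal_le_one hA σ F h u)

include hσ in
theorem rstep_mem {h : List V} {u v : V} (hp : rstep A σ h u v ≠ 0) : v ∈ A.next u := by
  classical
  refine Profile.Valid.step_mem hσ (h := h) fun h0 => hp ?_
  rw [rstep, h0]; rfl

include hA in
theorem rstep_nature (σ : Profile k V) {u : V} (hu : A.owner u = none) (h : List V) (v : V) :
    rstep A σ h u v = (A.prob u v : ℝ) := by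
  unfold rstep Arena.stepProb
  rw [hu]
  exact ENNReal.toReal_ofReal (by exact_mod_cast (hA.2 u hu).1 v)

include hA hσ in
theorem rval_terminal (F : Set V) {u : V} [Decidable (u ∈ F)] (hu : A.terminal u) (h : List V) :
    rval A σ F h u = if u ∈ F then 1 else 0 := by
  classical
  unfold rval
  rw [reachVal_terminal hA hσ F hu, indF]
  split_ifs <;> simp

include hA hσ in
theorem rval_step {F : Set V} (hF : ∀ v ∈ F, A.terminal v) (h : List V) (u : V) :
    rval A σ F h u = ∑ v, rstep A σ h u v * rval A σ F (h ++ [u]) v := by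
  classical
  unfold rval rstep
  rw [reachVal_step hA hσ hF, ENNReal.toReal_sum]
  · simp only [ENNReal.toReal_mul]
  · intro v _
    exact ENNReal.mul_ne_top (stepProb_ne_top hA σ h u v) (reachVal_ne_top hA σ F _ _)

/-- If the probability of reaching `F` vanishes initially, it vanishes along all visited positions. -/
theorem Visited.rval_eq_zero (hA : A.WF) (hσ : Profile.Valid A σ) {F : Set V} (hF : ∀ v ∈ F, A.terminal v)
    (h0 : rval A σ F [] A.init = 0) {h : List V} {u : V} (hv : Visited A σ h u) :
    rval A σ F h u = 0 := by
  induction hv with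
  | init => exact h0
  | @step h u v _ hp ih =>
    rw [rval_step hA hσ hF, Finset.sum_eq_zero_iff_of_nonneg
      (fun v _ => mul_nonneg (rstep_nonneg _ _ _ _ _) (rval_nonneg _ _ _ _ _))] at ih
    exact (mul_eq_zero.1 (ih v (Finset.mem_univ v))).resolve_left hp

/-- Comparison principle: a bounded subharmonic function which is nonpositive on the set where
the counter `Ψ` vanishes is nonpositive, provided that `Ψ` decreases in expectation elsewhere. -/
theorem subharmonic_nonpos (σ : Profile k V) (Inv : List V → V → Prop)
    (Ψ : V → ℝ) (hInv : ∀ h u v, Inv h u → Ψ u ≠ 0 → rstep A σ h u v ≠ 0 → Inv (h ++ [u]) v)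
    (K : ℝ) (hΨ0 : ∀ u, Ψ u = 0 ∨ 1 ≤ Ψ u) (hΨK : ∀ u, Ψ u ≤ K)
    (hΨ : ∀ h u, Inv h u → Ψ u ≠ 0 → ∑ v, rstep A σ h u v * Ψ v ≤ Ψ u - 1)
    (g : List V → V → ℝ) (B : ℝ) (hB : ∀ h u, g h u ≤ B)
    (hg0 : ∀ h u, Inv h u → Ψ u = 0 → g h u ≤ 0)
    (hg : ∀ h u, Inv h u → Ψ u ≠ 0 → g h u ≤ ∑ v, rstep A σ h u v * g (h ++ [u]) v) :
    ∀ h u, Inv h u → g h u ≤ 0 := by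
  have hΨn : ∀ u, 0 ≤ Ψ u := fun u => by rcases hΨ0 u with h | h <;> linarith
  have hind : ∀ n : ℕ, ∀ h u, Inv h u → g h u ≤ max B 0 * (1 - 1 / (max K 1)) ^ n * Ψ u := by
    intro n
    have hK1 : 1 ≤ max K 1 := le_max_right _ _
    have hr : 0 ≤ 1 - 1 / max K 1 := by
      rw [sub_nonneg, div_le_one (by linarith)]; exact hK1
    induction n with
    | zero =>
      intro h u hi
      rcases hΨ0 u with h0 | h1
      · simpa [h0] using hg0 h u hi h0
      · have := hB h u
        have h2 : B ≤ max B 0 := le_max_left _ _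
        have h3 : 0 ≤ max B 0 := le_max_right _ _
        rw [pow_zero, mul_one]
        nlinarith
    | succ n ih =>
      intro h u hi
      by_cases h0 : Ψ u = 0
      · simpa [h0] using hg0 h u hi h0
      · set c := max B 0 * (1 - 1 / max K 1) ^ n with hc
        have hc0 : 0 ≤ c := mul_nonneg (le_max_right _ _) (pow_nonneg hr _)
        have h1 : g h u ≤ c * (Ψ u - 1) := by
          refine (hg h u hi h0).trans ?_
          refine le_trans ?_ (mul_le_mul_of_nonneg_left (hΨ h u hi h0) hc0)
          rw [Finset.mul_sum]
          refine Finset.sum_le_sum fun v _ => ?_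
          by_cases hp : rstep A σ h u v = 0
          · simp [hp]
          · have := mul_le_mul_of_nonneg_left (ih _ v (hInv h u v hi h0 hp)) (rstep_nonneg A σ h u v)
            linarith
        have h2 : Ψ u - 1 ≤ (1 - 1 / max K 1) * Ψ u := by
          have : Ψ u / max K 1 ≤ 1 := by
            rw [div_le_one (by linarith)]
            exact (hΨK u).trans (le_max_left _ _)
          have e : (1 - 1 / max K 1) * Ψ u = Ψ u - Ψ u / max K 1 := by ring
          rw [e]; linarith
        calc g h u ≤ c * (Ψ u - 1) := h1
          _ ≤ c * ((1 - 1 / max K 1) * Ψ u) := mul_le_mul_of_nonneg_left h2 hc0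
          _ = _ := by rw [hc]; ring
  intro h u hi
  have hK1 : 1 ≤ max K 1 := le_max_right _ _
  have hpos : 0 < 1 / max K 1 := by positivity
  have hle : 1 / max K 1 ≤ 1 := by rw [div_le_one (by linarith)]; exact hK1
  have hlim : Filter.Tendsto (fun n : ℕ => max B 0 * (1 - 1 / (max K 1)) ^ n * Ψ u)
      Filter.atTop (nhds (max B 0 * 0 * Ψ u)) :=
    ((tendsto_pow_atTop_nhds_zero_of_lt_one (by linarith) (by linarith)).const_mul _).mul_const _
  have := ge_of_tendsto hlim (Filter.Eventually.of_forall fun n => hind n h u hi)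
  simpa using this

theorem iterExp_le_of_superharmonic (σ : Profile k V) (F : Set V) (Φ : List V → V → ℝ≥0∞)
    (h0 : ∀ h u, indF F h u ≤ Φ h u)
    (hs : ∀ h u, ∑ v, A.stepProb σ h u v * Φ (h ++ [u]) v ≤ Φ h u) (n : ℕ) :
    ∀ h u, iterExp A σ (indF F) n h u ≤ Φ h u := by
  induction n with
  | zero => exact h0
  | succ n ih =>
    intro h u
    refine le_trans ?_ (hs h u)
    exact Finset.sum_le_sum fun v _ => mul_le_mul_right (ih _ _) _

theorem iterExp_congr_ext {σ σ' : Profile k V} (f : List V → V → ℝ≥0∞) (w : List V)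
    (hw : ∀ h, w <+: h → ∀ u v, A.stepProb σ h u v = A.stepProb σ' h u v) (n : ℕ) :
    ∀ h u, w <+: h → iterExp A σ f n h u = iterExp A σ' f n h u := by
  induction n with
  | zero => intro h u _; rfl
  | succ n ih =>
    intro h u hh
    rw [iterExp, iterExp]
    refine Finset.sum_congr rfl fun v _ => ?_
    rw [hw h hh, ih _ _ (hh.trans (List.prefix_append _ _))]

/-- The environment players have no profitable deviation, in terms of reachability values. -/
def Stable (A : Arena k V) (F : Fin (k + 1) → Set V) (σ : Profile k V) : Prop :=
  ∀ i, i ≠ 0 → ∀ τ : Strategy V, Strategy.Valid A τ →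
    rval A (Function.update σ i τ) (F i) [] A.init ≤ rval A σ (F i) [] A.init

theorem update_valid {i : Fin (k + 1)} {τ : Strategy V} (hσ : Profile.Valid A σ)
    (hτ : Strategy.Valid A τ) : Profile.Valid A (Function.update σ i τ) := by
  intro j
  by_cases hj : j = i
  · subst hj; simpa using hτ
  · simpa [hj] using hσ j

/-- In an equilibrium, no player gains by a single deviation at a visited position. -/
theorem Stable.oneShot {F : Fin (k + 1) → Set V} (hst : Stable A F σ) (hA : A.WF)
    (hσ : Profile.Valid A σ) {i : Fin (k + 1)} (hi : i ≠ 0) (hF : ∀ v ∈ F i, A.terminal v)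
    {h : List V} {u v : V} (hv : Visited A σ h u) (ho : A.owner u = some i) (hn : v ∈ A.next u) :
    rval A σ (F i) (h ++ [u]) v ≤ rval A σ (F i) h u := by
  classical
  by_contra hlt
  push Not at hlt
  set τ : Strategy V := fun h' u' => if h' = h ∧ u' = u then PMF.pure v else σ i h' u' with hτ
  have hτv : Strategy.Valid A τ := by
    intro h' u' v' hne
    simp only [hτ] at hne
    split_ifs at hne with hc
    · obtain ⟨rfl, rfl⟩ := hc
      by_cases hvv : v' = v
      · rw [hvv]; exact hn
      · simp [PMF.pure_apply, hvv] at hne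
    · exact hσ i h' u' v' hne
  set σ' := Function.update σ i τ with hσ'
  have hσv : Profile.Valid A σ' := update_valid hσ hτv
  have hsp : ∀ h' u' v', ¬ (h' = h ∧ u' = u) → A.stepProb σ' h' u' v' = A.stepProb σ h' u' v' := by
    intro h' u' v' hc
    unfold Arena.stepProb
    rcases hou : A.owner u' with _ | j
    · rfl
    · by_cases hj : j = i
      · subst hj; simp [hσ', hτ, hc]
      · simp [hσ', hj]
  have hsv : ∀ v', A.stepProb σ' h u v' = if v' = v then 1 else 0 := by
    intro v'
    unfold Arena.stepProb
    rw [ho]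
    simp [hσ', hτ, PMF.pure_apply]
  have hext : ∀ u', reachVal A σ' (F i) (h ++ [u]) u' = reachVal A σ (F i) (h ++ [u]) u' := by
    intro u'
    unfold reachVal
    congr 1
    funext n
    refine iterExp_congr_ext _ (h ++ [u]) (fun h' hh u'' v'' => hsp _ _ _ ?_) n _ _ List.prefix_rfl
    rintro ⟨rfl, _⟩
    have := hh.length_le
    simp at this
  have hhu : reachVal A σ (F i) h u < reachVal A σ' (F i) h u := by
    rw [reachVal_step hA hσv hF h u]
    simp only [hsv, hext, ite_mul, one_mul, zero_mul, Finset.sum_ite_eq', Finset.mem_univ, if_true]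
    exact (ENNReal.toReal_lt_toReal (reachVal_ne_top hA _ _ _ _) (reachVal_ne_top hA _ _ _ _)).1 hlt
  have hle : ∀ h' u', reachVal A σ (F i) h' u' ≤ reachVal A σ' (F i) h' u' := by
    intro h' u'
    refine iSup_le fun n => iterExp_le_of_superharmonic σ (F i) _ ?_ ?_ n h' u'
    · intro h' u'
      exact le_iSup (fun n => iterExp A σ' (indF (F i)) n h' u') 0
    · intro h' u'
      by_cases hc : h' = h ∧ u' = u
      · obtain ⟨rfl, rfl⟩ := hc
        refine le_of_eq_of_le ?_ hhu.le
        rw [reachVal_step hA hσ hF]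
        simp only [hext]
      · rw [reachVal_step hA hσv hF]
        simp only [hsp h' u' _ hc]
        exact le_rfl
  have hler : ∀ h' u', rval A σ (F i) h' u' ≤ rval A σ' (F i) h' u' := fun h' u' =>
    ENNReal.toReal_mono (reachVal_ne_top hA _ _ _ _) (hle h' u')
  have hprop : ∀ h' u', Visited A σ h' u' → h'.length ≤ h.length →
      rval A σ (F i) h' u' < rval A σ' (F i) h' u' →
      rval A σ (F i) [] A.init < rval A σ' (F i) [] A.init := by
    intro h' u' hvis
    induction hvis with
    | init => exact fun _ h => h
    | @step h1 u1 v1 _ hp ih =>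
      intro hl hs
      simp only [List.length_append, List.length_singleton] at hl
      refine ih (by omega) ?_
      rw [rval_step hA hσ hF h1, rval_step hA hσv hF h1]
      have hsame : ∀ v', rstep A σ' h1 u1 v' = rstep A σ h1 u1 v' := by
        intro v'
        unfold rstep
        rw [hsp]
        rintro ⟨rfl, _⟩; omega
      simp only [hsame]
      refine Finset.sum_lt_sum (fun v' _ => mul_le_mul_of_nonneg_left (hler _ _) (rstep_nonneg _ _ _ _ _))
        ⟨v1, Finset.mem_univ _, mul_lt_mul_of_pos_left hs (lt_of_le_of_ne (rstep_nonneg _ _ _ _ _) hp.symm)⟩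
  have := hprop h u hv le_rfl
    ((ENNReal.toReal_lt_toReal (reachVal_ne_top hA _ _ _ _) (reachVal_ne_top hA _ _ _ _)).2 hhu)
  exact absurd (hst i hi τ hτv) (not_le.2 this)

/-- A profile of finite-state strategies induces only finitely many reachability values. -/
theorem finite_range_rval {σ : Profile k V} (hfs : ∀ i, Strategy.FiniteState (σ i)) (A : Arena k V)
    (F : Set V) : (Set.range fun p : List V × V => rval A σ F p.1 p.2).Finite := by
  choose M hM m0 upd out hout using hfs
  have hfold : ∀ (h : List V) (i : Fin (k + 1)) (m : ∀ i, M i),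
      h.foldl (fun (m : ∀ i, M i) v i => upd i (m i) v) m i = h.foldl (upd i) (m i) := by
    intro h i
    induction h with
    | nil => intro m; rfl
    | cons x h ih => intro m; exact ih _
  set mem : List V → ∀ i, M i := fun h => h.foldl (fun (m : ∀ i, M i) v i => upd i (m i) v) m0 with hmem
  have hsp : ∀ h h' u v, mem h = mem h' → A.stepProb σ h u v = A.stepProb σ h' u v := by
    intro h h' u v hh
    unfold Arena.stepProb
    rcases A.owner u with _ | i
    · rfl
    · simp only [hout]
      rw [← hfold h i m0, ← hfold h' i m0]
      have := congrFun hh i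
      simp only [hmem] at this
      rw [this]
  have hit : ∀ n h h' u, mem h = mem h' →
      iterExp A σ (indF F) n h u = iterExp A σ (indF F) n h' u := by
    intro n
    induction n with
    | zero => intro h h' u _; rfl
    | succ n ih =>
      intro h h' u hh
      rw [iterExp, iterExp]
      refine Finset.sum_congr rfl fun v _ => ?_
      rw [hsp h h' u v hh, ih (h ++ [u]) (h' ++ [u]) v]
      simp only [hmem, List.foldl_append] at hh ⊢
      rw [hh]
  classical
  let val : (∀ i, M i) × V → ℝ := fun p =>
    if hp : ∃ h, mem h = p.1 then rval A σ F hp.choose p.2 else 0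
  refine (Set.finite_range val).subset ?_
  rintro _ ⟨⟨h, u⟩, rfl⟩
  refine ⟨(mem h, u), ?_⟩
  have hp : ∃ h', mem h' = mem h := ⟨h, rfl⟩
  simp only [val, hp, dif_pos]
  unfold rval reachVal
  congr 2
  funext n
  exact hit n _ _ u hp.choose_spec

end RealValues

section Transport

variable {k : ℕ} {V W : Type}

/-- Two arenas are isomorphic along a bijection of their vertices. -/
structure ArenaIso (A : Arena k V) (B : Arena k W) (e : V ≃ W) : Prop where
  owner : ∀ u, B.owner (e u) = A.owner u
  edge : ∀ u v, B.edge (e u) (e v) = A.edge u v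
  prob : ∀ u v, B.prob (e u) (e v) = A.prob u v
  init : e A.init = B.init

/-- The image of an arena under a bijection of the vertices. -/
def Arena.reindex (A : Arena k V) (e : V ≃ W) : Arena k W where
  owner u := A.owner (e.symm u)
  edge u v := A.edge (e.symm u) (e.symm v)
  prob u v := A.prob (e.symm u) (e.symm v)
  init := e A.init

theorem arenaIso_reindex (A : Arena k V) (e : V ≃ W) : ArenaIso A (A.reindex e) e :=
  ⟨by simp [Arena.reindex], by simp [Arena.reindex], by simp [Arena.reindex], rfl⟩

namespace ArenaIso

variable {A : Arena k V} {B : Arena k W} {e : V ≃ W}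

theorem symm (h : ArenaIso A B e) : ArenaIso B A e.symm where
  owner u := by rw [← h.owner]; simp
  edge u v := by rw [← h.edge]; simp
  prob u v := by rw [← h.prob]; simp
  init := by rw [← h.init]; simp

theorem mem_next (h : ArenaIso A B e) (u v : V) : e v ∈ B.next (e u) ↔ v ∈ A.next u := by
  simp only [Arena.next, Set.mem_ofPred_eq, h.owner, h.edge, h.prob]

theorem terminal (h : ArenaIso A B e) {u : V} (hu : A.terminal u) : B.terminal (e u) := by
  ext w
  obtain ⟨v, rfl⟩ := e.surjective w
  rw [h.mem_next, hu]; simp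

theorem wf [Fintype V] [Fintype W] (h : ArenaIso A B e) (hA : A.WF) : B.WF := by
  refine ⟨fun w => ?_, fun w hw => ?_⟩
  · obtain ⟨u, rfl⟩ := e.surjective w
    obtain ⟨v, hv⟩ := hA.1 u
    exact ⟨e v, (h.mem_next u v).2 hv⟩
  · obtain ⟨u, rfl⟩ := e.surjective w
    rw [h.owner] at hw
    refine ⟨fun w => ?_, ?_⟩
    · obtain ⟨v, rfl⟩ := e.surjective w
      rw [h.prob]; exact (hA.2 u hw).1 v
    · rw [← (hA.2 u hw).2, ← e.sum_comp]
      simp only [h.prob]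

end ArenaIso

/-- Pull back a strategy along a bijection of the vertices. -/
noncomputable def Strategy.pull (e : V ≃ W) (σ : Strategy W) : Strategy V :=
  fun h u => (σ (h.map e) (e u)).map e.symm

theorem PMF_map_equiv_apply (e : V ≃ W) (p : PMF W) (v : V) : (p.map e.symm) v = p (e v) := by
  rw [PMF.map_apply, tsum_eq_single (e v)]
  · simp
  · intro w hw
    rw [if_neg]
    rintro rfl
    simp at hw

theorem Strategy.pull_apply (e : V ≃ W) (σ : Strategy W) (h : List V) (u v : V) :
    Strategy.pull e σ h u v = σ (h.map e) (e u) (e v) := PMF_map_equiv_apply e _ v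

theorem Strategy.pull_pull_symm (e : V ≃ W) (σ : Strategy V) :
    Strategy.pull e (Strategy.pull e.symm σ) = σ := by
  funext h u
  ext v
  rw [Strategy.pull_apply, Strategy.pull_apply]
  simp

theorem Strategy.Pure.pull {σ : Strategy W} (hσ : Strategy.Pure σ) (e : V ≃ W) :
    Strategy.Pure (Strategy.pull e σ) := by
  intro h u
  obtain ⟨w, hw⟩ := hσ (h.map e) (e u)
  exact ⟨e.symm w, by rw [Strategy.pull_apply]; simpa using hw⟩

theorem Strategy.FiniteState.pull {σ : Strategy W} (hσ : Strategy.FiniteState σ) (e : V ≃ W) :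
    Strategy.FiniteState (Strategy.pull e σ) := by
  obtain ⟨M, hM, m0, upd, out, hout⟩ := hσ
  refine ⟨M, hM, m0, fun m v => upd m (e v), fun m u => (out m (e u)).map e.symm, fun h u => ?_⟩
  rw [Strategy.pull, hout, List.foldl_map]

namespace ArenaIso

variable {A : Arena k V} {B : Arena k W} {e : V ≃ W}

theorem pull_valid (h : ArenaIso A B e) {τ : Strategy W} (hτ : Strategy.Valid B τ) :
    Strategy.Valid A (Strategy.pull e τ) := by
  intro hist u v hne
  rw [Strategy.pull_apply] at hne
  exact (h.mem_next u v).1 (hτ _ _ _ hne)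

theorem stepProb_pull (h : ArenaIso A B e) (σ : Profile k W) (hist : List V) (u v : V) :
    A.stepProb (fun i => Strategy.pull e (σ i)) hist u v = B.stepProb σ (hist.map e) (e u) (e v) := by
  unfold Arena.stepProb
  rw [h.owner]
  rcases A.owner u with _ | i
  · simp only [h.prob]
  · exact Strategy.pull_apply _ _ _ _ _

variable [Fintype V] [Fintype W]

theorem iterExp_pull (h : ArenaIso A B e) (σ : Profile k W) (F : Set W) (n : ℕ) :
    ∀ hist u, iterExp A (fun i => Strategy.pull e (σ i)) (indF (e ⁻¹' F)) n hist u =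
      iterExp B σ (indF F) n (hist.map e) (e u) := by
  induction n with
  | zero => intro hist u; simp only [iterExp, indF]; rfl
  | succ n ih =>
    intro hist u
    rw [iterExp, iterExp, ← e.sum_comp]
    refine Finset.sum_congr rfl fun v _ => ?_
    rw [h.stepProb_pull, ih]; simp

theorem rval_pull (h : ArenaIso A B e) (σ : Profile k W) (F : Set W) (hist : List V) (u : V) :
    rval A (fun i => Strategy.pull e (σ i)) (e ⁻¹' F) hist u = rval B σ F (hist.map e) (e u) := by
  unfold rval reachVal
  simp only [h.iterExp_pull]

theorem stable_pull (h : ArenaIso A B e) {σ : Profile k W} {F : Fin (k + 1) → Set W}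
    (hs : Stable B F σ) : Stable A (fun i => e ⁻¹' F i) (fun i => Strategy.pull e (σ i)) := by
  intro i hi τ hτ
  have h1 := hs i hi (Strategy.pull e.symm τ) (h.symm.pull_valid hτ)
  have h2 : Function.update (fun i => Strategy.pull e (σ i)) i τ =
      fun j => Strategy.pull e (Function.update σ i (Strategy.pull e.symm τ) j) := by
    funext j
    by_cases hj : j = i
    · subst hj; simp [Strategy.pull_pull_symm]
    · simp [hj]
  simp only
  rw [h2, h.rval_pull, h.rval_pull, h.init]
  exact h1

end ArenaIso

end Transport

section Answer

variable {k : ℕ} {V : Type} [Fintype V]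

theorem pay_eq_reachVal [DecidableEq V] {A : Arena k V} (hA : A.WF) {σ : Profile k V}
    (hσ : Profile.Valid A σ) {F : Fin (k + 1) → V → Bool} (hF : ∀ i v, F i v = true → A.terminal v)
    (i : Fin (k + 1)) :
    Pay A (fun i => trObj (F i)) σ i = reachVal A σ {v | F i v = true} [] A.init :=
  PrFrom_reach hA hσ (fun v hv => hF i v hv) A.init

theorem zeroNE_iff_stable [DecidableEq V] {A : Arena k V} (hA : A.WF) {σ : Profile k V}
    (hσ : Profile.Valid A σ) {F : Fin (k + 1) → V → Bool} (hF : ∀ i v, F i v = true → A.terminal v) :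
    ZeroNE A (fun i => trObj (F i)) σ ↔ Stable A (fun i => {v | F i v = true}) σ := by
  refine forall_congr' fun i => forall_congr' fun _ => forall_congr' fun τ =>
    forall_congr' fun hτ => ?_
  rw [pay_eq_reachVal hA hσ hF, pay_eq_reachVal hA (update_valid hσ hτ) hF]
  exact (ENNReal.toReal_le_toReal (reachVal_ne_top hA _ _ _ _) (reachVal_ne_top hA _ _ _ _)).symm

/-- Every well-formed arena has a positional valid strategy. -/
theorem exists_positional {A : Arena k V} (hA : A.WF) :
    ∃ τ : Strategy V, Strategy.Valid A τ ∧ Strategy.Pure τ ∧ Strategy.FiniteState τ := by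
  classical
  choose nx hnx using hA.1
  refine ⟨fun _ u => PMF.pure (nx u), ?_, ?_, ?_⟩
  · intro h u v hv
    have : v = nx u := by
      by_contra hc
      simp [PMF.pure_apply, hc] at hv
    rw [this]; exact hnx u
  · intro h u; exact ⟨nx u, by simp⟩
  · exact ⟨Unit, inferInstance, (), fun _ _ => (), fun _ u => PMF.pure (nx u), fun _ _ => rfl⟩

theorem stepProb_update_of_unowned {A : Arena k V} {i : Fin (k + 1)} (h0 : ∀ u, A.owner u ≠ some i)
    (σ : Profile k V) (τ : Strategy V) (h : List V) (u v : V) :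
    A.stepProb (Function.update σ i τ) h u v = A.stepProb σ h u v := by
  unfold Arena.stepProb
  rcases ho : A.owner u with _ | j
  · rfl
  · have : j ≠ i := by rintro rfl; exact h0 u ho
    simp [this]

theorem rval_update_of_unowned {A : Arena k V} {i : Fin (k + 1)} (h0 : ∀ u, A.owner u ≠ some i)
    (σ : Profile k V) (τ : Strategy V) (F : Set V) (h : List V) (u : V) :
    rval A (Function.update σ i τ) F h u = rval A σ F h u := by
  have : ∀ n h u, iterExp A (Function.update σ i τ) (indF F) n h u = iterExp A σ (indF F) n h u := by
    intro n
    induction n with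
    | zero => intro h u; rfl
    | succ n ih =>
      intro h u
      rw [iterExp, iterExp]
      simp only [ih, stepProb_update_of_unowned h0]
  unfold rval reachVal
  simp only [this]

/-- If the system controls no vertex and the threshold is zero, a negative answer amounts to the
existence of a stable profile in which the system reaches its target with probability zero. -/
theorem not_answerGt_iff (I : TRInstance) (hμ : I.μ = 0) (A : Arena I.k V) (hA : A.WF)
    (F : Fin (I.k + 1) → V → Bool) (e : V ≃ Fin I.n) (hiso : ArenaIso A I.A e)
    (hF : ∀ i v, I.F i (e v) = F i v) (h0 : ∀ u, A.owner u ≠ some 0)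
    (pu fs : Prop) (C : {n : ℕ} → Strategy (Fin n) → Prop)
    (hC : ∀ σ : Strategy (Fin I.n), C σ ↔ (pu → Strategy.Pure σ) ∧ (fs → Strategy.FiniteState σ)) :
    ¬ TRInstance.AnswerGt C I ↔ ∃ σ : Profile I.k V, Profile.Valid A σ ∧
      (∀ i, (pu → Strategy.Pure (σ i)) ∧ (fs → Strategy.FiniteState (σ i))) ∧
      Stable A (fun i => {v | F i v = true}) σ ∧ rval A σ {v | F 0 v = true} [] A.init = 0 := by
  have hpre : ∀ i, e ⁻¹' {w | I.F i w = true} = {v | F i v = true} := by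
    intro i; ext v; simp [hF]
  have hpre' : ∀ i, e.symm ⁻¹' {v | F i v = true} = {w | I.F i w = true} := by
    intro i; ext w
    obtain ⟨v, rfl⟩ := e.surjective w
    simp [hF]
  have h0' : ∀ w, I.A.owner w ≠ some 0 := by
    intro w
    obtain ⟨u, rfl⟩ := e.surjective w
    rw [hiso.owner]; exact h0 u
  constructor
  · intro hno
    obtain ⟨τ, hτv, hτp, hτf⟩ := exists_positional I.wf
    unfold TRInstance.AnswerGt NCRSPgtAnswer at hno
    push Not at hno
    obtain ⟨σ, hσ0, hσv, hσC, hne, hpay⟩ := hno τ hτv ((hC τ).2 ⟨fun _ => hτp, fun _ => hτf⟩)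
    have hcl : ∀ i, C (σ i) := by
      intro i
      by_cases hi : i = 0
      · subst hi; rw [hσ0]; exact (hC τ).2 ⟨fun _ => hτp, fun _ => hτf⟩
      · exact hσC i hi
    refine ⟨fun i => Strategy.pull e (σ i), fun i => hiso.pull_valid (hσv i), fun i => ?_, ?_, ?_⟩
    · exact ⟨fun h => (((hC _).1 (hcl i)).1 h).pull e, fun h => (((hC _).1 (hcl i)).2 h).pull e⟩
    · have := hiso.stable_pull ((zeroNE_iff_stable I.wf hσv I.hterm).1 hne)
      simpa only [hpre] using this
    · rw [← hpre, hiso.rval_pull, hiso.init]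
      rw [pay_eq_reachVal I.wf hσv I.hterm, hμ] at hpay
      unfold rval
      simp only [Rat.cast_zero, ENNReal.ofReal_zero, nonpos_iff_eq_zero] at hpay
      simp [hpay]
  · rintro ⟨σ, hσv, hσC, hst, hz⟩ ⟨τ, hτv, hτC, hall⟩
    set σ' : Profile I.k (Fin I.n) := Function.update (fun i => Strategy.pull e.symm (σ i)) 0 τ with hσ'
    have hv' : Profile.Valid I.A σ' :=
      update_valid (fun i => hiso.symm.pull_valid (hσv i)) hτv
    have hrv : ∀ i h u, rval I.A σ' {w | I.F i w = true} h u =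
        rval A σ {v | F i v = true} (h.map e.symm) (e.symm u) := by
      intro i h u
      rw [hσ', rval_update_of_unowned h0', ← hpre', hiso.symm.rval_pull]
    have hs' : Stable I.A (fun i => {w | I.F i w = true}) σ' := by
      intro i hi ρ hρ
      have := hiso.symm.stable_pull hst i hi ρ hρ
      simp only [hpre'] at this
      simp only [hσ']
      rw [Function.update_comm hi.symm, rval_update_of_unowned h0', rval_update_of_unowned h0']
      exact this
    have := hall σ' (by simp [hσ']) hv' (fun i hi => by
      simp only [hσ', Function.update_of_ne hi]
      exact (hC _).2 ⟨fun h => ((hσC i).1 h).pull _, fun h => ((hσC i).2 h).pull _⟩)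
      ((zeroNE_iff_stable I.wf hv' I.hterm).2 hs')
    rw [pay_eq_reachVal I.wf hv' I.hterm, hμ] at this
    have h2 := hrv 0 [] I.A.init
    rw [List.map_nil, hiso.symm.init, hz] at h2
    rw [rval, ENNReal.toReal_eq_zero_iff] at h2
    rcases h2 with h2 | h2
    · simp [h2] at this
    · exact reachVal_ne_top I.wf _ _ _ _ h2

end Answer

/-- A counter machine with control states `Q` and registers `R`.  In each step the register
`test q` is tested, and decremented if it is nonzero; the outcome of the test determines the next
state and the set of the registers to be incremented. -/
structure CMachine (Q R : Type) where
  q0 : Q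
  r0 : R
  test : Q → R
  nxt : Q → Bool → Q
  inc : Q → Bool → R → Bool
  bad : Q → Bool

namespace CMachine

variable {Q R : Type} [DecidableEq R]

/-- The counter values after a step with test outcome `b`. -/
def upd (M : CMachine Q R) (q : Q) (b : Bool) (c : R → ℕ) : R → ℕ := fun r =>
  if b = true ∧ r = M.test q then c r - 1 else c r + (if M.inc q b r then 1 else 0)

/-- The outcome of the zero test. -/
def branch (M : CMachine Q R) (x : Q × (R → ℕ)) : Bool := decide (x.2 (M.test x.1) ≠ 0)

/-- One step of the machine. -/
def step (M : CMachine Q R) (x : Q × (R → ℕ)) : Q × (R → ℕ) :=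
  (M.nxt x.1 (M.branch x), M.upd x.1 (M.branch x) x.2)

/-- The configuration after `t` steps on input `n`. -/
def cfg (M : CMachine Q R) (n : ℕ) : ℕ → Q × (R → ℕ)
  | 0 => (M.q0, fun r => if r = M.r0 then n else 0)
  | t + 1 => M.step (M.cfg n t)

/-- The target state of a transition; `none` is the initial transition. -/
def tgt (M : CMachine Q R) : Option (Q × Bool) → Q
  | none => M.q0
  | some (q, b) => M.nxt q b

/-- The factor by which a transition changes `2 ^ (-c r)`. -/
def mult (M : CMachine Q R) : Option (Q × Bool) → R → ℚ
  | none, _ => 1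
  | some (q, b), r => if b = true ∧ r = M.test q then 2 else if M.inc q b r then 1 / 2 else 1

/-- The value of `2 ^ (-c r)` before a transition, if it is determined by the transition. -/
def forced (M : CMachine Q R) (n : ℕ) : Option (Q × Bool) → R → Option ℚ
  | none, r => some (if r = M.r0 then (1 / 2) ^ n else 1)
  | some (q, b), r => if b = false ∧ r = M.test q then some 1 else none

theorem mult_pos (M : CMachine Q R) (δ : Option (Q × Bool)) (r : R) : 0 < M.mult δ r := by
  rcases δ with _ | ⟨q, b⟩
  · simp [mult]
  · simp only [mult]; split_ifs <;> norm_num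

theorem mult_le (M : CMachine Q R) (δ : Option (Q × Bool)) (r : R) : M.mult δ r ≤ 2 := by
  rcases δ with _ | ⟨q, b⟩
  · simp [mult]
  · simp only [mult]; split_ifs <;> norm_num

theorem forced_mem (M : CMachine Q R) {n : ℕ} {δ : Option (Q × Bool)} {r : R} {v : ℚ}
    (h : M.forced n δ r = some v) : 0 ≤ v ∧ v ≤ 1 := by
  rcases δ with _ | ⟨q, b⟩
  · simp only [forced, Option.some.injEq] at h
    subst h
    split_ifs
    · exact ⟨by positivity, pow_le_one₀ (by norm_num) (by norm_num)⟩
    · norm_num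
  · simp only [forced] at h
    split_ifs at h
    simp only [Option.some.injEq] at h
    subst h; norm_num

end CMachine

/-- Vertices of the game simulating a counter machine. -/
inductive GV (Q R : Type) (N : ℕ) : Type
  | M : Q → Bool → GV Q R N
  | X : Option (Q × Bool) → Bool → Fin (N + 1) → GV Q R N
  | Ex : Option (R × Bool × Bool) → GV Q R N
  | Ev : Option (Q × Bool) → Bool → R → GV Q R N
  | Half : Option (Q × Bool) → Bool → R → GV Q R N
  | Hi : Option (Q × Bool) → Bool → R → GV Q R N
  | Lo : Bool → R → GV Q R N
  | T : R × Bool → Bool → GV Q R N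
  | Z : GV Q R N

instance {Q R : Type} {N : ℕ} [Finite Q] [Finite R] : Finite (GV Q R N) := by
  let f : (Q × Bool) ⊕ (Option (Q × Bool) × Bool × Fin (N + 1)) ⊕ Option (R × Bool × Bool) ⊕
      (Option (Q × Bool) × Bool × R) ⊕ (Option (Q × Bool) × Bool × R) ⊕
      (Option (Q × Bool) × Bool × R) ⊕ (Bool × R) ⊕ ((R × Bool) × Bool) ⊕ Unit → GV Q R N := fun x =>
    match x with
    | .inl (q, p) => .M q p
    | .inr (.inl (δ, p, i)) => .X δ p i
    | .inr (.inr (.inl o)) => .Ex o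
    | .inr (.inr (.inr (.inl (δ, p, r)))) => .Ev δ p r
    | .inr (.inr (.inr (.inr (.inl (δ, p, r))))) => .Half δ p r
    | .inr (.inr (.inr (.inr (.inr (.inl (δ, p, r)))))) => .Hi δ p r
    | .inr (.inr (.inr (.inr (.inr (.inr (.inl (p, r))))))) => .Lo p r
    | .inr (.inr (.inr (.inr (.inr (.inr (.inr (.inl (j, b)))))))) => .T j b
    | .inr (.inr (.inr (.inr (.inr (.inr (.inr (.inr ()))))))) => .Z
  refine Finite.of_surjective f ?_
  intro v
  rcases v with ⟨q, p⟩ | ⟨δ, p, i⟩ | o | ⟨δ, p, r⟩ | ⟨δ, p, r⟩ | ⟨δ, p, r⟩ | ⟨p, r⟩ | ⟨j, b⟩ | _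
  · exact ⟨.inl (q, p), rfl⟩
  · exact ⟨.inr (.inl (δ, p, i)), rfl⟩
  · exact ⟨.inr (.inr (.inl o)), rfl⟩
  · exact ⟨.inr (.inr (.inr (.inl (δ, p, r)))), rfl⟩
  · exact ⟨.inr (.inr (.inr (.inr (.inl (δ, p, r))))), rfl⟩
  · exact ⟨.inr (.inr (.inr (.inr (.inr (.inl (δ, p, r)))))), rfl⟩
  · exact ⟨.inr (.inr (.inr (.inr (.inr (.inr (.inl (p, r))))))), rfl⟩
  · exact ⟨.inr (.inr (.inr (.inr (.inr (.inr (.inr (.inl (j, b)))))))), rfl⟩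
  · exact ⟨.inr (.inr (.inr (.inr (.inr (.inr (.inr (.inr ()))))))), rfl⟩

/-- The player asked at the exits of a checking phase with parity `p`. -/
def exitPlayer {R : Type} (p : Bool) : Option (R × Bool) → Option (R × Bool × Bool)
  | none => none
  | some (r, b) => some (r, p, b)

/-- The constant payoff of leaving the game. -/
def exitPay (d : ℕ) (b : Bool) : ℚ := if b then 1 / (6 * d) else 1 / (3 * d)

section Node

variable {Q R : Type} [DecidableEq R] [Fintype R] {N : ℕ}

open GV in
/-- The moves at a vertex: either a player and two successors, or a distribution. -/
noncomputable def node (M : CMachine Q R) (en : Fin N ≃ Option (R × Bool)) (n : ℕ) :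
    GV Q R N → (Option (R × Bool × Bool) × GV Q R N × GV Q R N) ⊕ List (ℚ × GV Q R N)
  | .M q p => if M.bad q then .inr [(1, Z)]
      else .inl (some (M.test q, !p, true), X (some (q, true)) p 0, X (some (q, false)) p 0)
  | X δ p i => if h : i.val < N then
        .inl (exitPlayer p (en ⟨i, h⟩), X δ p ⟨i + 1, by omega⟩, Ex (exitPlayer p (en ⟨i, h⟩)))
      else .inr ((1 / 2, .M (M.tgt δ) (!p)) ::
        (Finset.univ : Finset R).toList.map fun r => (1 / (2 * Fintype.card R : ℚ), Ev δ p r))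
  | Ex none => .inr [(1, Z)]
  | Ex (some (r, p, b)) =>
      .inr [(exitPay (Fintype.card R) b, T (r, p) b), (1 - exitPay (Fintype.card R) b, Z)]
  | Ev δ p r => match M.forced n δ r with
      | some v => .inr [(v, Hi δ p r), (1 - v, Lo p r)]
      | none => .inl (none, Hi δ p r, Half δ p r)
  | Half δ p r => .inr [(1 / 2, Lo p r), (1 / 2, Ev δ p r)]
  | Hi δ p r => .inr [(M.mult δ r / 8, T (r, p) true), (1 / 2 - M.mult δ r / 8, T (r, p) false),
      (1 / 4, T (r, !p) true), (1 / 4, T (r, !p) false)]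
  | Lo p r => .inr [(1 / 2, T (r, p) false), (1 / 2, T (r, !p) true)]
  | T j b => .inr [(1, T j b)]
  | Z => .inr [(1, Z)]

open scoped Classical in
/-- The arena of the game simulating a counter machine on input `n`. -/
noncomputable def gameArena (M : CMachine Q R) (en : Fin N ≃ Option (R × Bool)) {k : ℕ}
    (pl : Option (R × Bool × Bool) ≃ Fin k) (n : ℕ) : Arena k (GV Q R N) where
  owner u := match node M en n u with
    | .inl x => some (pl x.1).succ
    | .inr _ => none
  edge u v := match node M en n u with
    | .inl x => decide (v = x.2.1 ∨ v = x.2.2)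
    | .inr _ => false
  prob u v := match node M en n u with
    | .inl _ => 0
    | .inr l => (l.map fun x => if v = x.2 then x.1 else 0).sum
  init := .X none false 0

open scoped Classical in
/-- The targets of the players. -/
noncomputable def gameTarget (Q : Type) {R : Type} (N : ℕ) {k : ℕ} (pl : Option (R × Bool × Bool) ≃ Fin k)
    (i : Fin (k + 1)) : GV Q R N → Bool :=
  Fin.cases (fun v => decide (v = .Z))
    (fun j v => match pl.symm j with
      | none => false
      | some (r, p, b) => decide (v = .T (r, p) b)) i

variable {k : ℕ} (M : CMachine Q R) (en : Fin N ≃ Option (R × Bool))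
  (pl : Option (R × Bool × Bool) ≃ Fin k) (n : ℕ)

theorem gameArena_owner_inl {u : GV Q R N} {x} (h : node M en n u = .inl x) :
    (gameArena M en pl n).owner u = some (pl x.1).succ := by
  simp [gameArena, h]

theorem gameArena_owner_inr {u : GV Q R N} {l} (h : node M en n u = .inr l) :
    (gameArena M en pl n).owner u = none := by
  simp [gameArena, h]

theorem gameArena_next_inl {u : GV Q R N} {x} (h : node M en n u = .inl x) :
    (gameArena M en pl n).next u = {x.2.1, x.2.2} := by
  ext v
  simp only [Arena.next, Set.mem_ofPred_eq, gameArena_owner_inl M en pl n h]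
  simp [gameArena, h]

open scoped Classical in
theorem gameArena_prob_inr {u : GV Q R N} {l} (h : node M en n u = .inr l) (v : GV Q R N) :
    (gameArena M en pl n).prob u v = (l.map fun x => if v = x.2 then x.1 else 0).sum := by
  simp [gameArena, h]

theorem exitPay_pos [Nonempty R] (b : Bool) : 0 < exitPay (Fintype.card R) b := by
  have : (0 : ℚ) < Fintype.card R := by exact_mod_cast Fintype.card_pos
  unfold exitPay; split_ifs <;> positivity

theorem exitPay_lt_one [Nonempty R] (b : Bool) : exitPay (Fintype.card R) b < 1 := by
  have h1 : (1 : ℚ) ≤ Fintype.card R := by exact_mod_cast Nat.succ_le_of_lt Fintype.card_pos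
  unfold exitPay; split_ifs <;> rw [div_lt_one (by linarith)] <;> linarith

theorem node_inr_sum [Nonempty R] {u : GV Q R N} {l} (h : node M en n u = .inr l) :
    (∀ x ∈ l, 0 ≤ x.1) ∧ (l.map Prod.fst).sum = 1 := by
  have h1 : (0 : ℚ) < Fintype.card R := by exact_mod_cast Fintype.card_pos
  rcases u with ⟨q, p⟩ | ⟨δ, p, i⟩ | (_ | ⟨r, p, b⟩) | ⟨δ, p, r⟩ | ⟨δ, p, r⟩ | ⟨δ, p, r⟩ | ⟨p, r⟩ | ⟨j, b⟩ | _ <;>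
    simp only [node] at h
  · split_ifs at h
    cases h; simp
  · split_ifs at h
    cases h
    refine ⟨?_, ?_⟩
    · intro x hx
      simp only [List.mem_cons, List.mem_map] at hx
      rcases hx with rfl | ⟨r, _, rfl⟩
      · norm_num
      · positivity
    · simp only [List.map_cons, List.map_map, List.sum_cons]
      have : ((Finset.univ : Finset R).toList.map (Prod.fst ∘ fun r : R => ((1 / (2 * Fintype.card R : ℚ), GV.Ev δ p r) : ℚ × GV Q R N))) =
          (Finset.univ : Finset R).toList.map (fun _ => (1 / (2 * Fintype.card R : ℚ))) := rfl
      rw [this, Finset.sum_map_toList]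
      simp
      field_simp
      norm_num
  · cases h; simp
  · cases h
    have := exitPay_pos (R := R) b
    have := exitPay_lt_one (R := R) b
    refine ⟨?_, by simp⟩
    simp; constructor <;> linarith
  · rcases hf : M.forced n δ r with _ | v
    · simp [hf] at h
    · simp only [hf] at h
      cases h
      have := M.forced_mem hf
      refine ⟨?_, by simp⟩
      simp; exact this
  · cases h; norm_num
  · cases h
    have h2 := M.mult_pos δ r
    have h3 := M.mult_le δ r
    refine ⟨?_, by simp; ring⟩
    simp; exact ⟨by linarith, by linarith⟩
  · cases h; norm_num
  · cases h; simp
  · cases h; simp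

theorem sum_list_ite {α : Type} [Fintype α] [DecidableEq α] (l : List (ℚ × α)) (f : α → ℝ) :
    ∑ v, (((l.map fun x => if v = x.2 then x.1 else 0).sum : ℚ) : ℝ) * f v =
      (l.map fun x => (x.1 : ℝ) * f x.2).sum := by
  induction l with
  | nil => simp
  | cons x l ih =>
    simp only [List.map_cons, List.sum_cons, Rat.cast_add, add_mul, Finset.sum_add_distrib, ih]
    congr 1
    rw [Finset.sum_eq_single x.2] <;> simp +contextual

variable [Fintype Q]

noncomputable instance : Fintype (GV Q R N) := Fintype.ofFinite _

theorem gameArena_wf [Nonempty R] : (gameArena M en pl n).WF := by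
  classical
  have key : ∀ u l, node M en n u = .inr l →
      (∀ v, 0 ≤ (gameArena M en pl n).prob u v) ∧ ∑ v, (gameArena M en pl n).prob u v = 1 := by
    intro u l h
    obtain ⟨h1, h2⟩ := node_inr_sum M en n h
    refine ⟨fun v => ?_, ?_⟩
    · rw [gameArena_prob_inr M en pl n h]
      refine List.sum_nonneg ?_
      intro y hy
      obtain ⟨x, hx, rfl⟩ := List.mem_map.1 hy
      split_ifs
      · exact h1 x hx
      · exact le_rfl
    · have := sum_list_ite l (fun _ : GV Q R N => (1 : ℝ))
      simp only [mul_one] at this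
      have e : ((l.map fun x => (x.1 : ℝ)).sum) = (((l.map Prod.fst).sum : ℚ) : ℝ) := by
        rw [Rat.cast_list_sum, List.map_map]; rfl
      rw [e, h2] at this
      simp only [gameArena_prob_inr M en pl n h]
      exact_mod_cast this
  refine ⟨fun u => ?_, fun u hu => ?_⟩
  · rcases h : node M en n u with x | l
    · rw [gameArena_next_inl M en pl n h]
      exact ⟨_, Or.inl rfl⟩
    · obtain ⟨h1, h2⟩ := key u l h
      have : ∃ v, 0 < (gameArena M en pl n).prob u v := by
        by_contra hc
        push Not at hc
        have : ∑ v, (gameArena M en pl n).prob u v ≤ 0 := Finset.sum_nonpos fun v _ => hc v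
        linarith
      obtain ⟨v, hv⟩ := this
      exact ⟨v, Or.inl ⟨gameArena_owner_inr M en pl n h, hv⟩⟩
  · rcases h : node M en n u with x | l
    · rw [gameArena_owner_inl M en pl n h] at hu; cases hu
    · exact key u l h

theorem gameArena_terminal {u : GV Q R N} (h : node M en n u = .inr [(1, u)]) :
    (gameArena M en pl n).terminal u := by
  classical
  ext v
  simp only [Arena.next, Set.mem_ofPred_eq, gameArena_owner_inr M en pl n h,
    gameArena_prob_inr M en pl n h]
  simp only [List.map_cons, List.map_nil, List.sum_cons, List.sum_nil]
  split_ifs with hv <;> simp [hv]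

theorem gameTarget_terminal (i : Fin (k + 1)) (v : GV Q R N) (hv : gameTarget Q N pl i v = true) :
    (gameArena M en pl n).terminal v := by
  classical
  refine gameArena_terminal M en pl n ?_
  induction i using Fin.cases with
  | zero =>
    have : v = .Z := by simpa [gameTarget] using hv
    subst this; rfl
  | succ j =>
    simp only [gameTarget, Fin.cases_succ] at hv
    split at hv
    · cases hv
    · have := of_decide_eq_true hv
      subst this; rfl

end Node

/-- Expected value of `f` at the next vertex. -/
noncomputable def expect {k : ℕ} {V : Type} [Fintype V] (A : Arena k V) (σ : Profile k V)
    (h : List V) (u : V) (f : V → ℝ) : ℝ := ∑ v, rstep A σ h u v * f v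

section GameExpect

variable {Q R : Type} [DecidableEq R] [Fintype R] [Fintype Q] {N k : ℕ}
  {M : CMachine Q R} {en : Fin N ≃ Option (R × Bool)} {pl : Option (R × Bool × Bool) ≃ Fin k} {n : ℕ}

theorem expect_inr [Nonempty R] (σ : Profile k (GV Q R N)) {u : GV Q R N} {l}
    (hu : node M en n u = .inr l) (h : List (GV Q R N)) (f : GV Q R N → ℝ) :
    expect (gameArena M en pl n) σ h u f = (l.map fun x => (x.1 : ℝ) * f x.2).sum := by
  classical
  rw [← sum_list_ite l f]
  refine Finset.sum_congr rfl fun v _ => ?_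
  rw [rstep_nature (gameArena_wf M en pl n) σ (gameArena_owner_inr M en pl n hu),
    gameArena_prob_inr M en pl n hu]

theorem rstep_inr_ne [Nonempty R] {σ : Profile k (GV Q R N)} {u v : GV Q R N} {l}
    (hu : node M en n u = .inr l) {h : List (GV Q R N)}
    (hv : rstep (gameArena M en pl n) σ h u v ≠ 0) : ∃ x ∈ l, x.2 = v := by
  classical
  by_contra hc
  push Not at hc
  apply hv
  rw [rstep_nature (gameArena_wf M en pl n) σ (gameArena_owner_inr M en pl n hu),
    gameArena_prob_inr M en pl n hu, List.sum_eq_zero, Rat.cast_zero]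
  intro y hy
  obtain ⟨x, hx, rfl⟩ := List.mem_map.1 hy
  rw [if_neg fun h => hc x hx h.symm]

theorem rstep_inr_pos [Nonempty R] (σ : Profile k (GV Q R N)) {u v : GV Q R N} {l}
    (hu : node M en n u = .inr l) (h : List (GV Q R N)) {w : ℚ} (hw : 0 < w) (hl : (w, v) ∈ l) :
    rstep (gameArena M en pl n) σ h u v ≠ 0 := by
  classical
  rw [rstep_nature (gameArena_wf M en pl n) σ (gameArena_owner_inr M en pl n hu),
    gameArena_prob_inr M en pl n hu]
  have h0 : ∀ y ∈ (l.map fun x => if v = x.2 then x.1 else 0), 0 ≤ y := by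
    intro y hy
    obtain ⟨x, hx, rfl⟩ := List.mem_map.1 hy
    split_ifs
    · exact (node_inr_sum M en n hu).1 x hx
    · exact le_rfl
  have h1 := List.single_le_sum h0 w (List.mem_map.2 ⟨_, hl, by simp⟩)
  exact_mod_cast (hw.trans_le h1).ne'

theorem rstep_inl_ne {σ : Profile k (GV Q R N)} (hσ : Profile.Valid (gameArena M en pl n) σ)
    {u v : GV Q R N} {i a b}
    (hu : node M en n u = .inl (i, a, b)) {h : List (GV Q R N)}
    (hv : rstep (gameArena M en pl n) σ h u v ≠ 0) : v = a ∨ v = b := by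
  have := rstep_mem hσ hv
  rwa [gameArena_next_inl M en pl n hu] at this

theorem expect_inl {σ : Profile k (GV Q R N)} (hσ : Profile.Valid (gameArena M en pl n) σ)
    {u : GV Q R N} {i a b} (hu : node M en n u = .inl (i, a, b)) (hab : a ≠ b)
    (h : List (GV Q R N)) (f : GV Q R N → ℝ) :
    expect (gameArena M en pl n) σ h u f =
      rstep (gameArena M en pl n) σ h u a * f a + rstep (gameArena M en pl n) σ h u b * f b := by
  classical
  unfold expect
  rw [← Finset.sum_subset (Finset.subset_univ {a, b}), Finset.sum_pair hab]
  intro v _ hv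
  by_contra hc
  rcases rstep_inl_ne hσ hu (left_ne_zero_of_mul hc) with rfl | rfl <;> simp at hv

theorem rstep_inl_add [Nonempty R] {σ : Profile k (GV Q R N)} (hσ : Profile.Valid (gameArena M en pl n) σ)
    {u : GV Q R N} {i a b} (hu : node M en n u = .inl (i, a, b)) (hab : a ≠ b)
    (h : List (GV Q R N)) :
    rstep (gameArena M en pl n) σ h u a + rstep (gameArena M en pl n) σ h u b = 1 := by
  have h1 := expect_inl hσ hu hab h (fun _ => 1)
  simp only [expect, mul_one] at h1
  rw [← h1, rstep_sum (gameArena_wf M en pl n)]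

theorem expect_inl_le [Nonempty R] {σ : Profile k (GV Q R N)} (hσ : Profile.Valid (gameArena M en pl n) σ)
    {u : GV Q R N} {i a b} (hu : node M en n u = .inl (i, a, b)) (hab : a ≠ b)
    (h : List (GV Q R N)) {f : GV Q R N → ℝ} {c : ℝ}
    (ha : rstep (gameArena M en pl n) σ h u a ≠ 0 → f a ≤ c)
    (hb : rstep (gameArena M en pl n) σ h u b ≠ 0 → f b ≤ c) :
    expect (gameArena M en pl n) σ h u f ≤ c := by
  have h1 := expect_inl hσ hu hab h f
  have h2 := rstep_inl_add hσ hu hab h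
  have h3 := rstep_nonneg (gameArena M en pl n) σ h u a
  have h4 := rstep_nonneg (gameArena M en pl n) σ h u b
  generalize rstep (gameArena M en pl n) σ h u a = α at *
  generalize rstep (gameArena M en pl n) σ h u b = β at *
  have h5 : α * f a ≤ α * c := by
    by_cases h : α = 0
    · simp [h]
    · exact mul_le_mul_of_nonneg_left (ha h) h3
  have h6 : β * f b ≤ β * c := by
    by_cases h : β = 0
    · simp [h]
    · exact mul_le_mul_of_nonneg_left (hb h) h4
  rw [h1]
  calc _ ≤ α * c + β * c := add_le_add h5 h6
    _ = c := by rw [← add_mul, h2, one_mul]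

theorem expect_inl_ge [Nonempty R] {σ : Profile k (GV Q R N)} (hσ : Profile.Valid (gameArena M en pl n) σ)
    {u : GV Q R N} {i a b} (hu : node M en n u = .inl (i, a, b)) (hab : a ≠ b)
    (h : List (GV Q R N)) {f : GV Q R N → ℝ} {c : ℝ}
    (ha : rstep (gameArena M en pl n) σ h u a ≠ 0 → c ≤ f a)
    (hb : rstep (gameArena M en pl n) σ h u b ≠ 0 → c ≤ f b) :
    c ≤ expect (gameArena M en pl n) σ h u f := by
  have := expect_inl_le hσ hu hab h (f := fun v => - f v) (c := -c)
    (fun h => neg_le_neg (ha h)) (fun h => neg_le_neg (hb h))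
  simp only [expect, mul_neg, Finset.sum_neg_distrib, neg_le_neg_iff] at this
  exact this

/-- Expected number of steps bound, used for termination arguments. -/
noncomputable def GV.rank : GV Q R N → ℝ
  | .M _ _ => 2 * N + 9
  | .X _ _ i => N + 8 + (N - (i : ℕ))
  | .Ev _ _ _ => 5
  | .Half _ _ _ => 4
  | .Hi _ _ _ => 1
  | .Lo _ _ => 1
  | .Ex _ => 1
  | .T _ _ => 0
  | .Z => 0

theorem GV.rank_eq_zero_or (u : GV Q R N) : u.rank = 0 ∨ 1 ≤ u.rank := by
  have hN : (0 : ℝ) ≤ N := by positivity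
  rcases u with ⟨q, p⟩ | ⟨δ, p, i⟩ | o | ⟨δ, p, r⟩ | ⟨δ, p, r⟩ | ⟨δ, p, r⟩ | ⟨p, r⟩ | ⟨j, b⟩ | _ <;>
    simp only [GV.rank]
  · right; linarith
  · right
    have : ((i : ℕ) : ℝ) ≤ N := by exact_mod_cast Nat.lt_succ_iff.1 i.2
    linarith
  all_goals norm_num

theorem GV.rank_le (u : GV Q R N) : u.rank ≤ 2 * N + 9 := by
  have hN : (0 : ℝ) ≤ N := by positivity
  rcases u with ⟨q, p⟩ | ⟨δ, p, i⟩ | o | ⟨δ, p, r⟩ | ⟨δ, p, r⟩ | ⟨δ, p, r⟩ | ⟨p, r⟩ | ⟨j, b⟩ | _ <;>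
    simp only [GV.rank]
  · linarith
  · have : (0 : ℝ) ≤ ((i : ℕ) : ℝ) := by positivity
    linarith
  all_goals linarith

theorem GV.rank_eq_zero {u : GV Q R N} (h : u.rank = 0) : (∃ j b, u = .T j b) ∨ u = .Z := by
  have hN : (0 : ℝ) ≤ N := by positivity
  rcases u with ⟨q, p⟩ | ⟨δ, p, i⟩ | o | ⟨δ, p, r⟩ | ⟨δ, p, r⟩ | ⟨δ, p, r⟩ | ⟨p, r⟩ | ⟨j, b⟩ | _ <;>
    simp only [GV.rank] at h
  · linarith
  · have : ((i : ℕ) : ℝ) ≤ N := by exact_mod_cast Nat.lt_succ_iff.1 i.2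
    linarith
  all_goals first | norm_num at h | skip
  · exact .inl ⟨_, _, rfl⟩
  · exact .inr rfl

/-! Expectations at the individual vertices. -/

theorem node_M {q : Q} {p : Bool} (hq : M.bad q = false) :
    node M en n (.M q p) = .inl (some (M.test q, !p, true), .X (some (q, true)) p 0,
      .X (some (q, false)) p 0) := by simp [node, hq]

theorem node_M_bad {q : Q} {p : Bool} (hq : M.bad q = true) :
    node M en n (.M q p) = .inr [(1, .Z)] := by simp [node, hq]

theorem node_X {δ : Option (Q × Bool)} {p : Bool} {i : Fin (N + 1)} (h : i.val < N) :
    node M en n (.X δ p i) = .inl (exitPlayer p (en ⟨i, h⟩), .X δ p ⟨i + 1, by omega⟩,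
      .Ex (exitPlayer p (en ⟨i, h⟩))) := by simp [node, h]

theorem node_X_last {δ : Option (Q × Bool)} {p : Bool} {i : Fin (N + 1)} (h : ¬ i.val < N) :
    node M en n (.X δ p i) = .inr ((1 / 2, .M (M.tgt δ) (!p)) ::
      (Finset.univ : Finset R).toList.map fun r => (1 / (2 * Fintype.card R : ℚ), .Ev δ p r)) := by
  simp [node, h]

theorem node_Ev_some {δ : Option (Q × Bool)} {p : Bool} {r : R} {v : ℚ}
    (h : M.forced n δ r = some v) :
    node M en n (.Ev δ p r) = .inr [(v, .Hi δ p r), (1 - v, .Lo p r)] := by simp [node, h]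

theorem node_Ev_none {δ : Option (Q × Bool)} {p : Bool} {r : R}
    (h : M.forced n δ r = none) :
    node M en n (.Ev δ p r) = .inl (none, .Hi δ p r, .Half δ p r) := by simp [node, h]

variable [Nonempty R] {σ : Profile k (GV Q R N)} {h : List (GV Q R N)} {f : GV Q R N → ℝ}

theorem expect_M_bad {q : Q} {p : Bool} (hq : M.bad q = true) :
    expect (gameArena M en pl n) σ h (.M q p) f = f .Z := by
  rw [expect_inr σ (node_M_bad hq)]; simp

theorem expect_X_last {δ : Option (Q × Bool)} {p : Bool} {i : Fin (N + 1)} (hi : ¬ i.val < N) :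
    expect (gameArena M en pl n) σ h (.X δ p i) f = 1 / 2 * f (.M (M.tgt δ) (!p)) +
      1 / (2 * Fintype.card R) * ∑ r, f (.Ev δ p r) := by
  rw [expect_inr σ (node_X_last hi), List.map_cons, List.map_map, List.sum_cons,
    Finset.mul_sum, ← Finset.sum_map_toList]
  simp [Function.comp_def]

theorem expect_Ex_none : expect (gameArena M en pl n) σ h (.Ex none) f = f .Z := by
  rw [expect_inr σ (l := [(1, .Z)]) rfl]; simp

theorem expect_Ex {r : R} {p b : Bool} :
    expect (gameArena M en pl n) σ h (.Ex (some (r, p, b))) f =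
      (exitPay (Fintype.card R) b : ℚ) * f (.T (r, p) b) +
        (1 - (exitPay (Fintype.card R) b : ℚ)) * f .Z := by
  rw [expect_inr σ (u := .Ex (some (r, p, b))) rfl]; simp

theorem expect_Ev_some {δ : Option (Q × Bool)} {p : Bool} {r : R} {v : ℚ}
    (hv : M.forced n δ r = some v) :
    expect (gameArena M en pl n) σ h (.Ev δ p r) f = v * f (.Hi δ p r) + (1 - v) * f (.Lo p r) := by
  rw [expect_inr σ (node_Ev_some hv)]; simp

theorem expect_Half {δ : Option (Q × Bool)} {p : Bool} {r : R} :
    expect (gameArena M en pl n) σ h (.Half δ p r) f = 1 / 2 * f (.Lo p r) + 1 / 2 * f (.Ev δ p r) := by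
  rw [expect_inr σ (u := .Half δ p r) rfl]; simp

theorem expect_Hi {δ : Option (Q × Bool)} {p : Bool} {r : R} :
    expect (gameArena M en pl n) σ h (.Hi δ p r) f = M.mult δ r / 8 * f (.T (r, p) true) +
      (1 / 2 - M.mult δ r / 8) * f (.T (r, p) false) + 1 / 4 * f (.T (r, !p) true) +
      1 / 4 * f (.T (r, !p) false) := by
  rw [expect_inr σ (u := .Hi δ p r) rfl]; simp; ring

theorem expect_Lo {p : Bool} {r : R} :
    expect (gameArena M en pl n) σ h (.Lo p r) f = 1 / 2 * f (.T (r, p) false) +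
      1 / 2 * f (.T (r, !p) true) := by
  rw [expect_inr σ (u := .Lo p r) rfl]; simp

theorem expect_rank (hσ : Profile.Valid (gameArena M en pl n) σ) (h : List (GV Q R N))
    (u : GV Q R N) (hu : u.rank ≠ 0) :
    expect (gameArena M en pl n) σ h u GV.rank ≤ u.rank - 1 := by
  have hN : (0 : ℝ) ≤ N := by positivity
  rcases u with ⟨q, p⟩ | ⟨δ, p, i⟩ | (_ | ⟨r, p, b⟩) | ⟨δ, p, r⟩ | ⟨δ, p, r⟩ | ⟨δ, p, r⟩ | ⟨p, r⟩ | ⟨j, b⟩ | _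
  · rcases hq : M.bad q with _ | _
    · refine expect_inl_le hσ (node_M hq) (by simp) h ?_ ?_ <;> intro _ <;> simp [GV.rank] <;> linarith
    · rw [expect_M_bad hq]; simp [GV.rank]; linarith
  · by_cases hi : i.val < N
    · have : ((i : ℕ) : ℝ) + 1 ≤ N := by exact_mod_cast hi
      refine expect_inl_le hσ (node_X hi) (by simp) h ?_ ?_ <;> intro _ <;> simp [GV.rank] <;> linarith
    · rw [expect_X_last hi]
      have : i.val = N := by omega
      have hd : (0 : ℝ) < Fintype.card R := by exact_mod_cast Fintype.card_pos
      simp [GV.rank, this]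
      field_simp
      linarith
  · rw [expect_Ex_none]; simp [GV.rank]
  · rw [expect_Ex]; simp [GV.rank]
  · rcases hf : M.forced n δ r with _ | v
    · refine expect_inl_le hσ (node_Ev_none hf) (by simp) h ?_ ?_ <;> intro _ <;> norm_num [GV.rank]
    · rw [expect_Ev_some hf]; norm_num [GV.rank]
  · rw [expect_Half]; norm_num [GV.rank]
  · rw [expect_Hi]; simp [GV.rank]
  · rw [expect_Lo]; simp [GV.rank]
  · simp [GV.rank] at hu
  · simp [GV.rank] at hu

/-- The comparison principle for the game. -/
theorem game_nonpos (hσ : Profile.Valid (gameArena M en pl n) σ)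
    (Inv : List (GV Q R N) → GV Q R N → Prop)
    (hInv : ∀ h u v, Inv h u → u.rank ≠ 0 → rstep (gameArena M en pl n) σ h u v ≠ 0 → Inv (h ++ [u]) v)
    (g : List (GV Q R N) → GV Q R N → ℝ) (B : ℝ) (hB : ∀ h u, g h u ≤ B)
    (hT : ∀ h j b, Inv h (.T j b) → g h (.T j b) ≤ 0)
    (hZ : ∀ h, Inv h .Z → g h .Z ≤ 0)
    (hg : ∀ h u, Inv h u → u.rank ≠ 0 → g h u ≤ expect (gameArena M en pl n) σ h u (g (h ++ [u]))) :
    ∀ h u, Inv h u → g h u ≤ 0 := by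
  refine subharmonic_nonpos σ Inv GV.rank hInv (2 * N + 9) GV.rank_eq_zero_or GV.rank_le
    (fun h u _ hu => expect_rank hσ h u hu) g B hB ?_ hg
  intro h u hi hu
  rcases GV.rank_eq_zero hu with ⟨j, b, rfl⟩ | rfl
  · exact hT h j b hi
  · exact hZ h hi

end GameExpect

section Soundness

variable {Q R : Type} [DecidableEq R] [Fintype R] [Fintype Q] {N k : ℕ}
  {M : CMachine Q R} {en : Fin N ≃ Option (R × Bool)} {pl : Option (R × Bool × Bool) ≃ Fin k} {n : ℕ}

/-- Probability of reaching the terminal vertex `T j b`. -/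
noncomputable def tval (G : Arena k (GV Q R N)) (σ : Profile k (GV Q R N)) (j : R × Bool) (b : Bool)
    (h : List (GV Q R N)) (u : GV Q R N) : ℝ := rval G σ {.T j b} h u

local notation "𝓖" => gameArena M en pl n

theorem gameTarget_some (r : R) (p b : Bool) :
    {v : GV Q R N | gameTarget Q N pl (pl (some (r, p, b))).succ v = true} = {.T (r, p) b} := by
  ext v; simp [gameTarget]

theorem gameTarget_none : {v : GV Q R N | gameTarget Q N pl (pl none).succ v = true} = ∅ := by
  ext v; simp [gameTarget]

theorem gameTarget_zero : {v : GV Q R N | gameTarget Q N pl 0 v = true} = {.Z} := by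
  ext v; simp [gameTarget]

variable [Nonempty R] {σ : Profile k (GV Q R N)} {h : List (GV Q R N)}

theorem terminal_T (j : R × Bool) (b : Bool) : (𝓖).terminal (.T j b) :=
  gameArena_terminal M en pl n rfl

theorem terminal_Z : (𝓖).terminal .Z := gameArena_terminal M en pl n rfl

theorem tval_step (hσ : Profile.Valid 𝓖 σ) (j : R × Bool) (b : Bool) (h : List (GV Q R N))
    (u : GV Q R N) : tval 𝓖 σ j b h u = expect 𝓖 σ h u (tval 𝓖 σ j b (h ++ [u])) := by
  refine rval_step (gameArena_wf M en pl n) hσ ?_ h u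
  rintro v rfl
  exact terminal_T j b

theorem tval_nonneg (j : R × Bool) (b : Bool) (h : List (GV Q R N)) (u : GV Q R N) :
    0 ≤ tval 𝓖 σ j b h u := rval_nonneg _ _ _ _ _

theorem tval_le_one (j : R × Bool) (b : Bool) (h : List (GV Q R N)) (u : GV Q R N) :
    tval 𝓖 σ j b h u ≤ 1 := rval_le_one (gameArena_wf M en pl n) _ _ _ _

theorem tval_T (hσ : Profile.Valid 𝓖 σ) (j j' : R × Bool) (b b' : Bool) (h : List (GV Q R N)) :
    tval 𝓖 σ j b h (.T j' b') = if j' = j ∧ b' = b then 1 else 0 := by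
  classical
  rw [tval, rval_terminal (gameArena_wf M en pl n) hσ _ (terminal_T j' b')]
  simp

theorem tval_Z (hσ : Profile.Valid 𝓖 σ) (j : R × Bool) (b : Bool) (h : List (GV Q R N)) :
    tval 𝓖 σ j b h .Z = 0 := by
  classical
  rw [tval, rval_terminal (gameArena_wf M en pl n) hσ _ terminal_Z]
  simp

/-- A harmonic function is bounded by a superharmonic one if this is so on the terminal vertices. -/
theorem harmonic_le (hσ : Profile.Valid 𝓖 σ) (Inv : List (GV Q R N) → GV Q R N → Prop)
    (hInv : ∀ h u v, Inv h u → u.rank ≠ 0 → rstep 𝓖 σ h u v ≠ 0 → Inv (h ++ [u]) v)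
    (x Φ : List (GV Q R N) → GV Q R N → ℝ) (B : ℝ) (hxB : ∀ h u, x h u ≤ B)
    (hΦB : ∀ h u, -B ≤ Φ h u)
    (hT : ∀ h j b, Inv h (.T j b) → x h (.T j b) ≤ Φ h (.T j b))
    (hZ : ∀ h, Inv h .Z → x h .Z ≤ Φ h .Z)
    (hx : ∀ h u, Inv h u → u.rank ≠ 0 → x h u ≤ expect 𝓖 σ h u (x (h ++ [u])))
    (hΦ : ∀ h u, Inv h u → u.rank ≠ 0 → expect 𝓖 σ h u (Φ (h ++ [u])) ≤ Φ h u) :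
    ∀ h u, Inv h u → x h u ≤ Φ h u := by
  intro h u hi
  rw [← sub_nonpos]
  revert h u
  refine game_nonpos hσ Inv hInv (fun h u => x h u - Φ h u) (2 * B) ?_ ?_ ?_ ?_
  · intro h u; linarith [hxB h u, hΦB h u]
  · intro h j b hi; linarith [hT h j b hi]
  · intro h hi; linarith [hZ h hi]
  · intro h u hi hr
    have h1 := hx h u hi hr
    have h2 := hΦ h u hi hr
    have h3 : expect 𝓖 σ h u (fun v => x (h ++ [u]) v - Φ (h ++ [u]) v) =
        expect 𝓖 σ h u (x (h ++ [u])) - expect 𝓖 σ h u (Φ (h ++ [u])) := by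
      simp only [expect, mul_sub, Finset.sum_sub_distrib]
    change _ ≤ expect 𝓖 σ h u (fun v => x (h ++ [u]) v - Φ (h ++ [u]) v)
    rw [h3]; linarith

theorem tval_Ex (hσ : Profile.Valid 𝓖 σ) (r : R) (p b : Bool) (h : List (GV Q R N)) :
    tval 𝓖 σ (r, p) b h (.Ex (some (r, p, b))) = exitPay (Fintype.card R) b := by
  rw [tval_step hσ, expect_Ex, tval_T hσ, tval_Z hσ]; simp

theorem tval_Hi (hσ : Profile.Valid 𝓖 σ) (j : R × Bool) (b : Bool) (δ : Option (Q × Bool)) (p : Bool)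
    (r : R) (h : List (GV Q R N)) : tval 𝓖 σ j b h (.Hi δ p r) =
      if j.1 = r then if j.2 = p then (if b then M.mult δ r / 8 else 1 / 2 - M.mult δ r / 8) else 1 / 4
      else 0 := by
  obtain ⟨r', p'⟩ := j
  rw [tval_step hσ, expect_Hi]
  simp only [tval_T hσ, Prod.mk.injEq]
  by_cases hr : r = r'
  · subst hr
    cases b <;> cases p <;> cases p' <;> simp
  · simp [hr, Ne.symm hr]

theorem tval_Lo (hσ : Profile.Valid 𝓖 σ) (j : R × Bool) (b : Bool) (p : Bool)
    (r : R) (h : List (GV Q R N)) : tval 𝓖 σ j b h (.Lo p r) =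
      if j.1 = r then if j.2 = p then (if b then 0 else 1 / 2) else (if b then 1 / 2 else 0)
      else 0 := by
  obtain ⟨r', p'⟩ := j
  rw [tval_step hσ, expect_Lo]
  simp only [tval_T hσ, Prod.mk.injEq]
  by_cases hr : r = r'
  · subst hr
    cases b <;> cases p <;> cases p' <;> simp
  · simp [hr, Ne.symm hr]

theorem gadget_le (hσ : Profile.Valid 𝓖 σ) (δ : Option (Q × Bool)) (p : Bool) (r : R) (α β γ : ℝ)
    (hHi : α * (1 / 4) + β * (M.mult δ r / 8) ≤ γ) (hLo : α * (1 / 2) ≤ γ) (h : List (GV Q R N)) :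
    α * tval 𝓖 σ (r, !p) true h (.Ev δ p r) + β * tval 𝓖 σ (r, p) true h (.Ev δ p r) ≤ γ := by
  classical
  set x : List (GV Q R N) → GV Q R N → ℝ := fun h u =>
    α * tval 𝓖 σ (r, !p) true h u + β * tval 𝓖 σ (r, p) true h u - γ with hx
  set g : List (GV Q R N) → GV Q R N → ℝ := fun h u => if u.rank = 0 then 0 else x h u with hg
  have hstep : ∀ h u, x h u = expect 𝓖 σ h u (x (h ++ [u])) := by
    intro h u
    simp only [hx]
    rw [tval_step hσ, tval_step hσ _ _ h u]
    have := rstep_sum (gameArena_wf M en pl n) σ h u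
    simp only [expect, mul_sub, mul_add, Finset.sum_sub_distrib, Finset.sum_add_distrib,
      ← Finset.sum_mul, this, Finset.mul_sum]
    simp only [one_mul, sub_left_inj]
    congr 1 <;> exact Finset.sum_congr rfl fun _ _ => by ring
  have hH : ∀ h, x h (.Hi δ p r) ≤ 0 := by
    intro h; simp only [hx, tval_Hi hσ]; simp; linarith
  have hL : ∀ h, x h (.Lo p r) ≤ 0 := by
    intro h; simp only [hx, tval_Lo hσ]; simp; linarith
  have rE : (GV.Ev δ p r : GV Q R N).rank ≠ 0 := by norm_num [GV.rank]
  have rF : (GV.Half δ p r : GV Q R N).rank ≠ 0 := by norm_num [GV.rank]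
  have rH : (GV.Hi δ p r : GV Q R N).rank ≠ 0 := by norm_num [GV.rank]
  have rL : (GV.Lo p r : GV Q R N).rank ≠ 0 := by norm_num [GV.rank]
  have key := game_nonpos hσ
    (fun _ u => u.rank = 0 ∨ u = .Ev δ p r ∨ u = .Half δ p r ∨ u = .Hi δ p r ∨ u = .Lo p r) ?_ g
    (|α| + |β| + |γ|) ?_ ?_ ?_ ?_ h (.Ev δ p r) (by simp)
  · simp only [hg, rE, if_false, hx] at key
    linarith
  · rintro h u v (hu | rfl | rfl | rfl | rfl) hr hv
    · exact absurd hu hr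
    · rcases hf : M.forced n δ r with _ | w
      · rcases rstep_inl_ne hσ (node_Ev_none hf) hv with rfl | rfl <;> simp
      · obtain ⟨y, hy, rfl⟩ := rstep_inr_ne (node_Ev_some hf) hv
        simp only [List.mem_cons, List.not_mem_nil, or_false] at hy
        rcases hy with rfl | rfl <;> simp
    · obtain ⟨y, hy, rfl⟩ := rstep_inr_ne (u := .Half δ p r) rfl hv
      simp only [List.mem_cons, List.not_mem_nil, or_false] at hy
      rcases hy with rfl | rfl <;> simp
    · obtain ⟨y, hy, rfl⟩ := rstep_inr_ne (u := .Hi δ p r) rfl hv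
      simp only [List.mem_cons, List.not_mem_nil, or_false] at hy
      rcases hy with rfl | rfl | rfl | rfl <;> simp [GV.rank]
    · obtain ⟨y, hy, rfl⟩ := rstep_inr_ne (u := .Lo p r) rfl hv
      simp only [List.mem_cons, List.not_mem_nil, or_false] at hy
      rcases hy with rfl | rfl <;> simp [GV.rank]
  · intro h u
    simp only [hg]
    split_ifs
    · positivity
    · have b1 : α * tval 𝓖 σ (r, !p) true h u ≤ |α| := by
        have := tval_nonneg (M := M) (en := en) (pl := pl) (n := n) (σ := σ) (r, !p) true h u
        have := tval_le_one (M := M) (en := en) (pl := pl) (n := n) (σ := σ) (r, !p) true h u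
        nlinarith [le_abs_self α, abs_nonneg α]
      have b2 : β * tval 𝓖 σ (r, p) true h u ≤ |β| := by
        have := tval_nonneg (M := M) (en := en) (pl := pl) (n := n) (σ := σ) (r, p) true h u
        have := tval_le_one (M := M) (en := en) (pl := pl) (n := n) (σ := σ) (r, p) true h u
        nlinarith [le_abs_self β, abs_nonneg β]
      simp only [hx]
      linarith [neg_abs_le γ]
  · intro h j b _; simp [hg, GV.rank]
  · intro h _; simp [hg, GV.rank]
  · rintro h u (hu | rfl | rfl | rfl | rfl) hr
    · exact absurd hu hr
    · have e : g h (.Ev δ p r) = x h (.Ev δ p r) := by simp only [hg, rE, if_false]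
      rw [e, hstep]
      rcases hf : M.forced n δ r with _ | w
      · rw [expect_inl hσ (node_Ev_none hf) (by simp), expect_inl hσ (node_Ev_none hf) (by simp)]
        simp only [hg, rH, rF, if_false]; exact le_rfl
      · rw [expect_Ev_some hf, expect_Ev_some hf]
        simp only [hg, rH, rL, if_false]; exact le_rfl
    · have e : g h (.Half δ p r) = x h (.Half δ p r) := by simp only [hg, rF, if_false]
      rw [e, hstep, expect_Half, expect_Half]
      simp only [hg, rE, rL, if_false]; exact le_rfl
    · have e : g h (.Hi δ p r) = x h (.Hi δ p r) := by simp only [hg, rH, if_false]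
      rw [e, expect_Hi]
      refine (hH h).trans ?_
      simp [hg, GV.rank]
    · have e : g h (.Lo p r) = x h (.Lo p r) := by simp only [hg, rL, if_false]
      rw [e, expect_Lo]
      refine (hL h).trans ?_
      simp [hg, GV.rank]

/-- The value encoded by the checking gadget. -/
theorem gadget (hσ : Profile.Valid 𝓖 σ) (δ : Option (Q × Bool)) (p : Bool) (r : R)
    (h : List (GV Q R N)) : ∃ v : ℝ, 0 ≤ v ∧ v ≤ 1 ∧ (∀ f, M.forced n δ r = some f → v = f) ∧
      tval 𝓖 σ (r, p) true h (.Ev δ p r) = M.mult δ r * v / 8 ∧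
      tval 𝓖 σ (r, !p) true h (.Ev δ p r) = 1 / 2 - v / 4 := by
  have hm : (0 : ℝ) < M.mult δ r := by exact_mod_cast M.mult_pos δ r
  have hm8 : (8 : ℝ) / M.mult δ r * (M.mult δ r / 8) = 1 := by field_simp
  have hm2 : (2 : ℝ) / M.mult δ r * (M.mult δ r / 8) = 1 / 4 := by field_simp; norm_num
  refine ⟨8 / M.mult δ r * tval 𝓖 σ (r, p) true h (.Ev δ p r), ?_, ?_, ?_, ?_, ?_⟩
  · exact mul_nonneg (by positivity) (tval_nonneg _ _ _ _)
  · have := gadget_le hσ δ p r 0 (8 / M.mult δ r) 1 (by rw [hm8]; norm_num) (by norm_num) h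
    linarith
  · intro f hf
    rw [tval_step hσ, expect_Ev_some hf, tval_Hi hσ, tval_Lo hσ]
    simp
    field_simp
  · field_simp
  · have h1 := gadget_le hσ δ p r 1 (2 / M.mult δ r) (1 / 2) (by rw [hm2]; norm_num) (by norm_num) h
    have h2 := gadget_le hσ δ p r (-1) (-(2 / M.mult δ r)) (-(1 / 2))
      (by rw [neg_mul _ (_ / (8 : ℝ)), hm2]; norm_num) (by norm_num) h
    have e : (8 : ℝ) / M.mult δ r = 4 * (2 / M.mult δ r) := by ring
    rw [e]
    linarith

/-- A bound for the sum of the values of the two players of a register and a parity. -/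
noncomputable def pairBound (j : R × Bool) : GV Q R N → ℝ
  | .M _ _ => 1 / (2 * Fintype.card R)
  | .X _ _ _ => 1 / (2 * Fintype.card R)
  | .Ev _ _ r => if j.1 = r then 1 / 2 else 0
  | .Half _ _ r => if j.1 = r then 1 / 2 else 0
  | .Hi _ _ r => if j.1 = r then 1 / 2 else 0
  | .Lo _ r => if j.1 = r then 1 / 2 else 0
  | .Ex none => 0
  | .Ex (some (r, p, b)) => if (r, p) = j then (exitPay (Fintype.card R) b : ℚ) else 0
  | .T j' _ => if j' = j then 1 else 0
  | .Z => 0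

theorem exitPay_le (b : Bool) : ((exitPay (Fintype.card R) b : ℚ) : ℝ) ≤ 1 / (2 * Fintype.card R) := by
  have hd : (0 : ℝ) < Fintype.card R := by exact_mod_cast Fintype.card_pos
  cases b <;> simp only [exitPay] <;> push_cast <;>
    exact one_div_le_one_div_of_le (by positivity) (by linarith)

theorem pairBound_nonneg (j : R × Bool) (u : GV Q R N) : 0 ≤ pairBound j u := by
  have h2 : ∀ b, (0 : ℝ) ≤ (exitPay (Fintype.card R) b : ℚ) := fun b => by
    exact_mod_cast (exitPay_pos b).le
  rcases u with ⟨q, p⟩ | ⟨δ, p, i⟩ | (_ | ⟨r, p, b⟩) | ⟨δ, p, r⟩ | ⟨δ, p, r⟩ | ⟨δ, p, r⟩ | ⟨p, r⟩ | ⟨j, b⟩ | _ <;>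
    simp only [pairBound] <;> (try split_ifs) <;> first | positivity | exact h2 b

theorem tval_pair_le (hσ : Profile.Valid 𝓖 σ) (j : R × Bool) (h : List (GV Q R N)) (u : GV Q R N) :
    tval 𝓖 σ j true h u + tval 𝓖 σ j false h u ≤ pairBound j u := by
  have hd : (0 : ℝ) < Fintype.card R := by exact_mod_cast Fintype.card_pos
  refine harmonic_le hσ (fun _ _ => True) (fun _ _ _ _ _ _ => trivial)
    (fun h u => tval 𝓖 σ j true h u + tval 𝓖 σ j false h u) (fun _ u => pairBound j u) 2 ?_ ?_ ?_ ?_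
    ?_ ?_ h u trivial
  · intro h u
    linarith [tval_le_one (M := M) (en := en) (pl := pl) (n := n) (σ := σ) j true h u,
      tval_le_one (M := M) (en := en) (pl := pl) (n := n) (σ := σ) j false h u]
  · intro h u; linarith [pairBound_nonneg j u]
  · intro h j' b _
    simp only [tval_T hσ, pairBound]
    by_cases hj : j' = j <;> cases b <;> simp [hj]
  · intro h _
    simp [tval_Z hσ, pairBound]
  · intro h u _ _
    rw [tval_step hσ, tval_step hσ j false]
    simp only [expect, mul_add, Finset.sum_add_distrib]; exact le_rfl
  · intro h u _ hu
    have he := exitPay_le (R := R)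
    have h2 : ∀ b, (0 : ℝ) ≤ (exitPay (Fintype.card R) b : ℚ) := fun b => by
      exact_mod_cast (exitPay_pos b).le
    have hm : ∀ o : Option (R × Bool × Bool), pairBound j (GV.Ex o : GV Q R N) ≤ 1 / (2 * Fintype.card R) := by
      rintro (_ | ⟨r, p, b⟩) <;> simp only [pairBound]
      · positivity
      · split_ifs
        · exact he b
        · positivity
    rcases u with ⟨q, p⟩ | ⟨δ, p, i⟩ | (_ | ⟨r, p, b⟩) | ⟨δ, p, r⟩ | ⟨δ, p, r⟩ | ⟨δ, p, r⟩ | ⟨p, r⟩ | ⟨j', b⟩ | _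
    · rcases hq : M.bad q with _ | _
      · refine expect_inl_le hσ (node_M hq) (by simp) h ?_ ?_ <;> intro _ <;> exact le_rfl
      · rw [expect_M_bad hq]; simp [pairBound]
    · by_cases hi : i.val < N
      · refine expect_inl_le hσ (node_X hi) (by simp) h (fun _ => le_rfl) (fun _ => hm _)
      · rw [expect_X_last hi]
        simp only [pairBound, Finset.sum_ite_eq, Finset.mem_univ, if_true]
        field_simp; norm_num
    · rw [expect_Ex_none]; simp [pairBound]
    · rw [expect_Ex]; simp only [pairBound]
      split_ifs <;> simp
    · rcases hf : M.forced n δ r with _ | v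
      · refine expect_inl_le hσ (node_Ev_none hf) (by simp) h ?_ ?_ <;> intro _ <;> exact le_rfl
      · rw [expect_Ev_some hf]; simp only [pairBound]
        apply le_of_eq; ring
    · rw [expect_Half]; simp only [pairBound]
      apply le_of_eq; ring
    · obtain ⟨r', p'⟩ := j
      rw [expect_Hi]; simp only [pairBound, Prod.mk.injEq]
      by_cases hr : r = r'
      · subst hr; cases p <;> cases p' <;> simp <;> norm_num
      · simp [hr, Ne.symm hr]
    · obtain ⟨r', p'⟩ := j
      rw [expect_Lo]; simp only [pairBound, Prod.mk.injEq]
      by_cases hr : r = r'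
      · subst hr; cases p <;> cases p' <;> simp
      · simp [hr, Ne.symm hr]
    · simp [GV.rank] at hu
    · simp [GV.rank] at hu

end Soundness

theorem CMachine.mult_mul_pow {Q R : Type} [DecidableEq R] (M : CMachine Q R) (x : Q × (R → ℕ)) (r : R) :
    (M.mult (some (x.1, M.branch x)) r : ℝ) * (1 / 2) ^ x.2 r = (1 / 2) ^ M.upd x.1 (M.branch x) x.2 r := by
  simp only [CMachine.mult, CMachine.upd]
  by_cases h : M.branch x = true ∧ r = M.test x.1
  · rw [if_pos h, if_pos h]
    obtain ⟨h1, rfl⟩ := h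
    have : x.2 (M.test x.1) ≠ 0 := by simpa [CMachine.branch] using h1
    obtain ⟨m, hm⟩ := Nat.exists_eq_succ_of_ne_zero this
    rw [hm, Nat.succ_sub_one, pow_succ]; push_cast; ring
  · rw [if_neg h, if_neg h]
    split_ifs
    · rw [pow_succ]; push_cast; ring
    · simp

section Soundness

variable {Q R : Type} [DecidableEq R] [Fintype R] [Fintype Q] {N k : ℕ}
  {M : CMachine Q R} {en : Fin N ≃ Option (R × Bool)} {pl : Option (R × Bool × Bool) ≃ Fin k} {n : ℕ}

local notation "𝓖" => gameArena M en pl n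

variable [Nonempty R] {σ : Profile k (GV Q R N)} {h : List (GV Q R N)}
  (hσ : Profile.Valid (gameArena M en pl n) σ)
  (hst : Stable (gameArena M en pl n) (fun i => {v | gameTarget Q N pl i v = true}) σ)
  (h0 : rval (gameArena M en pl n) σ {v | gameTarget Q N pl 0 v = true} [] (gameArena M en pl n).init = 0)

include hσ h0 in
theorem not_visited_Z : ¬ Visited 𝓖 σ h .Z := by
  classical
  intro hv
  rw [gameTarget_zero] at h0
  have := hv.rval_eq_zero (gameArena_wf M en pl n) hσ (by rintro v rfl; exact terminal_Z) h0
  rw [rval_terminal (gameArena_wf M en pl n) hσ _ terminal_Z] at this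
  simp at this

include hσ h0 in
theorem not_visited_Ex (o : Option (R × Bool × Bool)) : ¬ Visited 𝓖 σ h (.Ex o) := by
  intro hv
  rcases o with _ | ⟨r, p, b⟩
  · exact not_visited_Z hσ h0 (hv.step (rstep_inr_pos σ (u := .Ex none) rfl h one_pos (by simp)))
  · exact not_visited_Z hσ h0 (hv.step (rstep_inr_pos σ (u := .Ex (some (r, p, b))) rfl h
      (w := 1 - exitPay (Fintype.card R) b) (by linarith [exitPay_lt_one (R := R) b]) (by simp)))

include hσ h0 in
theorem not_visited_bad {q : Q} {p : Bool} (hv : Visited 𝓖 σ h (.M q p)) : M.bad q = false := by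
  by_contra hb
  exact not_visited_Z hσ h0 (hv.step (rstep_inr_pos σ
    (node_M_bad (by simpa using hb)) h one_pos (by simp)))

include hσ hst in
theorem tval_oneShot {u a b : GV Q R N} {r : R} {p c : Bool}
    (hu : node M en n u = .inl (some (r, p, c), a, b)) (hv : Visited 𝓖 σ h u) :
    tval 𝓖 σ (r, p) c (h ++ [u]) a ≤ tval 𝓖 σ (r, p) c h u ∧
    tval 𝓖 σ (r, p) c (h ++ [u]) b ≤ tval 𝓖 σ (r, p) c h u := by
  have hF : ∀ v ∈ {v | gameTarget Q N pl (pl (some (r, p, c))).succ v = true}, (𝓖).terminal v :=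
    fun v hv => gameTarget_terminal M en pl n _ v hv
  have ho := gameArena_owner_inl M en pl n hu
  have hn := gameArena_next_inl M en pl n hu
  have h1 := hst.oneShot (gameArena_wf M en pl n) hσ (Fin.succ_ne_zero _) hF hv ho
    (v := a) (by rw [hn]; simp)
  have h2 := hst.oneShot (gameArena_wf M en pl n) hσ (Fin.succ_ne_zero _) hF hv ho
    (v := b) (by rw [hn]; simp)
  simp only [gameTarget_some] at h1 h2
  exact ⟨h1, h2⟩

include hσ hst h0 in
theorem exits_passed (δ : Option (Q × Bool)) (p : Bool) (m : ℕ) : ∀ (i : Fin (N + 1)) (h : List (GV Q R N)),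
    i.val + m = N → Visited 𝓖 σ h (.X δ p i) →
    (∃ h', Visited 𝓖 σ h' (.X δ p (Fin.last N)) ∧
      ∀ j b, tval 𝓖 σ j b h' (.X δ p (Fin.last N)) = tval 𝓖 σ j b h (.X δ p i)) ∧
    ∀ l : Fin N, i.val ≤ l.val → ∀ r b, en l = some (r, b) →
      (exitPay (Fintype.card R) b : ℝ) ≤ tval 𝓖 σ (r, p) b h (.X δ p i) := by
  induction m with
  | zero =>
    intro i h hi hv
    have : i = Fin.last N := Fin.ext (by simpa using hi)
    subst this
    refine ⟨⟨h, hv, fun _ _ => rfl⟩, fun l hl => ?_⟩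
    have := l.2
    simp at hl; omega
  | succ m ih =>
    intro i h hi hv
    have hiN : i.val < N := by omega
    have hE : rstep 𝓖 σ h (.X δ p i) (.Ex (exitPlayer p (en ⟨i, hiN⟩))) = 0 := by
      by_contra hne
      exact not_visited_Ex hσ h0 _ (hv.step hne)
    have hsum := rstep_inl_add hσ (node_X (p := p) (δ := δ) (M := M) (en := en) (n := n) hiN) (by simp) h
    rw [hE, add_zero] at hsum
    have hval : ∀ j b, tval 𝓖 σ j b (h ++ [.X δ p i]) (.X δ p ⟨i + 1, by omega⟩) =
        tval 𝓖 σ j b h (.X δ p i) := by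
      intro j b
      rw [tval_step hσ j b h, expect_inl hσ (node_X hiN) (by simp), hsum, hE]; simp
    obtain ⟨⟨h', hv', hval'⟩, hex⟩ := ih ⟨i + 1, by omega⟩ (h ++ [.X δ p i]) (by simp; omega)
      (hv.step (by rw [hsum]; exact one_ne_zero))
    refine ⟨⟨h', hv', fun j b => (hval' j b).trans (hval j b)⟩, fun l hl r b hlb => ?_⟩
    rcases hl.eq_or_lt with hl | hl
    · have e : (⟨i, hiN⟩ : Fin N) = l := Fin.ext hl
      have hnode := node_X (M := M) (n := n) (en := en) (δ := δ) (p := p) hiN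
      rw [e, hlb] at hnode
      have := (tval_oneShot hσ hst hnode hv).2
      rwa [exitPlayer, tval_Ex hσ] at this
    · rw [← hval]
      exact hex l hl r b hlb

theorem exitPay_add : ((exitPay (Fintype.card R) true : ℚ) : ℝ) + (exitPay (Fintype.card R) false : ℚ) =
    1 / (2 * Fintype.card R) := by
  have hd : (0 : ℝ) < Fintype.card R := by exact_mod_cast Fintype.card_pos
  simp only [exitPay]; push_cast; simp; field_simp; norm_num

include hσ hst h0 in
theorem tval_check {δ : Option (Q × Bool)} {p : Bool} (hv : Visited 𝓖 σ h (.X δ p 0)) :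
    (∀ r, tval 𝓖 σ (r, p) true h (.X δ p 0) = 1 / (6 * Fintype.card R)) ∧
    ∃ h', Visited 𝓖 σ h' (.X δ p (Fin.last N)) ∧
      ∀ j b, tval 𝓖 σ j b h' (.X δ p (Fin.last N)) = tval 𝓖 σ j b h (.X δ p 0) := by
  obtain ⟨h1, h2⟩ := exits_passed hσ hst h0 δ p N 0 h (by simp) hv
  refine ⟨fun r => ?_, h1⟩
  have e1 := h2 (en.symm (some (r, true))) (Nat.zero_le _) r true (by simp)
  have e2 := h2 (en.symm (some (r, false))) (Nat.zero_le _) r false (by simp)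
  have e3 := tval_pair_le hσ (r, p) h (.X δ p 0)
  rw [pairBound, ← exitPay_add] at e3
  have e4 : tval 𝓖 σ (r, p) true h (.X δ p 0) = (exitPay (Fintype.card R) true : ℚ) := by linarith
  rw [e4]; simp [exitPay]

include hσ hst h0 in
theorem tval_M {q : Q} {p : Bool} (hv : Visited 𝓖 σ h (.M q p)) (r : R) :
    tval 𝓖 σ (r, p) true h (.M q p) = 1 / (6 * Fintype.card R) := by
  have hq := not_visited_bad hσ h0 hv
  rw [tval_step hσ]
  refine le_antisymm (expect_inl_le hσ (node_M hq) (by simp) h ?_ ?_)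
    (expect_inl_ge hσ (node_M hq) (by simp) h ?_ ?_) <;> intro hne <;>
    rw [(tval_check hσ hst h0 (hv.step hne)).1]

include hσ hst h0 in
theorem tval_phase {δ : Option (Q × Bool)} {p : Bool} (hv : Visited 𝓖 σ h (.X δ p 0)) :
    ∃ v : R → ℝ, (∀ r, 0 ≤ v r ∧ v r ≤ 1 ∧ ∀ f, M.forced n δ r = some f → v r = f) ∧
      (∀ r, tval 𝓖 σ (r, !p) true h (.X δ p 0) = 1 / (3 * Fintype.card R) - v r / (8 * Fintype.card R)) ∧
      ∃ h', Visited 𝓖 σ h' (.M (M.tgt δ) (!p)) ∧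
        ∀ r, tval 𝓖 σ (r, p) true h' (.M (M.tgt δ) (!p)) =
          1 / (3 * Fintype.card R) - M.mult δ r * v r / (8 * Fintype.card R) := by
  have hd : (0 : ℝ) < Fintype.card R := by exact_mod_cast Fintype.card_pos
  obtain ⟨hv6, h', hv', hval⟩ := tval_check hσ hst h0 hv
  have hlast : ¬ (Fin.last N).val < N := by simp
  have hvM : Visited 𝓖 σ (h' ++ [.X δ p (Fin.last N)]) (.M (M.tgt δ) (!p)) :=
    hv'.step (rstep_inr_pos σ (node_X_last hlast) h' (w := 1 / 2) (by norm_num) (by simp))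
  have hother : ∀ (r r' : R) (p' : Bool) (g : List (GV Q R N)), r' ≠ r →
      tval 𝓖 σ (r, p') true g (.Ev δ p r') = 0 := by
    intro r r' p' g hr
    have h1 := tval_pair_le hσ (r, p') g (.Ev δ p r')
    rw [pairBound, if_neg (fun e => hr e.symm)] at h1
    have h2 := tval_nonneg (M := M) (en := en) (pl := pl) (n := n) (σ := σ) (r, p') true g (.Ev δ p r')
    have h3 := tval_nonneg (M := M) (en := en) (pl := pl) (n := n) (σ := σ) (r, p') false g (.Ev δ p r')
    linarith
  choose v hv0 hv1 hvf hvp hvn using fun r => gadget hσ δ p r (h' ++ [.X δ p (Fin.last N)])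
  have hX : ∀ r p', tval 𝓖 σ (r, p') true h (.X δ p 0) =
      1 / 2 * tval 𝓖 σ (r, p') true (h' ++ [.X δ p (Fin.last N)]) (.M (M.tgt δ) (!p)) +
      1 / (2 * Fintype.card R) * tval 𝓖 σ (r, p') true (h' ++ [.X δ p (Fin.last N)]) (.Ev δ p r) := by
    intro r p'
    rw [← hval, tval_step hσ, expect_X_last hlast, Finset.sum_eq_single r]
    · intro r' _ hr; exact hother r r' p' _ hr
    · simp
  refine ⟨v, fun r => ⟨hv0 r, hv1 r, hvf r⟩, fun r => ?_, _, hvM, fun r => ?_⟩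
  · rw [hX, tval_M hσ hst h0 hvM, hvn]
    field_simp; ring
  · have := hX r p
    rw [hv6, hvp] at this
    have e : tval 𝓖 σ (r, p) true (h' ++ [.X δ p (Fin.last N)]) (.M (M.tgt δ) (!p)) =
      2 * (1 / (6 * Fintype.card R) - 1 / (2 * Fintype.card R) * (M.mult δ r * v r / 8)) := by linarith
    rw [e]; field_simp; ring

include hσ hst h0 in
theorem tval_M_ge {q : Q} {p : Bool} (hv : Visited 𝓖 σ h (.M q p)) (r : R) :
    1 / (3 * Fintype.card R : ℝ) - 1 / (8 * Fintype.card R) ≤ tval 𝓖 σ (r, !p) true h (.M q p) := by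
  have hd : (0 : ℝ) < Fintype.card R := by exact_mod_cast Fintype.card_pos
  have hq := not_visited_bad hσ h0 hv
  rw [tval_step hσ]
  refine expect_inl_ge hσ (node_M hq) (by simp) h ?_ ?_ <;> intro hne <;>
  · obtain ⟨v, hv1, hv2, -⟩ := tval_phase hσ hst h0 (hv.step hne)
    rw [hv2]
    have := div_le_div_of_nonneg_right (hv1 r).2.1 (by positivity : (0 : ℝ) ≤ 8 * Fintype.card R)
    linarith

include hσ hst h0 in
theorem visited_cfg (t : ℕ) : ∃ h p, Visited 𝓖 σ h (.M (M.cfg n t).1 p) ∧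
    ∀ r, tval 𝓖 σ (r, !p) true h (.M (M.cfg n t).1 p) =
      1 / (3 * Fintype.card R) - (1 / 2) ^ (M.cfg n t).2 r / (8 * Fintype.card R) := by
  have hd : (0 : ℝ) < Fintype.card R := by exact_mod_cast Fintype.card_pos
  have hinj : ∀ x y : ℝ, 1 / (3 * Fintype.card R : ℝ) - x / (8 * Fintype.card R) =
      1 / (3 * Fintype.card R) - y / (8 * Fintype.card R) → x = y := by
    intro x y hxy
    have : x / (8 * Fintype.card R : ℝ) = y / (8 * Fintype.card R) := by linarith
    field_simp at this
    exact this
  induction t with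
  | zero =>
    obtain ⟨v, hv1, hv2, h', hv', hv3⟩ := tval_phase hσ hst h0 (Visited.init (A := 𝓖) (σ := σ))
    refine ⟨h', true, hv', fun r => (hv3 r).trans ?_⟩
    rw [(hv1 r).2.2 _ rfl]
    simp only [CMachine.mult, CMachine.cfg]
    split_ifs <;> simp
  | succ t ih =>
    obtain ⟨h, p, hv, hval⟩ := ih
    set x := M.cfg n t with hx
    have hq := not_visited_bad hσ h0 hv
    have hnode := node_M (p := p) (en := en) (n := n) hq
    set u : GV Q R N := .M x.1 p with hu
    have hshot := tval_oneShot hσ hst hnode hv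
    have hadd := rstep_inl_add hσ hnode (by simp) h
    have hexp := fun j b => (tval_step hσ j b h u).trans
      (expect_inl hσ hnode (by simp) h (tval 𝓖 σ j b (h ++ [u])))
    have hsuppval : ∀ b, rstep 𝓖 σ h u (.X (some (x.1, b)) p 0) ≠ 0 →
        tval 𝓖 σ (M.test x.1, !p) true (h ++ [u]) (.X (some (x.1, b)) p 0) =
          tval 𝓖 σ (M.test x.1, !p) true h u := by
      have e := hexp (M.test x.1, !p) true
      have n1 := rstep_nonneg 𝓖 σ h u (.X (some (x.1, true)) p 0)
      have n2 := rstep_nonneg 𝓖 σ h u (.X (some (x.1, false)) p 0)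
      intro b hb
      cases b
      · have := lt_of_le_of_ne n2 hb.symm
        refine le_antisymm hshot.2 ?_
        by_contra hlt
        push Not at hlt
        have h1 := mul_le_mul_of_nonneg_left hshot.1 n1
        have h2 := mul_lt_mul_of_pos_left hlt this
        have : tval 𝓖 σ (M.test x.1, !p) true h u < (rstep 𝓖 σ h u (.X (some (x.1, true)) p 0) +
          rstep 𝓖 σ h u (.X (some (x.1, false)) p 0)) * tval 𝓖 σ (M.test x.1, !p) true h u := by
          rw [add_mul]; linarith
        rw [hadd, one_mul] at this
        exact lt_irrefl _ this
      · have := lt_of_le_of_ne n1 hb.symm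
        refine le_antisymm hshot.1 ?_
        by_contra hlt
        push Not at hlt
        have h1 := mul_le_mul_of_nonneg_left hshot.2 n2
        have h2 := mul_lt_mul_of_pos_left hlt this
        have : tval 𝓖 σ (M.test x.1, !p) true h u < (rstep 𝓖 σ h u (.X (some (x.1, true)) p 0) +
          rstep 𝓖 σ h u (.X (some (x.1, false)) p 0)) * tval 𝓖 σ (M.test x.1, !p) true h u := by
          rw [add_mul]; linarith
        rw [hadd, one_mul] at this
        exact lt_irrefl _ this
    have hbr : ∀ b, rstep 𝓖 σ h u (.X (some (x.1, b)) p 0) ≠ 0 → b = M.branch x := by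
      intro b hb
      obtain ⟨v, hv1, hv2, h', hv', hv3⟩ := tval_phase hσ hst h0 (hv.step hb)
      have e : v (M.test x.1) = (1 / 2) ^ x.2 (M.test x.1) := by
        apply hinj
        rw [← hv2, hsuppval b hb, hval]
      cases b
      · have h1 := (hv1 (M.test x.1)).2.2 1 (by simp [CMachine.forced])
        rw [h1] at e
        have : x.2 (M.test x.1) = 0 := by
          by_contra hne
          have := pow_lt_one₀ (by norm_num : (0 : ℝ) ≤ 1 / 2) (by norm_num) hne
          rw [← e] at this
          norm_num at this
        simp [CMachine.branch, this]
      · have h1 := tval_M_ge hσ hst h0 hv' (M.test x.1)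
        rw [Bool.not_not, hv3, e] at h1
        have hm : M.mult (some (x.1, true)) (M.test x.1) = 2 := by simp [CMachine.mult]
        rw [hm] at h1
        have : x.2 (M.test x.1) ≠ 0 := by
          intro h0
          rw [h0] at h1
          have h2 : (2 : ℝ) / (8 * Fintype.card R) ≤ 1 / (8 * Fintype.card R) := by
            norm_num at h1 ⊢; linarith
          rw [div_le_div_iff_of_pos_right (by positivity)] at h2
          norm_num at h2
        simp [CMachine.branch, this]
    have hone : rstep 𝓖 σ h u (.X (some (x.1, M.branch x)) p 0) = 1 ∧
        rstep 𝓖 σ h u (.X (some (x.1, !M.branch x)) p 0) = 0 := by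
      have hz : rstep 𝓖 σ h u (.X (some (x.1, !M.branch x)) p 0) = 0 := by
        by_contra hne
        have := hbr _ hne
        simp at this
      refine ⟨?_, hz⟩
      revert hz
      rcases M.branch x with _ | _ <;> simp only [Bool.not_false, Bool.not_true] <;> intro hz <;>
        rw [hz] at hadd <;> simpa using hadd
    have hvX : Visited 𝓖 σ (h ++ [u]) (.X (some (x.1, M.branch x)) p 0) :=
      hv.step (by rw [hone.1]; exact one_ne_zero)
    have hvalX : ∀ j b, tval 𝓖 σ j b (h ++ [u]) (.X (some (x.1, M.branch x)) p 0) = tval 𝓖 σ j b h u := by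
      intro j b
      rw [hexp]
      revert hone
      rcases M.branch x with _ | _ <;> simp only [Bool.not_false, Bool.not_true] <;>
        rintro ⟨e1, e2⟩ <;> rw [e1, e2] <;> simp
    obtain ⟨v, hv1, hv2, h', hv', hv3⟩ := tval_phase hσ hst h0 hvX
    refine ⟨h', !p, hv', fun r => ?_⟩
    have e : v r = (1 / 2) ^ x.2 r := by
      apply hinj
      rw [← hv2, hvalX, hval]
    rw [Bool.not_not]
    refine (hv3 r).trans ?_
    rw [e, CMachine.mult_mul_pow]; rfl

include hσ hst h0 in
/-- An equilibrium with payoff `0` for the system simulates the machine. -/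
theorem soundness : (∀ t, M.bad (M.cfg n t).1 = false) ∧
    ((∀ i, Strategy.FiniteState (σ i)) → ∀ r, (Set.range fun t => (M.cfg n t).2 r).Finite) := by
  refine ⟨fun t => ?_, fun hfs r => ?_⟩
  · obtain ⟨h, p, hv, -⟩ := visited_cfg hσ hst h0 t
    exact not_visited_bad hσ h0 hv
  · have hd : (0 : ℝ) < Fintype.card R := by exact_mod_cast Fintype.card_pos
    have hfin := (finite_range_rval hfs 𝓖 {.T (r, true) true}).union
      (finite_range_rval hfs 𝓖 {.T (r, false) true})
    have hinj : Function.Injective fun c : ℕ =>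
        1 / (3 * Fintype.card R : ℝ) - (1 / 2) ^ c / (8 * Fintype.card R) := by
      intro a b hab
      have : (1 / 2 : ℝ) ^ a / (8 * Fintype.card R) = (1 / 2) ^ b / (8 * Fintype.card R) := by
        simp only at hab; linarith
      rw [div_left_inj' (by positivity)] at this
      exact pow_right_injective₀ (by norm_num) (by norm_num) this
    refine (hfin.preimage hinj.injOn).subset ?_
    rintro _ ⟨t, rfl⟩
    obtain ⟨h, p, hv, hval⟩ := visited_cfg hσ hst h0 t
    simp only [Set.mem_preimage]
    rw [← hval r]
    cases p
    · exact Or.inl ⟨(h, _), rfl⟩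
    · exact Or.inr ⟨(h, _), rfl⟩

end Soundness

section Completeness

variable {Q R : Type} [DecidableEq R] {N k : ℕ}
  (M : CMachine Q R) (en : Fin N ≃ Option (R × Bool)) {pl : Option (R × Bool × Bool) ≃ Fin k} (n : ℕ)

/-- The transition leading to the configuration at time `t`. -/
def CMachine.del : ℕ → Option (Q × Bool)
  | 0 => none
  | t + 1 => some ((M.cfg n t).1, M.branch (M.cfg n t))

theorem CMachine.tgt_del (t : ℕ) : M.tgt (M.del n t) = (M.cfg n t).1 := by
  cases t <;> rfl

theorem CMachine.mult_mul_pow_del (t : ℕ) (r : R) :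
    (M.mult (M.del n t) r : ℝ) * (1 / 2) ^ (M.cfg n (t - 1)).2 r = (1 / 2) ^ (M.cfg n t).2 r := by
  cases t with
  | zero => simp [del, mult]
  | succ t => exact M.mult_mul_pow _ _

theorem CMachine.forced_del {t : ℕ} {r : R} {v : ℚ} (h : M.forced n (M.del n t) r = some v) :
    (v : ℝ) = (1 / 2) ^ (M.cfg n (t - 1)).2 r := by
  cases t with
  | zero =>
    simp only [del, forced, Option.some.injEq] at h
    subst h
    simp only [cfg, Nat.zero_sub]
    split_ifs <;> simp
  | succ t =>
    simp only [del, forced] at h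
    split_ifs at h with h1
    obtain ⟨h1, rfl⟩ := h1
    cases h
    have : (M.cfg n t).2 (M.test (M.cfg n t).1) = 0 := by simpa [branch] using h1
    simp [this]

/-- Memory update: number of phases, and number of halving steps in the current gadget. -/
def memUpd (m : ℕ × ℕ) : GV Q R N → ℕ × ℕ
  | .M _ _ => (m.1 + 1, m.2)
  | .X _ _ _ => (m.1, 0)
  | .Half _ _ _ => (m.1, m.2 + 1)
  | _ => m

/-- Memory of a history. -/
def mem (h : List (GV Q R N)) : ℕ × ℕ := h.foldl memUpd (0, 0)

theorem mem_append (h : List (GV Q R N)) (u : GV Q R N) : mem (h ++ [u]) = memUpd (mem h) u := by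
  simp [mem]

open scoped Classical in
/-- The simulating move. -/
noncomputable def follow (m : ℕ × ℕ) : GV Q R N → GV Q R N
  | .M q p => .X (some (q, M.branch (M.cfg n m.1))) p 0
  | .X δ p i => if h : i.val < N then
      if en ⟨i, h⟩ = none ∧ δ ≠ M.del n m.1 then .Ex none else .X δ p ⟨i + 1, by omega⟩
      else .Z
  | .Ev δ p r => if m.2 < (M.cfg n (m.1 - 1)).2 r then .Half δ p r else .Hi δ p r
  | u => u

/-- Value of a player in terms of `2 ^ (-c)`, when the other parity is next. -/
noncomputable def farVal (d : ℕ) (b : Bool) (v : ℝ) : ℝ :=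
  if b then 1 / (3 * d) - v / (8 * d) else 1 / (6 * d) + v / (8 * d)

/-- Value of a player at the beginning of a phase. -/
noncomputable def phaseVal (d : ℕ) (j : R × Bool) (b : Bool) (c : R → ℕ) (p : Bool) : ℝ :=
  if p = j.2 then (exitPay d b : ℚ) else farVal d b ((1 / 2) ^ c j.1)

/-- Value of a player in its gadget. -/
noncomputable def gadVal (m v : ℝ) (p p0 b : Bool) : ℝ :=
  if p = p0 then (if b then m * v / 8 else 1 / 2 - m * v / 8) else (if b then 1 / 2 - v / 4 else v / 4)

theorem phaseVal_eq {d : ℕ} (hd : 0 < d) (j : R × Bool) (b : Bool) (c c' : R → ℕ) (p : Bool) (m : ℝ)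
    (h : m * (1 / 2) ^ c j.1 = (1 / 2) ^ c' j.1) :
    phaseVal d j b c p = 1 / 2 * phaseVal d j b c' (!p) +
      1 / (2 * d) * gadVal m ((1 / 2) ^ c j.1) p j.2 b := by
  obtain ⟨r, p0⟩ := j
  have hd' : (0 : ℝ) < d := by exact_mod_cast hd
  simp only [phaseVal, gadVal, farVal, exitPay] at *
  rw [h]
  cases b <;> cases p <;> cases p0 <;> simp <;> field_simp <;> ring

theorem phaseVal_nonneg (d : ℕ) (j : R × Bool) (b : Bool) (c : R → ℕ) (p : Bool) :
    0 ≤ phaseVal d j b c p := by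
  rcases d.eq_zero_or_pos with rfl | hd
  · simp only [phaseVal, farVal, exitPay]
    split_ifs <;> simp
  have hd' : (0 : ℝ) < d := by exact_mod_cast hd
  have h1 : ((1 : ℝ) / 2) ^ c j.1 ≤ 1 := pow_le_one₀ (by norm_num) (by norm_num)
  have h2 : (0 : ℝ) ≤ (1 / 2) ^ c j.1 := by positivity
  simp only [phaseVal, farVal, exitPay]
  split_ifs
  · push_cast; positivity
  · push_cast; positivity
  · have := div_le_div_of_nonneg_right h1 (by positivity : (0 : ℝ) ≤ 8 * d)
    have : (1 : ℝ) / (8 * d) ≤ 1 / (3 * d) :=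
      div_le_div_of_nonneg_left (by norm_num) (by positivity) (by linarith)
    linarith
  · positivity

/-- Value in a gadget with `j` halving steps made. -/
noncomputable def gadArg (m : ℕ × ℕ) (r : R) : ℝ := (1 / 2) ^ ((M.cfg n (m.1 - 1)).2 r - m.2)

open scoped Classical in
/-- The value function of the player with target `T j b`. -/
noncomputable def potential [Fintype R] (j : R × Bool) (b : Bool) (m : ℕ × ℕ) : GV Q R N → ℝ
  | .M _ p => phaseVal (Fintype.card R) j b (M.cfg n m.1).2 p
  | .X δ p _ => if δ = M.del n m.1 then phaseVal (Fintype.card R) j b (M.cfg n (m.1 - 1)).2 p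
      else if p = j.2 then (exitPay (Fintype.card R) b : ℚ) else 0
  | .Ex o => if o = some (j.1, j.2, b) then (exitPay (Fintype.card R) b : ℚ) else 0
  | .Ev δ p r => if r = j.1 then gadVal (M.mult δ r)
      (match M.forced n δ r with
        | some v => v
        | none => gadArg M n m r) p j.2 b else 0
  | .Half δ p r => if r = j.1 then 1 / 2 * gadVal (M.mult δ r) 0 p j.2 b +
      1 / 2 * gadVal (M.mult δ r) (gadArg M n (m.1, m.2 + 1) r) p j.2 b else 0
  | .Hi δ p r => if r = j.1 then gadVal (M.mult δ r) 1 p j.2 b else 0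
  | .Lo p r => if r = j.1 then gadVal 0 0 p j.2 b else 0
  | .T j' b' => if j' = j ∧ b' = b then 1 else 0
  | .Z => 0

/-- Positions consistent with the simulation. -/
def OnTrack (m : ℕ × ℕ) : GV Q R N → Prop
  | .M q _ => q = (M.cfg n m.1).1
  | .X δ _ _ => δ = M.del n m.1
  | .Ev δ _ _ => δ = M.del n m.1
  | .Half δ _ r => δ = M.del n m.1 ∧ M.forced n δ r = none
  | .Hi δ _ _ => δ = M.del n m.1
  | _ => True

variable [Fintype R] [Fintype Q] [Nonempty R]

variable {M en n}

local notation "𝓖" => gameArena M en pl n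

theorem gadVal_zero (m m' : ℝ) (p p0 b : Bool) : gadVal m 0 p p0 b = gadVal m' 0 p p0 b := by
  simp [gadVal]

theorem gadVal_convex (m w : ℝ) (p p0 b : Bool) :
    w * gadVal m 1 p p0 b + (1 - w) * gadVal m 0 p p0 b = gadVal m w p p0 b := by
  simp only [gadVal]; split_ifs <;> ring

theorem gadVal_half (m w : ℝ) (p p0 b : Bool) :
    1 / 2 * gadVal m 0 p p0 b + 1 / 2 * gadVal m w p p0 b = gadVal m (1 / 2 * w) p p0 b := by
  simp only [gadVal]; split_ifs <;> ring

/-- The value function is harmonic where the simulation is followed. -/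
theorem potential_harmonic {σ : Profile k (GV Q R N)} (j : R × Bool) (b : Bool)
    (hbad : ∀ t, M.bad (M.cfg n t).1 = false) {h : List (GV Q R N)} {u : GV Q R N}
    (hu : OnTrack M n (mem h) u)
    (hfol : ∀ x, node M en n u = .inl x → ∀ f, expect 𝓖 σ h u f = f (follow M en n (mem h) u)) :
    expect 𝓖 σ h u (potential M n j b (mem (h ++ [u]))) = potential M n j b (mem h) u := by
  classical
  have hcard : 0 < Fintype.card R := Fintype.card_pos
  rw [mem_append]
  set m := mem h with hm
  rcases u with ⟨q, p⟩ | ⟨δ, p, i⟩ | (_ | ⟨r, p, b'⟩) | ⟨δ, p, r⟩ | ⟨δ, p, r⟩ | ⟨δ, p, r⟩ | ⟨p, r⟩ | ⟨j', b'⟩ | _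
  · obtain rfl : q = _ := hu
    rw [hfol _ (node_M (hbad _))]
    simp [follow, potential, memUpd, CMachine.del]
  · obtain rfl : δ = _ := hu
    by_cases hi : i.val < N
    · rw [hfol _ (node_X hi)]
      simp [follow, potential, memUpd, hi]
    · rw [expect_X_last hi]
      simp only [memUpd, potential]
      rw [Finset.sum_ite_eq' Finset.univ j.1]
      simp only [Finset.mem_univ, if_true]
      have e : (match M.forced n (M.del n m.1) j.1 with
        | some v => (v : ℝ)
        | none => gadArg M n (m.1, 0) j.1) = (1 / 2) ^ (M.cfg n (m.1 - 1)).2 j.1 := by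
        rcases hf : M.forced n (M.del n m.1) j.1 with _ | v
        · simp [gadArg]
        · exact M.forced_del n hf
      rw [e, phaseVal_eq hcard j b _ _ p _ (M.mult_mul_pow_del n m.1 j.1)]
  · rw [expect_Ex_none]; simp [potential]
  · rw [expect_Ex]
    simp only [potential, memUpd, Option.some.injEq, Prod.mk.injEq]
    by_cases e : r = j.1 ∧ p = j.2 ∧ b' = b
    · obtain ⟨rfl, rfl, rfl⟩ := e; simp
    · have e2 : ¬ ((r, p) = j ∧ b' = b) := by
        rintro ⟨rfl, rfl⟩; simp at e
      simp [e, e2]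
  · obtain rfl : δ = _ := hu
    rcases hf : M.forced n (M.del n m.1) r with _ | v
    · rw [hfol _ (node_Ev_none hf)]
      by_cases hr : r = j.1
      · subst hr
        simp only [follow]
        split_ifs with hlt
        · simp only [potential, memUpd, if_true, hf, gadVal_half]
          congr 1
          rw [gadArg, gadArg]
          have : (M.cfg n (m.1 - 1)).2 j.1 - m.2 = (M.cfg n (m.1 - 1)).2 j.1 - (m.2 + 1) + 1 := by omega
          simp only [this, pow_succ]; ring
        · have : (M.cfg n (m.1 - 1)).2 j.1 - m.2 = 0 := by omega
          simp [potential, hf, gadArg, this]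
      · simp only [follow]
        split_ifs <;> simp [potential, hr]
    · rw [expect_Ev_some hf]
      by_cases hr : r = j.1
      · subst hr
        simp only [potential, if_true, hf]
        rw [gadVal_zero 0 (M.mult (M.del n m.1) j.1), gadVal_convex]
      · simp [potential, hr]
  · obtain ⟨rfl, hf⟩ : δ = _ ∧ _ := hu
    rw [expect_Half]
    by_cases hr : r = j.1
    · subst hr
      simp only [potential, memUpd, if_true, hf]
      rw [gadVal_zero 0 (M.mult (M.del n m.1) j.1)]
    · simp [potential, hr]
  · rw [expect_Hi]
    obtain ⟨r0, p0⟩ := j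
    by_cases hr : r = r0
    · subst hr
      simp only [potential, gadVal, Prod.mk.injEq]
      cases b <;> cases p <;> cases p0 <;> simp <;> norm_num
    · simp [potential, hr]
  · rw [expect_Lo]
    obtain ⟨r0, p0⟩ := j
    by_cases hr : r = r0
    · subst hr
      simp only [potential, gadVal, Prod.mk.injEq]
      cases b <;> cases p <;> cases p0 <;> simp
    · simp [potential, hr]
  · rw [expect_inr σ (u := .T j' b') rfl]; simp [potential]
  · rw [expect_inr σ (u := .Z) rfl]; simp [potential]

end Completeness

section Completeness

variable {Q R : Type} [DecidableEq R] [Fintype R] [Fintype Q] [Nonempty R] {N k : ℕ}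
  (M : CMachine Q R) (en : Fin N ≃ Option (R × Bool)) (pl : Option (R × Bool × Bool) ≃ Fin k) (n : ℕ)

local notation "𝓖" => gameArena M en pl n

open scoped Classical in
/-- The simulating move, completed at irrelevant vertices. -/
noncomputable def followMove (m : ℕ × ℕ) (u : GV Q R N) : GV Q R N :=
  if follow M en n m u ∈ (gameArena M en pl n).next u then follow M en n m u
  else ((gameArena_wf M en pl n).1 u).choose

/-- The profile in which all players follow the simulation. -/
noncomputable def followProfile : Profile k (GV Q R N) := fun _ h u =>
  PMF.pure (followMove M en pl n (mem h) u)

theorem followMove_mem (m : ℕ × ℕ) (u : GV Q R N) :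
    followMove M en pl n m u ∈ (gameArena M en pl n).next u := by
  unfold followMove
  split_ifs with h
  · exact h
  · exact ((gameArena_wf M en pl n).1 u).choose_spec

theorem followProfile_valid : Profile.Valid (gameArena M en pl n) (followProfile M en pl n) := by
  classical
  intro i h u v hv
  rw [followProfile, PMF.pure_apply] at hv
  have : v = followMove M en pl n (mem h) u := by
    by_contra hc
    simp [hc] at hv
  rw [this]
  exact followMove_mem M en pl n _ _

theorem followProfile_pure (i : Fin (k + 1)) : Strategy.Pure (followProfile M en pl n i) := by
  classical
  intro h u
  exact ⟨followMove M en pl n (mem h) u, by simp [followProfile]⟩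

variable {M en pl n}

theorem follow_mem {m : ℕ × ℕ} {u : GV Q R N} {x} (hu : node M en n u = .inl x) :
    follow M en n m u = x.2.1 ∨ follow M en n m u = x.2.2 := by
  classical
  rcases u with ⟨q, p⟩ | ⟨δ, p, i⟩ | (_ | ⟨r, p, b'⟩) | ⟨δ, p, r⟩ | ⟨δ, p, r⟩ | ⟨δ, p, r⟩ | ⟨p, r⟩ | ⟨j', b'⟩ | _
  · rcases hq : M.bad q with _ | _
    · rw [node_M hq] at hu
      cases hu
      simp only [follow]
      rcases M.branch _ with _ | _ <;> simp
    · rw [node_M_bad hq] at hu; cases hu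
  · by_cases hi : i.val < N
    · rw [node_X hi] at hu
      cases hu
      simp only [follow, dif_pos hi]
      split_ifs with h
      · simp [h.1, exitPlayer]
      · simp
    · rw [node_X_last hi] at hu; cases hu
  · cases hu
  · cases hu
  · rcases hf : M.forced n δ r with _ | v
    · rw [node_Ev_none hf] at hu
      cases hu
      simp only [follow]
      split_ifs <;> simp
    · rw [node_Ev_some hf] at hu; cases hu
  all_goals cases hu

theorem followMove_eq {m : ℕ × ℕ} {u : GV Q R N} {x} (hu : node M en n u = .inl x) :
    followMove M en pl n m u = follow M en n m u := by
  classical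
  rw [followMove, if_pos]
  rw [gameArena_next_inl M en pl n hu]
  exact follow_mem hu

/-- A profile which follows the simulation at the vertices of player `i`. -/
theorem rstep_follow {σ : Profile k (GV Q R N)} {u : GV Q R N} {x}
    (hu : node M en n u = .inl x) (hσ : σ (pl x.1).succ = followProfile M en pl n (pl x.1).succ)
    (h : List (GV Q R N)) (v : GV Q R N) :
    rstep 𝓖 σ h u v = open scoped Classical in if v = follow M en n (mem h) u then 1 else 0 := by
  classical
  rw [rstep, Arena.stepProb, gameArena_owner_inl M en pl n hu]
  simp only [hσ, followProfile, followMove_eq hu, PMF.pure_apply]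
  split_ifs <;> simp

theorem expect_follow {σ : Profile k (GV Q R N)} {u : GV Q R N} {x}
    (hu : node M en n u = .inl x) (hσ : σ (pl x.1).succ = followProfile M en pl n (pl x.1).succ)
    (h : List (GV Q R N)) (f : GV Q R N → ℝ) :
    expect 𝓖 σ h u f = f (follow M en n (mem h) u) := by
  classical
  simp only [expect, rstep_follow hu hσ]
  simp

/-- Positions reached when everybody follows the simulation. -/
def OnPath (m : ℕ × ℕ) : GV Q R N → Prop
  | .Ex _ => False
  | .Z => False
  | u => OnTrack M n m u

theorem OnPath.onTrack {m : ℕ × ℕ} {u : GV Q R N} (h : OnPath (M := M) (n := n) m u) :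
    OnTrack M n m u := by
  cases u <;> first | exact h | exact h.elim

/-- Steps of nature and simulating steps preserve the simulation. -/
theorem onPath_step {σ : Profile k (GV Q R N)} (hbad : ∀ t, M.bad (M.cfg n t).1 = false)
    {h : List (GV Q R N)} {u v : GV Q R N} (hu : OnPath (M := M) (n := n) (mem h) u)
    (hr : u.rank ≠ 0) (hv : rstep 𝓖 σ h u v ≠ 0)
    (hfol : ∀ x, node M en n u = .inl x → σ (pl x.1).succ = followProfile M en pl n (pl x.1).succ) :
    OnPath (M := M) (n := n) (mem (h ++ [u])) v := by
  classical
  rw [mem_append]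
  have hf : ∀ x, node M en n u = .inl x → v = follow M en n (mem h) u := by
    intro x hx
    by_contra hne
    rw [rstep_follow hx (hfol x hx), if_neg hne] at hv
    exact hv rfl
  set m := mem h with hm
  rcases u with ⟨q, p⟩ | ⟨δ, p, i⟩ | o | ⟨δ, p, r⟩ | ⟨δ, p, r⟩ | ⟨δ, p, r⟩ | ⟨p, r⟩ | ⟨j', b'⟩ | _
  · obtain rfl : q = _ := hu
    rw [hf _ (node_M (hbad _))]
    rfl
  · obtain rfl : δ = _ := hu
    by_cases hi : i.val < N
    · rw [hf _ (node_X hi)]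
      simp [follow, hi, OnPath, OnTrack, memUpd]
    · obtain ⟨x, hx, rfl⟩ := rstep_inr_ne (node_X_last hi) hv
      simp only [List.mem_cons, List.mem_map] at hx
      rcases hx with rfl | ⟨r, -, rfl⟩
      · exact M.tgt_del n _
      · rfl
  · exact hu.elim
  · obtain rfl : δ = _ := hu
    rcases hfo : M.forced n (M.del n m.1) r with _ | w
    · rw [hf _ (node_Ev_none hfo)]
      simp only [follow]
      split_ifs
      · exact ⟨rfl, hfo⟩
      · rfl
    · obtain ⟨x, hx, rfl⟩ := rstep_inr_ne (node_Ev_some hfo) hv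
      simp only [List.mem_cons, List.not_mem_nil, or_false] at hx
      rcases hx with rfl | rfl
      · rfl
      · trivial
  · obtain ⟨x, hx, rfl⟩ := rstep_inr_ne (u := .Half δ p r) rfl hv
    simp only [List.mem_cons, List.not_mem_nil, or_false] at hx
    rcases hx with rfl | rfl
    · trivial
    · exact hu.1
  · obtain ⟨x, hx, rfl⟩ := rstep_inr_ne (u := .Hi δ p r) rfl hv
    simp only [List.mem_cons, List.not_mem_nil, or_false] at hx
    rcases hx with rfl | rfl | rfl | rfl <;> trivial
  · obtain ⟨x, hx, rfl⟩ := rstep_inr_ne (u := .Lo p r) rfl hv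
    simp only [List.mem_cons, List.not_mem_nil, or_false] at hx
    rcases hx with rfl | rfl <;> trivial
  · simp [GV.rank] at hr
  · exact hu.elim

theorem rval_zero_followProfile (hbad : ∀ t, M.bad (M.cfg n t).1 = false) :
    rval 𝓖 (followProfile M en pl n) {v | gameTarget Q N pl 0 v = true} [] (𝓖).init = 0 := by
  classical
  have hσ := followProfile_valid M en pl n
  refine le_antisymm ?_ (rval_nonneg _ _ _ _ _)
  rw [gameTarget_zero]
  refine harmonic_le hσ (fun h u => OnPath (M := M) (n := n) (mem h) u) ?_
    (rval 𝓖 (followProfile M en pl n) {.Z}) (fun _ _ => 0) 1 ?_ ?_ ?_ ?_ ?_ ?_ [] (𝓖).init ?_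
  · intro h u v hu hr hv
    exact onPath_step hbad hu hr hv fun _ _ => rfl
  · intro h u; exact rval_le_one (gameArena_wf M en pl n) _ _ _ _
  · intro _ _; norm_num
  · intro h j b _
    rw [rval_terminal (gameArena_wf M en pl n) hσ _ (terminal_T j b)]
    simp
  · intro h hh; exact hh.elim
  · intro h u _ _
    exact (rval_step (gameArena_wf M en pl n) hσ (by rintro v rfl; exact terminal_Z) h u).le
  · intro h u _ _; simp [expect]
  · rfl

theorem potential_bound (j : R × Bool) (b : Bool) :
    ∃ B : ℝ, 0 ≤ B ∧ ∀ m u, |potential (N := N) M n j b m u| ≤ B := by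
  classical
  have hpow : ∀ c : ℕ, |(1 / 2 : ℝ) ^ c| ≤ 1 := fun c => by
    rw [abs_of_nonneg (by positivity)]
    exact pow_le_one₀ (by norm_num) (by norm_num)
  have hcard : (1 : ℝ) ≤ Fintype.card R := by exact_mod_cast Nat.succ_le_of_lt Fintype.card_pos
  have hd : ∀ c : ℝ, 1 ≤ c → |1 / (c * Fintype.card R : ℝ)| ≤ 1 := fun c hc => by
    rw [abs_of_nonneg (by positivity), div_le_one (by positivity)]
    nlinarith
  have hex : |((exitPay (Fintype.card R) b : ℚ) : ℝ)| ≤ 1 := by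
    have h1 := exitPay_pos (R := R) b
    have h2 := exitPay_lt_one (R := R) b
    rw [abs_of_nonneg (by exact_mod_cast h1.le)]
    exact_mod_cast h2.le
  have hfar : ∀ c : ℕ, |farVal (Fintype.card R) b ((1 / 2) ^ c)| ≤ 2 := fun c => by
    have h8 : |(1 / 2 : ℝ) ^ c / (8 * Fintype.card R)| ≤ 1 := by
      rw [div_eq_mul_one_div, abs_mul]
      exact mul_le_one₀ (hpow c) (abs_nonneg _) (hd 8 (by norm_num))
    have h3 := hd 3 (by norm_num)
    have h6 := hd 6 (by norm_num)
    rw [abs_le] at *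
    simp only [farVal]
    split_ifs <;> constructor <;> linarith [h8.1, h8.2, h3.1, h3.2, h6.1, h6.2]
  have hph : ∀ (c : R → ℕ) p, |phaseVal (Fintype.card R) j b c p| ≤ 2 := fun c p => by
    simp only [phaseVal]
    split_ifs
    · linarith
    · exact hfar _
  have hgad : ∀ (m v : ℝ) (p : Bool), 0 ≤ m → m ≤ 2 → 0 ≤ v → v ≤ 1 → |gadVal m v p j.2 b| ≤ 2 := by
    intro m v p h1 h2 h3 h4
    have h5 : m * v ≤ 2 := by nlinarith
    have h6 : 0 ≤ m * v := mul_nonneg h1 h3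
    rw [abs_le]
    simp only [gadVal]
    split_ifs <;> constructor <;> linarith
  have hm1 : ∀ δ r, (0 : ℝ) ≤ M.mult δ r := fun δ r => by exact_mod_cast (M.mult_pos δ r).le
  have hm2 : ∀ δ r, (M.mult δ r : ℝ) ≤ 2 := fun δ r => by exact_mod_cast M.mult_le δ r
  have hg0 : ∀ m r, 0 ≤ gadArg M n m r := fun m r => by unfold gadArg; positivity
  have hg1 : ∀ m r, gadArg M n m r ≤ 1 := fun m r =>
    pow_le_one₀ (by norm_num) (by norm_num)
  refine ⟨2, by norm_num, fun m u => ?_⟩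
  rcases u with ⟨q, p⟩ | ⟨δ, p, i⟩ | o | ⟨δ, p, r⟩ | ⟨δ, p, r⟩ | ⟨δ, p, r⟩ | ⟨p, r⟩ | ⟨j', b'⟩ | _ <;>
    simp only [potential]
  · exact hph _ _
  · split_ifs
    · exact hph _ _
    · linarith
    · simp
  · split_ifs
    · linarith
    · simp
  · split_ifs
    · rcases hf : M.forced n δ r with _ | v
      · exact hgad _ _ _ (hm1 _ _) (hm2 _ _) (hg0 _ _) (hg1 _ _)
      · have := M.forced_mem hf
        exact hgad _ _ _ (hm1 _ _) (hm2 _ _) (Rat.cast_nonneg.2 this.1)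
          ((Rat.cast_le.2 this.2).trans_eq Rat.cast_one)
    · simp
  · split_ifs
    · rw [gadVal_half]
      refine hgad _ _ _ (hm1 _ _) (hm2 _ _) (by linarith [hg0 (m.1, m.2 + 1) r])
        (by linarith [hg1 (m.1, m.2 + 1) r])
    · simp
  · split_ifs
    · exact hgad _ _ _ (hm1 _ _) (hm2 _ _) (by norm_num) (by norm_num)
    · simp
  · split_ifs
    · exact hgad _ _ _ (by norm_num) (by norm_num) (by norm_num) (by norm_num)
    · simp
  · split_ifs <;> simp
  · simp

theorem potential_le_followProfile (hbad : ∀ t, M.bad (M.cfg n t).1 = false) (j : R × Bool) (b : Bool) :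
    potential M n j b (0, 0) (𝓖).init ≤ tval 𝓖 (followProfile M en pl n) j b [] (𝓖).init := by
  classical
  have hσ := followProfile_valid M en pl n
  obtain ⟨B, hB, hpB⟩ := potential_bound (M := M) (n := n) (N := N) j b
  refine harmonic_le hσ (fun h u => OnPath (M := M) (n := n) (mem h) u) ?_
    (fun h => potential M n j b (mem h)) (tval 𝓖 (followProfile M en pl n) j b) B ?_ ?_ ?_ ?_ ?_ ?_ [] (𝓖).init ?_
  · intro h u v hu hr hv
    exact onPath_step hbad hu hr hv fun _ _ => rfl
  · intro h u; exact (abs_le.1 (hpB _ _)).2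
  · intro h u
    exact (neg_nonpos.2 hB).trans (tval_nonneg j b h u)
  · intro h j' b' _
    rw [tval_T hσ]; simp [potential]
  · intro h hh; exact hh.elim
  · intro h u hu _
    exact (potential_harmonic j b hbad hu.onTrack fun x hx f => expect_follow hx rfl h f).ge
  · intro h u _ _
    exact (tval_step hσ j b h u).ge
  · rfl

/-- Positions reached when one player deviates. -/
def NearTrack (en : Fin N ≃ Option (R × Bool)) (m : ℕ × ℕ) : GV Q R N → Prop
  | .X δ _ i => δ = M.del n m.1 ∨ i.val ≤ (en.symm none).val
  | u => OnTrack M n m u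

theorem nearTrack_cases {m : ℕ × ℕ} {u : GV Q R N} (h : NearTrack (M := M) (n := n) en m u) :
    OnTrack M n m u ∨ ∃ δ p i, u = .X δ p i ∧ δ ≠ M.del n m.1 ∧ i.val ≤ (en.symm none).val := by
  rcases u with ⟨q, p⟩ | ⟨δ, p, i⟩ | o | ⟨δ, p, r⟩ | ⟨δ, p, r⟩ | ⟨δ, p, r⟩ | ⟨p, r⟩ | ⟨j', b'⟩ | _
  · exact .inl h
  · by_cases e : δ = M.del n m.1
    · exact .inl e
    · exact .inr ⟨_, _, _, rfl, e, h.resolve_left e⟩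
  all_goals exact .inl h

theorem OnPath.nearTrack {m : ℕ × ℕ} {u : GV Q R N} (h : OnPath (M := M) (n := n) m u) :
    NearTrack (M := M) (n := n) en m u := by
  rcases u with ⟨q, p⟩ | ⟨δ, p, i⟩ | o | ⟨δ, p, r⟩ | ⟨δ, p, r⟩ | ⟨δ, p, r⟩ | ⟨p, r⟩ | ⟨j', b'⟩ | _
  case X => exact .inl h
  all_goals exact h.onTrack

theorem nearTrack_step {σ : Profile k (GV Q R N)} (hσ : Profile.Valid 𝓖 σ)
    (hbad : ∀ t, M.bad (M.cfg n t).1 = false)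
    {h : List (GV Q R N)} {u v : GV Q R N} (hu : NearTrack (M := M) (n := n) en (mem h) u)
    (hr : u.rank ≠ 0) (hv : rstep 𝓖 σ h u v ≠ 0)
    (hfol : σ (pl none).succ = followProfile M en pl n (pl none).succ) :
    NearTrack (M := M) (n := n) en (mem (h ++ [u])) v := by
  classical
  by_cases hown : (∃ x, node M en n u = .inl x ∧ x.1 ≠ none) ∨ (∃ o, u = .Ex o)
  · rw [mem_append]
    set m := mem h with hm
    rcases hown with ⟨x, hx, hne⟩ | ⟨o, rfl⟩
    · have hv' := rstep_inl_ne hσ hx hv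
      rcases u with ⟨q, p⟩ | ⟨δ, p, i⟩ | (_ | ⟨r, p, b'⟩) | ⟨δ, p, r⟩ | ⟨δ, p, r⟩ | ⟨δ, p, r⟩ | ⟨p, r⟩ | ⟨j', b'⟩ | _
      · obtain rfl : q = _ := hu
        rw [node_M (hbad _)] at hx
        cases hx
        rcases hv' with rfl | rfl <;> exact .inr (Nat.zero_le _)
      · by_cases hi : i.val < N
        · rw [node_X hi] at hx
          cases hx
          rcases hv' with rfl | rfl
          · rcases hu with hu | hu
            · exact .inl hu
            · refine .inr ?_
              have hlt : i.val ≠ (en.symm none).val := by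
                intro e
                apply hne
                have : (⟨i, hi⟩ : Fin N) = en.symm none := Fin.ext e
                simp [this, exitPlayer]
              simp only; omega
          · trivial
        · rw [node_X_last hi] at hx; cases hx
      · cases hx
      · cases hx
      · rcases hf : M.forced n δ r with _ | v
        · rw [node_Ev_none hf] at hx
          cases hx; exact absurd rfl hne
        · rw [node_Ev_some hf] at hx; cases hx
      all_goals cases hx
    · rcases o with _ | ⟨r, p, b⟩
      · obtain ⟨x, hx, rfl⟩ := rstep_inr_ne (u := .Ex none) rfl hv
        simp only [List.mem_cons, List.not_mem_nil, or_false] at hx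
        subst hx; trivial
      · obtain ⟨x, hx, rfl⟩ := rstep_inr_ne (u := .Ex (some (r, p, b))) rfl hv
        simp only [List.mem_cons, List.not_mem_nil, or_false] at hx
        rcases hx with rfl | rfl <;> trivial
  · push Not at hown
    have hfol' : ∀ x, node M en n u = .inl x →
        σ (pl x.1).succ = followProfile M en pl n (pl x.1).succ := by
      intro x hx
      rw [hown.1 x hx, hfol]
    rcases nearTrack_cases hu with ht | ⟨δ, p, i, rfl, hne, hle⟩
    · refine (onPath_step hbad ?_ hr hv hfol').nearTrack
      rcases u with ⟨q, p⟩ | ⟨δ, p, i⟩ | o | ⟨δ, p, r⟩ | ⟨δ, p, r⟩ | ⟨δ, p, r⟩ | ⟨p, r⟩ | ⟨j', b'⟩ | _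
      case Ex => exact absurd rfl (hown.2 o)
      case Z => simp [GV.rank] at hr
      all_goals exact ht
    · have hi : i.val < N := hle.trans_lt (en.symm none).2
      have hn := node_X (M := M) (n := n) (en := en) (δ := δ) (p := p) hi
      have hnone : en ⟨i, hi⟩ = none := by
        have := hown.1 _ hn
        rcases he : en ⟨i, hi⟩ with _ | ⟨r, b⟩
        · rfl
        · rw [he] at this; cases this
      rw [rstep_follow hn (hfol' _ hn)] at hv
      have : v = follow M en n (mem h) (.X δ p i) := by
        by_contra hc; rw [if_neg hc] at hv; exact hv rfl
      rw [this]
      simp only [follow, dif_pos hi, hnone, hne, ne_eq, not_false_eq_true, and_self, if_true]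
      trivial

theorem potential_super {r : R} {p0 b : Bool} {τ : Strategy (GV Q R N)}
    (hσ : Profile.Valid 𝓖 (Function.update (followProfile M en pl n) (pl (some (r, p0, b))).succ τ))
    (hbad : ∀ t, M.bad (M.cfg n t).1 = false) {h : List (GV Q R N)} {u : GV Q R N}
    (hu : NearTrack (M := M) (n := n) en (mem h) u) :
    expect 𝓖 (Function.update (followProfile M en pl n) (pl (some (r, p0, b))).succ τ) h u
      (potential M n (r, p0) b (mem (h ++ [u]))) ≤ potential M n (r, p0) b (mem h) u := by
  classical
  have hex : (0 : ℝ) ≤ (exitPay (Fintype.card R) b : ℚ) := by exact_mod_cast (exitPay_pos b).le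
  by_cases hown : ∃ x, node M en n u = .inl x ∧ x.1 = some (r, p0, b)
  · obtain ⟨x, hx, hx1⟩ := hown
    rcases u with ⟨q, p⟩ | ⟨δ, p, i⟩ | (_ | ⟨r, p, b'⟩) | ⟨δ, p, r'⟩ | ⟨δ, p, r⟩ | ⟨δ, p, r⟩ | ⟨p, r⟩ | ⟨j', b'⟩ | _
    · obtain rfl : q = _ := hu
      have hn := node_M (p := p) (en := en) (n := n) (hbad (mem h).1)
      rw [hn] at hx
      cases hx
      simp only [Option.some.injEq, Prod.mk.injEq] at hx1
      obtain ⟨rfl, rfl, rfl⟩ := hx1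
      have key : ∀ b', potential M n (M.test (M.cfg n (mem h).1).1, !p) true
          (mem (h ++ [.M (M.cfg n (mem h).1).1 p]))
          (.X (some ((M.cfg n (mem h).1).1, b')) p 0 : GV Q R N) ≤
          potential M n (M.test (M.cfg n (mem h).1).1, !p) true (mem h) (.M (M.cfg n (mem h).1).1 p : GV Q R N) := by
        intro b'
        rw [mem_append]
        simp only [potential, memUpd, Nat.add_sub_cancel]
        split_ifs with h1 h2
        · exact le_rfl
        · cases p <;> simp at h2
        · exact phaseVal_nonneg _ _ _ _ _
      exact expect_inl_le hσ hn (by simp) h (fun _ => key true) (fun _ => key false)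
    · by_cases hi : i.val < N
      · have hn := node_X (M := M) (n := n) (en := en) (δ := δ) (p := p) hi
        rw [hn] at hx
        cases hx
        rcases he : en ⟨i, hi⟩ with _ | ⟨r', b'⟩
        · rw [he] at hx1; cases hx1
        · rw [he] at hx1
          simp only [exitPlayer, Option.some.injEq, Prod.mk.injEq] at hx1
          obtain ⟨rfl, rfl, rfl⟩ := hx1
          rw [he] at hn
          refine expect_inl_le hσ hn (by simp) h (fun _ => ?_) (fun _ => ?_)
          · rw [mem_append]; exact le_rfl
          · rw [mem_append]
            simp [potential, exitPlayer, phaseVal]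
      · rw [node_X_last hi] at hx; cases hx
    · cases hx
    · cases hx
    · rcases hf : M.forced n δ r' with _ | v
      · rw [node_Ev_none hf] at hx
        cases hx; cases hx1
      · rw [node_Ev_some hf] at hx; cases hx
    all_goals cases hx
  · push Not at hown
    have hfol : ∀ x, node M en n u = .inl x →
        Function.update (followProfile M en pl n) (pl (some (r, p0, b))).succ τ (pl x.1).succ =
          followProfile M en pl n (pl x.1).succ := by
      intro x hx
      rw [Function.update_of_ne]
      intro e
      exact hown x hx (pl.injective (Fin.succ_injective _ e))
    rcases nearTrack_cases hu with ht | ⟨δ, p, i, rfl, hne, hle⟩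
    · exact (potential_harmonic _ b hbad ht fun x hx f => expect_follow hx (hfol x hx) h f).le
    · have hi : i.val < N := hle.trans_lt (en.symm none).2
      have hn := node_X (M := M) (n := n) (en := en) (δ := δ) (p := p) hi
      rw [expect_follow hn (hfol _ hn), mem_append]
      simp only [follow, dif_pos hi]
      split_ifs
      · simp only [potential, if_neg hne]
        rw [if_neg (by simp)]
        by_cases hp : p = p0
        · rw [if_pos hp]; exact hex
        · rw [if_neg hp]
      · simp [potential, memUpd, hne]

theorem followProfile_stable (hbad : ∀ t, M.bad (M.cfg n t).1 = false) :
    Stable 𝓖 (fun i => {v | gameTarget Q N pl i v = true}) (followProfile M en pl n) := by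
  classical
  intro i hi τ hτ
  have hσ := followProfile_valid M en pl n
  obtain ⟨i, rfl⟩ := Fin.exists_succ_eq.2 hi
  obtain ⟨o, rfl⟩ := pl.surjective i
  rcases o with _ | ⟨r, p, b⟩
  · simp only [gameTarget_none]
    have hσ' := update_valid (i := (pl none).succ) hσ hτ
    refine le_trans (le_of_eq ?_) (rval_nonneg _ _ _ _ _)
    refine le_antisymm ?_ (rval_nonneg _ _ _ _ _)
    refine harmonic_le hσ' (fun h u => True) (fun _ _ _ _ _ _ => trivial)
      (rval 𝓖 _ ∅) (fun _ _ => 0) 1 ?_ ?_ ?_ ?_ ?_ ?_ [] (𝓖).init trivial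
    · intro h u; exact rval_le_one (gameArena_wf M en pl n) _ _ _ _
    · intro _ _; norm_num
    · intro h j b _
      rw [rval_terminal (gameArena_wf M en pl n) hσ' _ (terminal_T j b)]; simp
    · intro h _
      rw [rval_terminal (gameArena_wf M en pl n) hσ' _ terminal_Z]; simp
    · intro h u _ _
      exact (rval_step (gameArena_wf M en pl n) hσ' (by simp) h u).le
    · intro h u _ _; simp [expect]
  · simp only [gameTarget_some]
    have hσ' := update_valid (i := (pl (some (r, p, b))).succ) hσ hτ
    refine le_trans ?_ (potential_le_followProfile hbad (r, p) b)
    obtain ⟨B, hB, hpB⟩ := potential_bound (M := M) (n := n) (N := N) (r, p) b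
    refine harmonic_le hσ' (fun h u => NearTrack (M := M) (n := n) en (mem h) u) ?_
      (tval 𝓖 _ (r, p) b) (fun h => potential M n (r, p) b (mem h)) (max B 1) ?_ ?_ ?_ ?_ ?_ ?_ [] (𝓖).init ?_
    · intro h u v hu hr hv
      refine nearTrack_step hσ' hbad hu hr hv (Function.update_of_ne ?_ _ _)
      intro e
      cases pl.injective (Fin.succ_injective _ e)
    · intro h u; exact (tval_le_one _ _ _ _).trans (le_max_right _ _)
    · intro h u
      have := (abs_le.1 (hpB (mem h) u)).1
      linarith [le_max_left B 1]
    · intro h j' b' _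
      rw [tval_T hσ']; simp [potential]
    · intro h _
      rw [tval_Z hσ']; simp [potential]
    · intro h u _ _
      exact (tval_step hσ' _ _ h u).le
    · intro h u hu _
      exact potential_super hσ' hbad hu
    · exact .inl rfl

theorem followProfile_finiteState {T : ℕ} (hT : ∀ t, T ≤ t → M.cfg n t = M.cfg n T) (i : Fin (k + 1)) :
    Strategy.FiniteState (followProfile M en pl n i) := by
  classical
  obtain ⟨J, hJ⟩ : ∃ J, ∀ t r, (M.cfg n t).2 r ≤ J := by
    refine ⟨∑ t ∈ Finset.range (T + 1), ∑ r, (M.cfg n t).2 r, fun t r => ?_⟩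
    have e : M.cfg n t = M.cfg n (min t T) := by
      rcases le_total t T with h | h
      · rw [min_eq_left h]
      · rw [min_eq_right h, hT t h]
    rw [e]
    refine le_trans ?_ (Finset.single_le_sum (f := fun t => ∑ r, (M.cfg n t).2 r)
      (fun _ _ => Nat.zero_le _) (Finset.mem_range.2 (Nat.lt_succ_of_le (min_le_right t T))))
    exact Finset.single_le_sum (f := fun r => (M.cfg n (min t T)).2 r)
      (fun _ _ => Nat.zero_le _) (Finset.mem_univ r)
  let sat : ℕ × ℕ → Fin (T + 2) × Fin (J + 1) := fun m =>
    (⟨min m.1 (T + 1), by omega⟩, ⟨min m.2 J, by omega⟩)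
  let val : Fin (T + 2) × Fin (J + 1) → ℕ × ℕ := fun m => (m.1.val, m.2.val)
  have hcfg : ∀ t, M.cfg n (min t (T + 1)) = M.cfg n t := by
    intro t
    rcases le_total t (T + 1) with h | h
    · rw [min_eq_left h]
    · rw [min_eq_right h, hT t (by omega), hT (T + 1) (by omega)]
  have hcfg1 : ∀ t, M.cfg n (min t (T + 1) - 1) = M.cfg n (t - 1) := by
    intro t
    rcases le_total t (T + 1) with h | h
    · rw [min_eq_left h]
    · rw [min_eq_right h, hT (t - 1) (by omega), hT (T + 1 - 1) (by omega)]
  have hdel : ∀ t, M.del n (min t (T + 1)) = M.del n t := by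
    intro t
    rcases t with _ | t
    · simp
    · have e : min (t + 1) (T + 1) = min t T + 1 := by omega
      have e2 : M.cfg n (min t T) = M.cfg n t := by
        rcases le_total t T with h | h
        · rw [min_eq_left h]
        · rw [min_eq_right h, hT t h]
      rw [e]
      simp only [CMachine.del, e2]
  have hfollow : ∀ m u, follow M en n (val (sat m)) u = follow M en n m u := by
    intro m u
    rcases u with ⟨q, p⟩ | ⟨δ, p, i⟩ | o | ⟨δ, p, r⟩ | ⟨δ, p, r⟩ | ⟨δ, p, r⟩ | ⟨p, r⟩ | ⟨j', b'⟩ | _ <;>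
      simp only [follow, val, sat, hcfg, hcfg1, hdel]
    have : (min m.2 J < (M.cfg n (m.1 - 1)).2 r) ↔ (m.2 < (M.cfg n (m.1 - 1)).2 r) := by
      have := hJ (m.1 - 1) r
      omega
    simp only [this]
  have hsat : ∀ m (u : GV Q R N), sat (memUpd (val (sat m)) u) = sat (memUpd m u) := by
    intro m u
    cases u <;> simp [memUpd, sat, val]
    all_goals omega
  refine ⟨Fin (T + 2) × Fin (J + 1), inferInstance, sat (0, 0), fun m u => sat (memUpd (val m) u),
    fun m u => PMF.pure (followMove M en pl n (val m) u), fun h u => ?_⟩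
  have hfold : h.foldl (fun m u => sat (memUpd (val m) u)) (sat (0, 0)) = sat (mem h) := by
    induction h using List.reverseRecOn with
    | nil => rfl
    | append_singleton h u ih =>
      rw [List.foldl_append, ih, mem_append]
      exact hsat _ _
  rw [hfold]
  simp only [followProfile, followMove, hfollow]

/-- The equilibria with payoff `0` for the system exist if the simulation never meets a bad state. -/
theorem completeness (hbad : ∀ t, M.bad (M.cfg n t).1 = false) : ∃ σ : Profile k (GV Q R N),
    Profile.Valid 𝓖 σ ∧ (∀ i, Strategy.Pure (σ i)) ∧
    ((∃ T, ∀ t, T ≤ t → M.cfg n t = M.cfg n T) → ∀ i, Strategy.FiniteState (σ i)) ∧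
    Stable 𝓖 (fun i => {v | gameTarget Q N pl i v = true}) σ ∧
    rval 𝓖 σ {v | gameTarget Q N pl 0 v = true} [] (𝓖).init = 0 :=
  ⟨followProfile M en pl n, followProfile_valid M en pl n, followProfile_pure M en pl n,
    fun ⟨_, hT⟩ => followProfile_finiteState hT, followProfile_stable hbad, rval_zero_followProfile hbad⟩

end Completeness

/-- Loop programs with unbounded loops; `loop r p` decrements the register `r` and runs `p` as long
as `r` is nonzero. -/
inductive Prog : Type
  | skip : Prog
  | inc : ℕ → Prog
  | seq : Prog → Prog → Prog
  | loop : ℕ → Prog → Prog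

/-- One step of a program with a stack of continuations. -/
def kstep : List Prog × (ℕ → ℕ) → List Prog × (ℕ → ℕ)
  | ([], s) => ([], s)
  | (.skip :: K, s) => (K, s)
  | (.inc r :: K, s) => (K, Function.update s r (s r + 1))
  | (.seq a b :: K, s) => (a :: b :: K, s)
  | (.loop r p :: K, s) => if s r = 0 then (K, s)
      else (p :: .loop r p :: K, Function.update s r (s r - 1))

/-- Program `p` terminates in state `s'` when started in state `s`. -/
def Runs (p : Prog) (s s' : ℕ → ℕ) : Prop := ∀ K, ∃ m, kstep^[m] (p :: K, s) = (K, s')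

theorem Runs.skip (s : ℕ → ℕ) : Runs .skip s s := fun _ => ⟨1, rfl⟩

theorem Runs.inc (r : ℕ) (s : ℕ → ℕ) : Runs (.inc r) s (Function.update s r (s r + 1)) :=
  fun _ => ⟨1, rfl⟩

theorem Runs.seq {a b : Prog} {s s' s'' : ℕ → ℕ} (ha : Runs a s s') (hb : Runs b s' s'') :
    Runs (.seq a b) s s'' := by
  intro K
  obtain ⟨m, hm⟩ := ha (b :: K)
  obtain ⟨m', hm'⟩ := hb K
  refine ⟨m' + m + 1, ?_⟩
  rw [Function.iterate_succ_apply, Function.iterate_add_apply]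
  change kstep^[m'] (kstep^[m] (a :: b :: K, s)) = _
  rw [hm, hm']

theorem Runs.loop {r : ℕ} {p : Prog} (S : ℕ → ℕ → ℕ) (h0 : S 0 r = 0) (m : ℕ)
    (hS : ∀ i < m, S (i + 1) r ≠ 0 ∧
      Runs p (Function.update (S (i + 1)) r (S (i + 1) r - 1)) (S i)) :
    Runs (.loop r p) (S m) (S 0) := by
  intro K
  induction m with
  | zero => exact ⟨1, by simp [kstep, h0]⟩
  | succ m ih =>
    obtain ⟨a, ha⟩ := ih fun i hi => hS i (by omega)
    obtain ⟨h1, h2⟩ := hS m (by omega)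
    obtain ⟨b, hb⟩ := h2 (.loop r p :: K)
    refine ⟨a + b + 1, ?_⟩
    rw [Function.iterate_succ_apply, Function.iterate_add_apply]
    simp only [kstep, if_neg h1]
    rw [hb, ha]

theorem Runs.congr {p : Prog} {s s' t t' : ℕ → ℕ} (h : Runs p s s') (hs : s = t) (hs' : s' = t') :
    Runs p t t' := hs ▸ hs' ▸ h

open Function in
/-- Moving the content of a register. -/
theorem runs_move {a o : ℕ} (hao : a ≠ o) (s : ℕ → ℕ) :
    Runs (.loop a (.inc o)) s (update (update s o (s o + s a)) a 0) := by
  refine (Runs.loop (fun i => update (update s o (s o + (s a - i))) a i) (by simp) (s a) ?_).congr ?_ ?_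
  · intro i hi
    refine ⟨by simp, (Runs.inc o _).congr rfl ?_⟩
    funext r
    by_cases h1 : r = a
    · subst h1; simp [hao]
    · by_cases h2 : r = o
      · subst h2; simp [h1]; omega
      · simp [h1, h2]
  · funext r
    by_cases h1 : r = a
    · subst h1; simp
    · by_cases h2 : r = o
      · subst h2; simp [h1]
      · simp [h1, h2]
  · simp

open Function in
theorem runs_clear (a : ℕ) (s : ℕ → ℕ) : Runs (.loop a .skip) s (update s a 0) := by
  refine (Runs.loop (fun i => update s a i) (by simp) (s a) ?_).congr (by simp) rfl
  intro i hi
  refine ⟨by simp, (Runs.skip _).congr ?_ rfl⟩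
  simp

/-- Copying a register with the help of a scratch register. -/
def copyProg (a o t : ℕ) : Prog := .seq (.loop a (.seq (.inc o) (.inc t))) (.loop t (.inc a))

open Function in
theorem runs_copy {a o t : ℕ} (hao : a ≠ o) (hat : a ≠ t) (hot : o ≠ t) {s : ℕ → ℕ} (ho : s o = 0)
    (ht : s t = 0) : Runs (copyProg a o t) s (update s o (s a)) := by
  have hr : Runs (.loop a (.seq (.inc o) (.inc t))) s (update (update (update s o (s a)) t (s a)) a 0) := by
    refine (Runs.loop (fun i => update (update (update s o (s a - i)) t (s a - i)) a i) (by simp) (s a) ?_).congr ?_ ?_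
    · intro i hi
      refine ⟨by simp, ((Runs.inc o _).seq (Runs.inc t _)).congr rfl ?_⟩
      funext r
      by_cases h1 : r = a
      · subst h1; simp [hao, hat]
      · by_cases h2 : r = o
        · subst h2; simp [h1, hot]; omega
        · by_cases h3 : r = t
          · subst h3; simp [h1, h2]; omega
          · simp [h1, h2, h3]
    · funext r
      by_cases h1 : r = a
      · subst h1; simp
      · by_cases h2 : r = o
        · subst h2; simp [h1, hot, ho]
        · by_cases h3 : r = t
          · subst h3; simp [h1, ht]
          · simp [h1, h2, h3]
    · simp
  refine (hr.seq (runs_move hat.symm _)).congr rfl ?_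
  funext r
  by_cases h1 : r = a
  · subst h1; simp [hao, hat, hat.symm]
  · by_cases h2 : r = o
    · subst h2; rw [update_of_ne hot, update_of_ne h1]; simp [h1, hot]
    · by_cases h3 : r = t
      · subst h3; simp [ht, h2]
      · simp [h1, h2, h3]

/-- The function `f` is computed by programs which leave all other registers unchanged. -/
def Computes {n : ℕ} (f : List.Vector ℕ n → ℕ) : Prop :=
  ∀ (ins : Fin n → ℕ) (o t : ℕ), (∀ i, ins i < t) → o < t → (∀ i, ins i ≠ o) →
    ∃ p : Prog, ∀ s : ℕ → ℕ, s o = 0 → (∀ r, t ≤ r → s r = 0) →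
      Runs p s (Function.update s o (f (List.Vector.ofFn fun i => s (ins i))))

theorem computes_zero : Computes (n := 0) fun _ => 0 := by
  intro ins o t _ _ _
  exact ⟨.skip, fun s ho _ => (Runs.skip s).congr rfl (by simp [← ho])⟩

theorem computes_get {n : ℕ} (i : Fin n) : Computes fun v => v.get i := by
  intro ins o t hi ho hio
  exact ⟨copyProg (ins i) o t, fun s hs ht => (runs_copy (hio i) (hi i).ne ho.ne hs (ht t le_rfl)).congr rfl
    (by simp)⟩

theorem computes_succ : Computes (n := 1) fun v => v.head.succ := by
  intro ins o t hi ho hio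
  obtain ⟨p, hp⟩ := computes_get (0 : Fin 1) ins o t hi ho hio
  refine ⟨.seq p (.inc o), fun s hs ht => ((hp s hs ht).seq (Runs.inc o _)).congr rfl ?_⟩
  simp [List.Vector.head_ofFn]

/-- Sequential composition of the first `m` programs. -/
def seqs (p : ℕ → Prog) : ℕ → Prog
  | 0 => .skip
  | m + 1 => .seq (seqs p m) (p m)

theorem Runs.seqs {p : ℕ → Prog} (S : ℕ → ℕ → ℕ) (m : ℕ) (h : ∀ i < m, Runs (p i) (S i) (S (i + 1))) :
    Runs (seqs p m) (S 0) (S m) := by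
  induction m with
  | zero => exact Runs.skip _
  | succ m ih => exact (ih fun i hi => h i (by omega)).seq (h m (by omega))

theorem computes_comp {m n : ℕ} {f : List.Vector ℕ n → ℕ} {g : Fin n → List.Vector ℕ m → ℕ}
    (hf : Computes f) (hg : ∀ i, Computes (g i)) :
    Computes fun v => f (List.Vector.ofFn fun i => g i v) := by
  classical
  intro ins o t hi ho hio
  choose pg hpg using fun i : Fin n => hg i ins (t + i) (t + n) (fun j => (hi j).trans_le (by omega))
    (by omega) (fun j => by have := hi j; omega)
  obtain ⟨pf, hpf⟩ := hf (fun i => t + i) o (t + n) (fun i => by omega) (by omega) (fun i => by omega)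
  refine ⟨.seq (seqs (fun i => if h : i < n then pg ⟨i, h⟩ else .skip) n)
    (.seq pf (seqs (fun i => .loop (t + i) .skip) n)), fun s hs ht => ?_⟩
  set v := List.Vector.ofFn fun i => s (ins i) with hv
  set G : ℕ → ℕ := fun i => if h : i < n then g ⟨i, h⟩ v else 0 with hG
  have h1 := Runs.seqs (p := fun i => if h : i < n then pg ⟨i, h⟩ else .skip)
    (fun m r => if t ≤ r ∧ r < t + m then G (r - t) else s r) n (by
      intro i hin
      simp only [dif_pos hin]
      refine (hpg ⟨i, hin⟩ _ ?_ ?_).congr rfl ?_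
      · simp only; rw [if_neg (by omega)]; exact ht _ (by omega)
      · intro r hr; rw [if_neg (by omega)]; exact ht _ (by omega)
      · have e : (List.Vector.ofFn fun j => if t ≤ ins j ∧ ins j < t + i then G (ins j - t) else s (ins j)) = v := by
          rw [hv]; congr 1; funext j
          have := hi j
          rw [if_neg (by omega)]
        rw [e]
        funext r
        by_cases hr : r = t + i
        · subst hr
          simp [hG, hin]
        · simp only [Function.update_of_ne hr]
          by_cases hr2 : t ≤ r ∧ r < t + i
          · rw [if_pos hr2, if_pos (by omega)]
          · rw [if_neg hr2, if_neg (by omega)])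
  have h2 := hpf (fun r => if t ≤ r ∧ r < t + n then G (r - t) else s r)
    (by rw [if_neg (by omega)]; exact hs)
    (by intro r hr; rw [if_neg (by omega)]; exact ht _ (by omega))
  set y := f (List.Vector.ofFn fun i => g i v) with hy
  have e : f (List.Vector.ofFn fun i : Fin n => if t ≤ t + i.val ∧ t + i.val < t + n then G (t + i - t)
      else s (t + i)) = y := by
    rw [hy]; congr 2; funext i
    rw [if_pos (by omega)]
    simp [hG]
  rw [e] at h2
  have h3 := Runs.seqs (p := fun i => .loop (t + i) .skip)
    (fun m r => if r = o then y else if t + m ≤ r ∧ r < t + n then G (r - t) else s r) n (by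
      intro i hin
      refine (runs_clear _ _).congr rfl ?_
      funext r
      by_cases hr : r = t + i
      · subst hr
        simp only [Function.update_self]
        rw [if_neg (by omega), if_neg (by omega)]
        exact (ht _ (by omega)).symm
      · simp only [Function.update_of_ne hr]
        by_cases hr2 : r = o
        · rw [if_pos hr2, if_pos hr2]
        · rw [if_neg hr2, if_neg hr2]
          by_cases hr3 : t + i ≤ r ∧ r < t + n
          · rw [if_pos hr3, if_pos (by omega)]
          · rw [if_neg hr3, if_neg (by omega)])
  refine (Runs.seq h1 (Runs.seq h2 (h3.congr ?_ rfl))).congr ?_ ?_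
  · funext r
    by_cases hr : r = o
    · subst hr; simp
    · simp [hr]
  · funext r
    rw [if_neg (by omega)]
  · funext r
    by_cases hr : r = o
    · subst hr; simp [← hy]
    · simp only [Function.update_of_ne hr, if_neg hr]
      rw [if_neg (by omega)]

open Function in
theorem computes_prec {n : ℕ} {f : List.Vector ℕ n → ℕ} {g : List.Vector ℕ (n + 2) → ℕ}
    (hf : Computes f) (hg : Computes g) :
    Computes fun v : List.Vector ℕ (n + 1) =>
      v.head.rec (f v.tail) fun y IH => g (y ::ᵥ IH ::ᵥ v.tail) := by
  classical
  intro ins o t hi ho hio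
  obtain ⟨pf, hpf⟩ := hf (fun i => ins i.succ) o (t + 4) (fun i => (hi _).trans_le (by omega)) (by omega)
    (fun i => hio _)
  obtain ⟨pg, hpg⟩ := hg (Fin.cons (t + 1) (Fin.cons o fun i => ins i.succ)) (t + 2) (t + 4)
    (fun i => by
      refine Fin.cases ?_ (fun i => Fin.cases ?_ (fun i => ?_) i) i
      · simp
      · simp; omega
      · have := hi i.succ
        simp; omega) (by omega)
    (fun i => by
      refine Fin.cases ?_ (fun i => Fin.cases ?_ (fun i => ?_) i) i
      · simp
      · simp; omega
      · have := hi i.succ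
        simp; omega)
  refine ⟨.seq (copyProg (ins 0) t (t + 3)) (.seq pf (.seq (.loop t (.seq pg (.seq (.loop o .skip)
    (.seq (.loop (t + 2) (.inc o)) (.inc (t + 1)))))) (.loop (t + 1) .skip))), fun s hs ht => ?_⟩
  set w := List.Vector.ofFn fun i => s (ins i.succ) with hw
  set x := s (ins 0) with hx
  have hhead : (List.Vector.ofFn fun i => s (ins i)).head = x := by simp [List.Vector.head_ofFn, hx]
  have htail : (List.Vector.ofFn fun i => s (ins i)).tail = w := by simp [List.Vector.tail_ofFn, hw]
  simp only [hhead, htail]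
  set F : ℕ → ℕ := fun i => Nat.rec (f w) (fun y IH => g (y ::ᵥ IH ::ᵥ w)) i with hF
  have hins : ∀ i, ins i ≠ t ∧ ins i ≠ t + 1 ∧ ins i ≠ t + 2 ∧ ins i ≠ o := fun i => by
    have := hi i
    exact ⟨by omega, by omega, by omega, hio i⟩
  have h1 := runs_copy (hins 0).1 (by have := hi 0; omega) (by omega) (ht t le_rfl) (ht (t + 3) (by omega))
  have h2 := hpf (update s t x) (by rw [update_of_ne (by omega)]; exact hs)
    (fun r hr => by rw [update_of_ne (by omega)]; exact ht r (by omega))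
  have e2 : (List.Vector.ofFn fun i => update s t x (ins i.succ)) = w := by
    rw [hw]; congr 1; funext i
    rw [update_of_ne (hins _).1]
  rw [e2] at h2
  have h3 := Runs.loop (r := t) (p := .seq pg (.seq (.loop o .skip)
    (.seq (.loop (t + 2) (.inc o)) (.inc (t + 1)))))
    (fun i => update (update (update s o (F (x - i))) (t + 1) (x - i)) t i) (by simp) x (by
      intro i hix
      refine ⟨by simp, ?_⟩
      have e3 : x - i = x - (i + 1) + 1 := by omega
      set y := x - (i + 1) with hy
      have hstart : update (update (update (update s o (F y)) (t + 1) y) t (i + 1)) t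
          ((update (update (update s o (F y)) (t + 1) y) t (i + 1) : ℕ → ℕ) t - 1) =
          update (update (update s o (F y)) (t + 1) y) t i := by simp
      rw [hstart]
      set s1 := update (update (update s o (F y)) (t + 1) y) t i with hs1
      have h4 := hpg s1
        (by rw [hs1, update_of_ne (by omega), update_of_ne (by omega), update_of_ne (by omega)]; exact ht _ (by omega))
        (fun r hr => by
          rw [hs1, update_of_ne (by omega), update_of_ne (by omega), update_of_ne (by omega)]
          exact ht _ (by omega))
      have e4 : (List.Vector.ofFn fun j => s1 ((Fin.cons (t + 1) (Fin.cons o fun i => ins i.succ) :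
          Fin (n + 2) → ℕ) j)) = y ::ᵥ F y ::ᵥ w := by
        rw [List.Vector.ofFn, List.Vector.ofFn]
        simp only [Fin.cons_zero, Fin.cons_succ]
        congr 1
        · simp [hs1]
        congr 1
        · rw [hs1, update_of_ne (by omega), update_of_ne (by omega)]; simp
        · rw [hw]; congr 1; funext i
          have := hins i.succ
          rw [hs1, update_of_ne this.1, update_of_ne this.2.1, update_of_ne this.2.2.2]
      rw [e4] at h4
      have e5 : g (y ::ᵥ F y ::ᵥ w) = F (x - i) := by rw [e3]
      rw [e5] at h4
      refine (h4.seq ((runs_clear o _).seq ((runs_move (by omega) _).seq (Runs.inc (t + 1) _)))).congr rfl ?_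
      have hot : o ≠ t := by omega
      have hot1 : o ≠ t + 1 := by omega
      have hot2 : o ≠ t + 2 := by omega
      funext r
      by_cases r1 : r = t + 1
      · subst r1
        simp [hot1.symm, hs1]; omega
      · by_cases r2 : r = t + 2
        · subst r2
          simp [hot2.symm]
          exact (ht _ (by omega)).symm
        · by_cases r3 : r = o
          · subst r3
            simp [hot, hot1, hot2, hot2.symm]
          · by_cases r4 : r = t
            · subst r4
              simp [hs1, r3]
            · simp [hs1, r1, r2, r3, r4])
  have h5 := runs_clear (t + 1) (update (update (update s o (F (x - 0))) (t + 1) (x - 0)) t 0)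
  refine (h1.seq (h2.seq ((h3.congr ?_ rfl).seq h5))).congr rfl ?_
  · funext r
    by_cases r1 : r = o
    · have : o ≠ t ∧ o ≠ t + 1 := by omega
      subst r1; simp [this, hF]
    · by_cases r4 : r = t
      · subst r4; simp [r1]
      · by_cases r2 : r = t + 1
        · subst r2; simp [r1]; exact (ht _ (by omega)).symm
        · simp [r1, r2, r4]
  · funext r
    by_cases r1 : r = o
    · have : o ≠ t ∧ o ≠ t + 1 := by omega
      subst r1; simp [this, hF]
    · by_cases r4 : r = t
      · subst r4; simp [r1]; exact (ht _ (by omega)).symm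
      · by_cases r2 : r = t + 1
        · subst r2; simp [r1]; exact (ht _ (by omega)).symm
        · simp [r1, r2, r4]

theorem computes_primrec {n : ℕ} {f : List.Vector ℕ n → ℕ} (hf : Nat.Primrec' f) : Computes f := by
  induction hf with
  | zero => exact computes_zero
  | succ => exact computes_succ
  | get i => exact computes_get i
  | comp g _ _ hf hg => exact computes_comp hf hg
  | prec _ _ hf hg => exact computes_prec hf hg

/-- The stacks which occur when running a program on top of the stack `K`. -/
def Prog.stacks : Prog → List Prog → Set (List Prog)
  | .skip, K => {.skip :: K}
  | .inc r, K => {.inc r :: K}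
  | .seq a b, K => {.seq a b :: K} ∪ (a.stacks (b :: K) ∪ b.stacks K)
  | .loop r p, K => {.loop r p :: K} ∪ p.stacks (.loop r p :: K)

theorem Prog.finite_stacks (p : Prog) : ∀ K, (p.stacks K).Finite := by
  induction p with
  | skip => exact fun K => Set.finite_singleton _
  | inc r => exact fun K => Set.finite_singleton _
  | seq a b ha hb => exact fun K => (Set.finite_singleton _).union ((ha _).union (hb _))
  | loop r p hp => exact fun K => (Set.finite_singleton _).union (hp _)

theorem Prog.cons_mem_stacks (p : Prog) (K : List Prog) : p :: K ∈ p.stacks K := by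
  cases p <;> simp [Prog.stacks]

/-- The stack after a step of the program, depending on the outcome of a test for zero. -/
def nextStack : List Prog → Bool → List Prog
  | [], _ => []
  | .skip :: K, _ => K
  | .inc _ :: K, _ => K
  | .seq a b :: K, _ => a :: b :: K
  | .loop r p :: K, z => if z then K else p :: .loop r p :: K

theorem Prog.nextStack_mem (p : Prog) : ∀ K L z, L ∈ p.stacks K →
    nextStack L z ∈ p.stacks K ∨ nextStack L z = K := by
  induction p with
  | skip => rintro K L z rfl; exact Or.inr rfl
  | inc r => rintro K L z rfl; exact Or.inr rfl
  | seq a b ha hb =>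
    rintro K L z (rfl | h | h)
    · exact Or.inl (Or.inr (Or.inl (a.cons_mem_stacks _)))
    · rcases ha _ L z h with h | h
      · exact Or.inl (Or.inr (Or.inl h))
      · rw [h]; exact Or.inl (Or.inr (Or.inr (b.cons_mem_stacks _)))
    · rcases hb _ L z h with h | h
      · exact Or.inl (Or.inr (Or.inr h))
      · exact Or.inr h
  | loop r p hp =>
    rintro K L z (rfl | h)
    · cases z
      · exact Or.inl (Or.inr (p.cons_mem_stacks _))
      · exact Or.inr rfl
    · rcases hp _ L z h with h | h
      · exact Or.inl (Or.inr h)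
      · rw [h]; exact Or.inl (Or.inl rfl)

/-- The control states of a program. -/
def Prog.Ctl (p : Prog) : Type := {K : List Prog // K = [] ∨ K ∈ p.stacks []}

noncomputable instance (p : Prog) : Fintype p.Ctl :=
  (((Set.finite_singleton []).union (p.finite_stacks [])).subset fun _ h => h).fintype

/-- The register the next step of a program refers to. -/
def headReg : List Prog → ℕ
  | .inc r :: _ => r
  | .loop r _ :: _ => r
  | _ => 0

/-- A bound for the registers of a program. -/
noncomputable def Prog.maxReg (p : Prog) : ℕ := Finset.univ.sup fun K : p.Ctl => headReg K.1

theorem Prog.headReg_le (p : Prog) (K : p.Ctl) : headReg K.1 ≤ p.maxReg :=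
  Finset.le_sup (f := fun K : p.Ctl => headReg K.1) (Finset.mem_univ K)

/-- The registers of a program, an unused register and a clock. -/
abbrev Prog.Reg (p : Prog) : Type := Fin (p.maxReg + 1) ⊕ Bool

/-- The counter machine running a program.  If `clk` is set, a clock counts the steps until the
program terminates, otherwise the state reached upon termination is bad. -/
noncomputable def Prog.machine (p : Prog) (clk : Bool) : CMachine p.Ctl p.Reg where
  q0 := ⟨[p], Or.inr (p.cons_mem_stacks _)⟩
  r0 := .inl 0
  test q := match q.1 with
    | .loop r _ :: _ => .inl (Fin.ofNat _ r)
    | _ => .inr false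
  nxt q b := ⟨nextStack q.1 !b, by
    rcases q.2 with h | h
    · rw [h]; exact Or.inl rfl
    · exact (p.nextStack_mem _ _ _ h).symm⟩
  inc q _ r := match r with
    | .inl i => (match q.1 with
      | .inc j :: _ => decide (i.val = j)
      | _ => false)
    | .inr false => false
    | .inr true => clk && !q.1.isEmpty
  bad q := !clk && q.1.isEmpty

/-- The computation of a program started with register `0` containing `n`. -/
def Prog.trace (p : Prog) (n t : ℕ) : List Prog × (ℕ → ℕ) :=
  kstep^[t] ([p], Function.update (fun _ => 0) 0 n)

theorem Prog.trace_succ (p : Prog) (n t : ℕ) : p.trace n (t + 1) = kstep (p.trace n t) :=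
  Function.iterate_succ_apply' ..

/-- The program terminates when started with register `0` containing `n`. -/
def Prog.Halts (p : Prog) (n : ℕ) : Prop := ∃ t, (p.trace n t).1 = []

theorem Prog.trace_nil (p : Prog) {n t u : ℕ} (h : (p.trace n t).1 = []) (hu : t ≤ u) :
    (p.trace n u).1 = [] := by
  induction u, hu using Nat.le_induction with
  | base => exact h
  | succ u _ ih =>
    rw [p.trace_succ]
    rcases hp : p.trace n u with ⟨K, s⟩
    rw [hp] at ih
    cases ih; rfl

variable {p : Prog} {clk : Bool} {n : ℕ}

theorem machine_cfg (t : ℕ) : (((p.machine clk).cfg n t).1).1 = (p.trace n t).1 ∧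
    (∀ i, ((p.machine clk).cfg n t).2 (.inl i) = (p.trace n t).2 i) ∧
    ((p.machine clk).cfg n t).2 (.inr false) = 0 := by
  induction t with
  | zero =>
    refine ⟨rfl, fun i => ?_, rfl⟩
    change (if (Sum.inl i : p.Reg) = .inl 0 then n else 0) = Function.update (fun _ => 0) 0 n i.val
    by_cases h : i = 0
    · subst h; simp
    · have : i.val ≠ 0 := fun h' => h (Fin.ext h')
      simp [h, this]
  | succ t ih =>
    rw [p.trace_succ]
    change (((p.machine clk).step ((p.machine clk).cfg n t)).1).1 = _ ∧
      (∀ i, ((p.machine clk).step ((p.machine clk).cfg n t)).2 (.inl i) = _) ∧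
      ((p.machine clk).step ((p.machine clk).cfg n t)).2 (.inr false) = 0
    generalize (p.machine clk).cfg n t = x at ih
    generalize p.trace n t = y at ih
    obtain ⟨⟨K, hK⟩, c⟩ := x
    obtain ⟨K', s⟩ := y
    obtain ⟨h1, h2, h3⟩ := ih
    simp only at h1 h2 h3
    subst h1
    have hle := p.headReg_le ⟨K, hK⟩
    simp only at hle
    rcases K with _ | ⟨_ | r | ⟨a, b⟩ | ⟨r, q⟩, K⟩
    · refine ⟨rfl, fun i => ?_, ?_⟩ <;>
        simp [CMachine.step, CMachine.branch, CMachine.upd, Prog.machine, kstep, h2, h3]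
    · refine ⟨rfl, fun i => ?_, ?_⟩ <;>
        simp [CMachine.step, CMachine.branch, CMachine.upd, Prog.machine, kstep, h2, h3]
    · refine ⟨rfl, fun i => ?_, ?_⟩
      · by_cases hi : i.val = r
        · subst hi
          simp [CMachine.step, CMachine.branch, CMachine.upd, Prog.machine, kstep, h2, h3]
        · simp [CMachine.step, CMachine.branch, CMachine.upd, Prog.machine, kstep, h2, h3, hi]
      · simp [CMachine.step, CMachine.branch, CMachine.upd, Prog.machine, kstep, h2, h3]
    · refine ⟨rfl, fun i => ?_, ?_⟩ <;>
        simp [CMachine.step, CMachine.branch, CMachine.upd, Prog.machine, kstep, h2, h3]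
    · have hr : r < p.maxReg + 1 := Nat.lt_succ_of_le hle
      have hv : (Fin.ofNat (p.maxReg + 1) r).val = r := Nat.mod_eq_of_lt hr
      have hc : c (.inl (Fin.ofNat (p.maxReg + 1) r)) = s r := by rw [h2, hv]
      by_cases h0 : s r = 0
      · refine ⟨?_, fun i => ?_, ?_⟩ <;>
          simp [CMachine.step, CMachine.branch, CMachine.upd, Prog.machine, kstep, nextStack, h2, h3, hc, h0, Nat.mod_eq_of_lt hr]
      · refine ⟨?_, fun i => ?_, ?_⟩
        · simp [CMachine.step, CMachine.branch, CMachine.upd, Prog.machine, kstep, nextStack, h2, h3, hc, h0, Nat.mod_eq_of_lt hr]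
        · by_cases hi : i.val = r
          · have : i = Fin.ofNat (p.maxReg + 1) r := Fin.ext (hi.trans hv.symm)
            simp only [CMachine.step, CMachine.branch, CMachine.upd, Prog.machine, kstep, hc, h0, ← this]
            simp [h2, hi, h0]
          · have : i ≠ Fin.ofNat (p.maxReg + 1) r := fun h => hi (by rw [h, hv])
            simp [CMachine.step, CMachine.branch, CMachine.upd, Prog.machine, kstep, hc, h0, this, h2, hi, Nat.mod_eq_of_lt hr]
            exact fun h => absurd h this
        · simp [CMachine.step, CMachine.branch, CMachine.upd, Prog.machine, kstep, h3, hc, h0, Nat.mod_eq_of_lt hr]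

theorem machine_bad_iff :
    (∀ t, (p.machine false).bad ((p.machine false).cfg n t).1 = false) ↔ ¬ p.Halts n := by
  simp only [Prog.Halts, not_exists]
  refine forall_congr' fun t => ?_
  rw [← (machine_cfg (clk := false) t).1]
  simp [Prog.machine]

theorem machine_bad_clock (q : p.Ctl) : (p.machine true).bad q = false := rfl

theorem machine_clock {t : ℕ} (h : ¬ p.Halts n) : ((p.machine true).cfg n t).2 (.inr true) = t := by
  induction t with
  | zero => rfl
  | succ t ih =>
    have h1 : (((p.machine true).cfg n t).1).1 ≠ [] := fun h' =>
      h ⟨t, by rw [← (machine_cfg (clk := true) t).1, h']⟩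
    have h2 : (Sum.inr true : p.Reg) ≠ (p.machine true).test ((p.machine true).cfg n t).1 := by
      simp only [Prog.machine]
      split <;> simp
    change (p.machine true).upd _ _ _ _ = _
    rw [CMachine.upd, if_neg (fun h => h2 h.2), ih]
    have h3 : ∀ b, (p.machine true).inc ((p.machine true).cfg n t).1 b (.inr true) = true := by
      intro b
      change (true && !(((p.machine true).cfg n t).1).1.isEmpty) = true
      simpa using h1
    rw [h3]; rfl

theorem machine_eventually_const (h : p.Halts n) :
    ∃ T, ∀ t, T ≤ t → (p.machine true).cfg n t = (p.machine true).cfg n T := by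
  obtain ⟨T, hT⟩ := h
  refine ⟨T, fun t ht => ?_⟩
  induction t, ht using Nat.le_induction with
  | base => rfl
  | succ t ht ih =>
    rw [← ih]
    change (p.machine true).step _ = _
    obtain ⟨h1, -, h3⟩ := machine_cfg (p := p) (clk := true) (n := n) t
    rw [p.trace_nil hT ht] at h1
    generalize (p.machine true).cfg n t = x at h1 h3
    obtain ⟨⟨K, hK⟩, c⟩ := x
    simp only at h1 h3
    subst h1
    refine Prod.ext rfl ?_
    funext r
    rcases r with i | _ | _ <;>
      simp [CMachine.step, CMachine.branch, CMachine.upd, Prog.machine, h3]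

open Function in
/-- Unbounded search for a zero of a primitive recursive function. -/
theorem exists_prog_halts {h : ℕ → ℕ → ℕ} (hh : Primrec₂ h) (hle : ∀ n t, h n t ≤ 1) :
    ∃ p : Prog, ∀ n, p.Halts n ↔ ∃ t, h n t = 0 := by
  have hc : Computes fun v : List.Vector ℕ 2 => h v.head v.tail.head :=
    computes_primrec ((Nat.Primrec'.prim_iff₂ (f := h)).2 hh)
  obtain ⟨p, hp⟩ := hc (fun i => i.val) 2 3 (fun i => by omega) (by omega) (fun i => by omega)
  set st : ℕ → ℕ → ℕ → ℕ → ℕ := fun n t z => update (update (update (fun _ => 0) 0 n) 1 t) 2 z with hst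
  have hp' : ∀ n t, Runs (.seq p (.inc 1)) (st n t 0) (st n (t + 1) (h n t)) := by
    intro n t
    refine ((hp _ (by simp [hst]) fun r hr => ?_).seq (Runs.inc 1 _)).congr rfl ?_
    · have : r ≠ 0 ∧ r ≠ 1 ∧ r ≠ 2 := by omega
      simp [hst, this]
    · have e : h (List.Vector.ofFn fun i : Fin 2 => st n t 0 i).head
          (List.Vector.ofFn fun i : Fin 2 => st n t 0 i).tail.head = h n t := by
        simp [List.Vector.head_ofFn, List.Vector.tail_ofFn, hst]
      simp only [e]
      funext r
      by_cases h1 : r = 1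
      · subst h1; simp [hst]
      · by_cases h2 : r = 2
        · subst h2; simp [hst]
        · simp [hst, h1, h2]
  set lp : Prog := .loop 2 (.seq p (.inc 1)) with hlp
  have hstep : ∀ n t, ∃ m, kstep^[m + 1] ([lp], st n t 1) = ([lp], st n (t + 1) (h n t)) := by
    intro n t
    obtain ⟨m, hm⟩ := hp' n t [lp]
    refine ⟨m, ?_⟩
    rw [iterate_succ_apply, ← hm]
    simp [hlp, kstep, hst]
  have hreach : ∀ n t, (∀ u < t, h n u ≠ 0) → ∃ m, t ≤ m ∧
      (Prog.seq (.inc 2) lp).trace n m = ([lp], st n t 1) := by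
    intro n t
    induction t with
    | zero =>
      intro _
      refine ⟨2, by omega, ?_⟩
      simp only [Prog.trace, iterate_succ_apply, iterate_zero_apply, kstep, Prod.mk.injEq, true_and]
      funext r
      by_cases h1 : r = 0
      · subst h1; simp [hst]
      · by_cases h2 : r = 2
        · subst h2; simp [hst]
        · by_cases h3 : r = 1
          · subst h3; simp [hst]
          · simp [hst, h1, h2, h3]
    | succ t ih =>
      intro hu
      obtain ⟨m, hm, hm'⟩ := ih fun u hut => hu u (by omega)
      obtain ⟨m', h'⟩ := hstep n t
      refine ⟨m' + 1 + m, by omega, ?_⟩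
      have := hu t (by omega)
      have h1 : h n t = 1 := by have := hle n t; omega
      rw [h1] at h'
      rw [Prog.trace] at hm' ⊢
      rw [iterate_add_apply, hm', h']
  refine ⟨.seq (.inc 2) lp, fun n => ⟨fun ⟨u, hu⟩ => ?_, fun hex => ?_⟩⟩
  · by_contra hc
    push Not at hc
    obtain ⟨m, hm, hm'⟩ := hreach n u fun u _ => hc u
    have := Prog.trace_nil _ hu hm
    rw [hm'] at this
    cases this
  · classical
    obtain ⟨m, -, hm⟩ := hreach n (Nat.find hex) fun u hu => Nat.find_min hex hu
    obtain ⟨m', h'⟩ := hstep n (Nat.find hex)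
    rw [Nat.find_spec hex] at h'
    refine ⟨m' + 1 + m + 1, ?_⟩
    rw [Prog.trace_succ, Prog.trace, iterate_add_apply]
    rw [Prog.trace] at hm
    rw [hm, h']
    simp [hlp, kstep, hst]

/-- Replacing an entry of a list which is padded by `d`. -/
def setPad {α : Type} (d : α) (l : List α) (i : ℕ) (a : α) : List α :=
  (List.range (max l.length (i + 1))).map fun j => if j = i then a else l.getD j d

theorem getD_setPad {α : Type} (d : α) (l : List α) (i : ℕ) (a : α) :
    (fun j => (setPad d l i a).getD j d) = Function.update (fun j => l.getD j d) i a := by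
  funext j
  by_cases hj : j < max l.length (i + 1)
  · rw [setPad, List.getD_eq_getElem _ _ (by simpa using hj)]
    by_cases h : j = i
    · subst h; simp
    · simp [h]
  · have h1 : l.length ≤ j := by omega
    have h2 : j ≠ i := by omega
    rw [setPad, List.getD_eq_default _ _ (by simpa using hj), Function.update_of_ne h2,
      List.getD_eq_default _ _ h1]

namespace TM

variable (M : TM)

/-- Configurations with a finite tape. -/
abbrev Code : Type := Fin (M.states + 1) × List (Fin (M.symbols + 3)) × ℕ

/-- The configuration represented by a code. -/
def decodeCfg (c : M.Code) : Cfg M.states M.symbols :=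
  ⟨c.1, fun j => c.2.1.getD j (blankSym M.symbols), c.2.2⟩

/-- One step on codes. -/
def codeStep (c : M.Code) : Option M.Code :=
  (M.step c.1 (c.2.1.getD c.2.2 (blankSym M.symbols))).map fun x =>
    (x.1, setPad (blankSym M.symbols) c.2.1 c.2.2 x.2.1, if x.2.2 = true then c.2.2 + 1 else c.2.2 - 1)

/-- A run on codes. -/
def codeRun (x : List Bool) (t : ℕ) : Option M.Code :=
  Nat.rec (some (M.start, x.map (bitSym M.symbols), 0)) (fun _ o => o.bind M.codeStep) t

theorem stepCfg_decodeCfg (c : M.Code) : M.stepCfg (M.decodeCfg c) = (M.codeStep c).map M.decodeCfg := by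
  obtain ⟨q, l, i⟩ := c
  simp only [stepCfg, codeStep, decodeCfg]
  rcases M.step q (l.getD i (blankSym M.symbols)) with _ | ⟨q', a, mv⟩
  · rfl
  · simp only [Option.map_some, decodeCfg, getD_setPad]

theorem run_eq_codeRun (x : List Bool) (t : ℕ) : M.run x t = (M.codeRun x t).map M.decodeCfg := by
  induction t with
  | zero =>
    refine congrArg some ?_
    refine congrArg (fun f => (⟨M.start, f, 0⟩ : Cfg M.states M.symbols)) ?_
    funext i
    split_ifs with h
    · simp [h]
    · simp [h]
  | succ t ih =>
    change (M.run x t).bind M.stepCfg = ((M.codeRun x t).bind M.codeStep).map M.decodeCfg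
    rw [ih]
    rcases M.codeRun x t with _ | c
    · rfl
    · exact M.stepCfg_decodeCfg c

theorem primrec_codeStep : Primrec M.codeStep := by
  have hpos : Primrec fun c : M.Code => c.2.2 := Primrec.snd.comp Primrec.snd
  have hl : Primrec fun c : M.Code => c.2.1 := Primrec.fst.comp Primrec.snd
  refine Primrec.option_map ((Primrec.dom_finite fun x : Fin (M.states + 1) × Fin (M.symbols + 3) =>
    M.step x.1 x.2).comp (Primrec.fst.pair ((Primrec.list_getD _).comp hl hpos))) ?_
  refine Primrec.pair (Primrec.fst.comp Primrec.snd) (Primrec.pair ?_ ?_)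
  · refine Primrec.list_map (Primrec.list_range.comp (Primrec.nat_max.comp
      (Primrec.list_length.comp (hl.comp Primrec.fst)) (Primrec.succ.comp (hpos.comp Primrec.fst)))) ?_
    exact Primrec.ite (Primrec.eq.comp Primrec.snd (hpos.comp (Primrec.fst.comp Primrec.fst)))
      (Primrec.fst.comp (Primrec.snd.comp (Primrec.snd.comp Primrec.fst)))
      ((Primrec.list_getD _).comp (hl.comp (Primrec.fst.comp Primrec.fst)) Primrec.snd)
  · exact Primrec.ite (Primrec.eq.comp (Primrec.snd.comp (Primrec.snd.comp Primrec.snd)) (Primrec.const true))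
      (Primrec.succ.comp (hpos.comp Primrec.fst)) (Primrec.pred.comp (hpos.comp Primrec.fst))

theorem primrec_codeRun : Primrec₂ M.codeRun := by
  refine Primrec.nat_rec (f := fun x : List Bool => some (M.start, x.map (bitSym M.symbols), 0))
    (g := fun _ (y : ℕ × Option M.Code) => y.2.bind M.codeStep) ?_ ?_
  · have h1 : Primrec₂ fun (_ : List Bool) b => bitSym M.symbols b :=
      (Primrec.dom_finite (bitSym M.symbols)).comp Primrec.snd
    have h2 : Primrec fun x : List Bool => x.map (bitSym M.symbols) := Primrec.list_map Primrec.id h1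
    exact Primrec.option_some.comp ((Primrec.const _).pair (h2.pair (Primrec.const 0)))
  · exact Primrec.option_bind (Primrec.snd.comp Primrec.snd) (M.primrec_codeStep.comp Primrec.snd)

theorem computablePred_of_decides {L : Set (List Bool)} (h : M.Decides L) :
    ComputablePred fun x => x ∈ L := by
  classical
  refine ⟨inferInstance, ?_⟩
  have h1 : Partrec fun x => Nat.rfind fun t => Part.some (M.codeRun x (t + 1)).isNone := by
    refine Partrec.rfind (p := fun x t => Part.some (M.codeRun x (t + 1)).isNone) ?_
    have : Primrec₂ fun x t => (M.codeRun x (t + 1)).isNone := by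
      have h2 : Primrec₂ fun (x : List Bool) t => M.codeRun x (t + 1) :=
        M.primrec_codeRun.comp Primrec.fst (Primrec.succ.comp Primrec.snd)
      refine (Primrec.not.comp (Primrec.option_isSome.comp h2)).of_eq ?_
      intro x
      exact Option.not_isSome _
    exact this.to_comp.partrec₂
  have h2 : Primrec₂ fun x t => ((M.codeRun x t).map fun c => decide (c.1 = M.accept)).getD false := by
    refine Primrec.option_getD.comp (Primrec.option_map M.primrec_codeRun ?_) (Primrec.const false)
    exact (Primrec.dom_finite fun q : Fin (M.states + 1) => decide (q = M.accept)).comp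
      (Primrec.fst.comp Primrec.snd)
  refine (h1.map h2.to_comp).of_eq fun x => ?_
  obtain ⟨t, c, hrun, hhalt, hacc⟩ := h x
  have hnone : M.run x (t + 1) = none := by
    change (M.run x t).bind M.stepCfg = none
    rw [hrun]; exact hhalt
  have hsome : ∀ u ≤ t, M.run x u ≠ none := by
    intro u hu hn
    have : M.run x t = none := by
      clear hrun hnone
      induction t, hu using Nat.le_induction with
      | base => exact hn
      | succ t _ ih =>
        change (M.run x t).bind M.stepCfg = none
        rw [ih]; rfl
    rw [this] at hrun; cases hrun
  refine Part.eq_some_iff.2 ?_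
  refine (Part.mem_map_iff _).2 ⟨t, Nat.mem_rfind.2 ⟨?_, fun {u} hu => ?_⟩, ?_⟩
  · rw [M.run_eq_codeRun, Option.map_eq_none_iff] at hnone
    simp [hnone]
  · have := hsome (u + 1) (by omega)
    rw [M.run_eq_codeRun, ne_eq, Option.map_eq_none_iff] at this
    simp only [Part.mem_some_iff]
    cases hc : M.codeRun x (u + 1)
    · exact absurd hc this
    · rfl
  · rw [M.run_eq_codeRun, Option.map_eq_some_iff] at hrun
    obtain ⟨d, hd, rfl⟩ := hrun
    rw [hd]
    simp only [Option.map_some, Option.getD_some, decide_eq_decide]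
    exact hacc.symm

end TM

theorem primrec_bits : Primrec Nat.bits := by
  have : Primrec₂ fun (_ : Unit) n => Nat.bits n := by
    refine Primrec.nat_strong_rec (fun (_ : Unit) n => Nat.bits n)
      (g := fun _ l => if l.length = 0 then some [] else
        (l[l.length / 2]?).map (List.cons (decide (l.length % 2 = 1)))) ?_ ?_
    · have hlen : Primrec fun x : Unit × List (List Bool) => x.2.length := Primrec.list_length.comp Primrec.snd
      refine Primrec.ite (Primrec.eq.comp hlen (Primrec.const 0)) (Primrec.const _) ?_
      refine Primrec.option_map (Primrec.list_getElem?.comp Primrec.snd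
        (Primrec.nat_div.comp hlen (Primrec.const 2))) ?_
      refine Primrec.list_cons.comp ?_ Primrec.snd
      exact PrimrecPred.decide (Primrec.eq.comp (Primrec.nat_mod.comp (hlen.comp Primrec.fst) (Primrec.const 2))
        (Primrec.const 1))
    · intro _ n
      rcases Nat.eq_zero_or_pos n with rfl | hn
      · simp
      · have h2 : n / 2 < n := Nat.div_lt_self hn (by norm_num)
        simp only [List.length_map, List.length_range, hn.ne', if_false]
        rw [List.getElem?_map, List.getElem?_range h2]
        simp only [Option.map_some, Option.some.injEq]
        have hb : Nat.bit (decide (n % 2 = 1)) (n / 2) = n := by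
          rcases Nat.mod_two_eq_zero_or_one n with h | h <;> simp [Nat.bit, h] <;> omega
        conv_rhs => rw [← hb]
        rw [Nat.bits_append_bit]
        intro h
        simp; omega
  exact this.comp (Primrec.const ()) Primrec.id

section Encoding

open Encodable

theorem encode_list_map {β : Type} [Encodable β] (l : List β) : encode (l.map encode) = encode l := by
  induction l with
  | nil => rfl
  | cons a l ih => rw [List.map_cons, encode_list_cons, encode_list_cons, ih]; rfl

theorem primrec_encode_ofFn {β : Type} [Encodable β] {m : ℕ} {f : ℕ → Fin m → β}
    (h : ∀ i, Primrec fun n => encode (f n i)) : Primrec fun n => encode (List.ofFn (f n)) := by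
  refine (Primrec.encode.comp (Primrec.list_ofFn h)).of_eq fun n => ?_
  rw [← encode_list_map (List.ofFn (f n)), List.map_ofFn]
  rfl

theorem primrec_encode_pair {β γ : Type} [Encodable β] [Encodable γ] {f : ℕ → β} {g : ℕ → γ}
    (hf : Primrec fun n => encode (f n)) (hg : Primrec fun n => encode (g n)) :
    Primrec fun n => encode (f n, g n) :=
  (Primrec₂.natPair.comp hf hg).of_eq fun _ => (encode_prod_val _ _).symm

theorem encode_rat (q : ℚ) : encode q = Nat.pair (encode q.num) q.den := by
  cases q; rfl

theorem primrec_two_pow : Primrec fun n : ℕ => 2 ^ n := by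
  refine (Primrec.nat_rec' (f := fun n : ℕ => n) (g := fun _ => 1) (h := fun _ x => 2 * x.2) Primrec.id
    (Primrec.const 1) (Primrec.nat_mul.comp (Primrec.const 2) (Primrec.snd.comp Primrec.snd))).of_eq ?_
  intro n
  induction n with
  | zero => rfl
  | succ n ih => rw [pow_succ, ← ih, mul_comm]

theorem primrec_encode_half_pow : Primrec fun n : ℕ => encode ((1 / 2 : ℚ) ^ n) := by
  refine (Primrec₂.natPair.comp (Primrec.const (encode (1 : ℤ))) primrec_two_pow).of_eq fun n => ?_
  rw [encode_rat, Rat.num_pow, Rat.den_pow]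
  norm_num

theorem primrec_encode_one_sub_half_pow : Primrec fun n : ℕ => encode (1 - (1 / 2 : ℚ) ^ n) := by
  have h1 : Primrec fun m : ℕ => encode (m : ℤ) :=
    (Primrec.nat_mul.comp (Primrec.const 2) Primrec.id).of_eq fun m => rfl
  refine (Primrec₂.natPair.comp (h1.comp (Primrec.pred.comp primrec_two_pow)) primrec_two_pow).of_eq fun n => ?_
  have hpos : 0 < 2 ^ n := by positivity
  have e : (1 - (1 / 2 : ℚ) ^ n) = (((2 ^ n).pred : ℕ) : ℤ) / ((2 ^ n : ℕ) : ℤ) := by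
    rw [Nat.pred_eq_sub_one]
    push_cast [Nat.one_le_two_pow]
    field_simp
    rw [sub_mul, ← mul_pow]; norm_num
  have hc : Nat.Coprime (((2 ^ n).pred : ℕ) : ℤ).natAbs ((2 ^ n : ℕ) : ℤ).natAbs := by
    rw [Int.natAbs_natCast, Int.natAbs_natCast]
    have := Nat.coprime_self_add_right (m := (2 ^ n).pred) (n := 1)
    have h2 : (2 ^ n).pred + 1 = 2 ^ n := Nat.succ_pred_eq_of_pos hpos
    rw [h2] at this
    exact this.2 (Nat.coprime_one_right _)
  rw [encode_rat, e, Rat.num_div_eq_of_coprime (by exact_mod_cast hpos) hc]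
  have := Rat.den_div_eq_of_coprime (a := (((2 ^ n).pred : ℕ) : ℤ)) (b := ((2 ^ n : ℕ) : ℤ)) (by exact_mod_cast hpos) hc
  rw [Int.natCast_inj.1 this]

theorem encodeTRInstance_injective {I J : TRInstance} (h : encodeTRInstance I = encodeTRInstance J) :
    I = J := by
  have hbits : Function.Injective Nat.bits := by
    refine Function.LeftInverse.injective (g := List.foldr Nat.bit 0) fun n => ?_
    induction n using Nat.binaryRec' with
    | zero => simp
    | bit b n h ih => rw [Nat.bits_append_bit n b h, List.foldr_cons, ih]
  have h1 := encode_injective (hbits h)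
  obtain ⟨k, n, A, F, μ, wf, ht, hμ0, hμ1⟩ := I
  obtain ⟨k', n', A', F', μ', wf', ht', hμ0', hμ1'⟩ := J
  simp only [Prod.mk.injEq] at h1
  obtain ⟨hA, hF, hμ⟩ := h1
  have hμ := encode_injective hμ
  have hA := encode_injective hA
  simp only [Prod.mk.injEq] at hA
  obtain ⟨rfl, rfl, ho, he, hp, hi⟩ := hA
  have hAA : A = A' := by
    obtain ⟨o, ed, pr, i⟩ := A
    obtain ⟨o', ed', pr', i'⟩ := A'
    simp only at ho he hp hi
    congr 1
    · funext v
      exact Option.map_injective Fin.val_injective (congrFun (List.ofFn_injective ho) v)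
    · funext v
      exact List.ofFn_injective (congrFun (List.ofFn_injective he) v)
    · funext v
      exact List.ofFn_injective (congrFun (List.ofFn_injective hp) v)
    · exact Fin.ext hi
  have hFF : F = F' := by
    funext v
    exact List.ofFn_injective (congrFun (List.ofFn_injective hF) v)
  subst hAA hFF hμ
  rfl

section

variable {Q R : Type} [DecidableEq R] [Fintype R] [Fintype Q] {N k : ℕ}
  (M : CMachine Q R) (en : Fin N ≃ Option (R × Bool)) (pl : Option (R × Bool × Bool) ≃ Fin k)

theorem gameArena_owner_eq (n : ℕ) : (gameArena M en pl n).owner = (gameArena M en pl 0).owner := by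
  funext u
  rcases u with ⟨q, p⟩ | ⟨δ, p, i⟩ | (_ | ⟨r, p, b⟩) | ⟨δ, p, r⟩ | ⟨δ, p, r⟩ | ⟨δ, p, r⟩ | ⟨p, r⟩ | ⟨j, b⟩ | _ <;>
    try rfl
  rcases δ with _ | ⟨q, b⟩ <;> rfl

theorem gameArena_edge_eq (n : ℕ) : (gameArena M en pl n).edge = (gameArena M en pl 0).edge := by
  funext u v
  rcases u with ⟨q, p⟩ | ⟨δ, p, i⟩ | (_ | ⟨r, p, b⟩) | ⟨δ, p, r⟩ | ⟨δ, p, r⟩ | ⟨δ, p, r⟩ | ⟨p, r⟩ | ⟨j, b⟩ | _ <;>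
    try rfl
  rcases δ with _ | ⟨q, b⟩ <;> rfl

theorem primrec_encode_prob (u v : GV Q R N) : Primrec fun n => encode ((gameArena M en pl n).prob u v) := by
  classical
  by_cases h : ∃ p, u = .Ev none p M.r0
  · obtain ⟨p, rfl⟩ := h
    have hn : ∀ n, (gameArena M en pl n).prob (.Ev none p M.r0) v = if v = .Hi none p M.r0 then (1 / 2) ^ n
        else if v = .Lo p M.r0 then 1 - (1 / 2) ^ n else 0 := by
      intro n
      rw [gameArena_prob_inr M en pl n (l := [((1 / 2) ^ n, .Hi none p M.r0), (1 - (1 / 2) ^ n, .Lo p M.r0)])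
        (by simp [node, CMachine.forced])]
      by_cases h1 : v = .Hi none p M.r0
      · subst h1; simp
      · by_cases h2 : v = .Lo p M.r0
        · subst h2; simp
        · simp [h1, h2]
    simp only [hn]
    split_ifs
    · exact primrec_encode_half_pow
    · exact primrec_encode_one_sub_half_pow
    · exact Primrec.const _
  · have hn : ∀ n, node M en n u = node M en 0 u := by
      intro n
      rcases u with ⟨q, p⟩ | ⟨δ, p, i⟩ | (_ | ⟨r, p, b⟩) | ⟨δ, p, r⟩ | ⟨δ, p, r⟩ | ⟨δ, p, r⟩ | ⟨p, r⟩ | ⟨j, b⟩ | _ <;>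
        try rfl
      rcases δ with _ | ⟨q, b⟩
      · have hr : r ≠ M.r0 := fun hr => h ⟨p, by rw [hr]⟩
        simp [node, CMachine.forced, hr]
      · rfl
    refine (Primrec.const (encode ((gameArena M en pl 0).prob u v))).of_eq fun n => ?_
    simp only [gameArena, hn]

/-- The game simulating a counter machine on input `n` as an instance of the synthesis problem. -/
noncomputable def gameInstance [Nonempty R] {m : ℕ} (e : GV Q R N ≃ Fin m) (n : ℕ) : TRInstance where
  k := k
  n := m
  A := (gameArena M en pl n).reindex e
  F i v := gameTarget Q N pl i (e.symm v)
  μ := 0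
  wf := (arenaIso_reindex _ e).wf (gameArena_wf M en pl n)
  hterm i v hv := by
    have := (arenaIso_reindex (gameArena M en pl n) e).terminal (gameTarget_terminal M en pl n i _ hv)
    simpa using this
  hμ0 := le_rfl
  hμ1 := zero_le_one

theorem primrec_encode_gameInstance [Nonempty R] {m : ℕ} (e : GV Q R N ≃ Fin m) :
    Primrec fun n => encodeTRInstance (gameInstance M en pl e n) := by
  refine primrec_bits.comp (primrec_encode_pair ?_ (Primrec.const (encode
    (List.ofFn fun i => List.ofFn ((gameInstance M en pl e 0).F i), encode (0 : ℚ)))))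
  set A := fun n => (gameInstance M en pl e n).A with hA
  have ho : ∀ n, (A n).owner = (A 0).owner := fun n => by
    simp only [hA, gameInstance, Arena.reindex, gameArena_owner_eq M en pl n]
  have he : ∀ n, (A n).edge = (A 0).edge := fun n => by
    simp only [hA, gameInstance, Arena.reindex, gameArena_edge_eq M en pl n]
  have h1 := primrec_encode_ofFn (f := fun n v => ((A n).owner v).map Fin.val) fun v => by
    simp only [ho]; exact Primrec.const (encode (((A 0).owner v).map Fin.val))
  have h2 := primrec_encode_ofFn (f := fun n v => List.ofFn ((A n).edge v)) fun v => by
    simp only [he]; exact Primrec.const (encode (List.ofFn ((A 0).edge v)))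
  have h3 := primrec_encode_ofFn (f := fun n v => List.ofFn ((A n).prob v)) fun v =>
    primrec_encode_ofFn (f := fun n w => (A n).prob v w) fun w =>
      primrec_encode_prob M en pl (e.symm v) (e.symm w)
  have h4 : Primrec fun n => encode ((A n).init : ℕ) := Primrec.const (encode ((A 0).init : ℕ))
  exact primrec_encode_pair (Primrec.const (encode k)) (primrec_encode_pair (Primrec.const (encode m))
    (primrec_encode_pair h1 (primrec_encode_pair h2 (primrec_encode_pair h3 h4))))

end

end Encoding

theorem not_answerGt_gameInstance_iff {Q R : Type} [DecidableEq R] [Fintype R] [Fintype Q] [Nonempty R]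
    {N k m : ℕ} (M : CMachine Q R) (en : Fin N ≃ Option (R × Bool))
    (pl : Option (R × Bool × Bool) ≃ Fin k) (e : GV Q R N ≃ Fin m) (n : ℕ) (pu fs : Prop)
    (C : {n : ℕ} → Strategy (Fin n) → Prop)
    (hC : ∀ {n : ℕ} (σ : Strategy (Fin n)), C σ ↔ (pu → σ.Pure) ∧ (fs → σ.FiniteState)) :
    ¬ TRInstance.AnswerGt C (gameInstance M en pl e n) ↔ ∃ σ : Profile k (GV Q R N),
      Profile.Valid (gameArena M en pl n) σ ∧
      (∀ i, (pu → Strategy.Pure (σ i)) ∧ (fs → Strategy.FiniteState (σ i))) ∧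
      Stable (gameArena M en pl n) (fun i => {v | gameTarget Q N pl i v = true}) σ ∧
      rval (gameArena M en pl n) σ {v | gameTarget Q N pl 0 v = true} [] (gameArena M en pl n).init = 0 := by
  refine not_answerGt_iff (gameInstance M en pl e n) rfl (gameArena M en pl n) (gameArena_wf M en pl n)
    (gameTarget Q N pl) e (arenaIso_reindex _ e) (fun i v => ?_) (fun u hu => ?_) pu fs C fun σ => hC σ
  · exact congrArg (gameTarget Q N pl i) (e.symm_apply_apply v)
  · rcases h : node M en n u with x | l
    · exact Fin.succ_ne_zero _
        (Option.some.inj ((gameArena_owner_inl M en pl n h).symm.trans hu))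
    · cases (gameArena_owner_inr M en pl n h).symm.trans hu

theorem not_answerGt_machine_iff (p : Prog) (clk : Bool) {N k m : ℕ}
    (en : Fin N ≃ Option (p.Reg × Bool)) (pl : Option (p.Reg × Bool × Bool) ≃ Fin k)
    (e : GV p.Ctl p.Reg N ≃ Fin m) (n : ℕ) (pu : Prop) (C : {n : ℕ} → Strategy (Fin n) → Prop)
    (hC : ∀ {n : ℕ} (σ : Strategy (Fin n)), C σ ↔ (pu → σ.Pure) ∧ (clk = true → σ.FiniteState)) :
    ¬ TRInstance.AnswerGt C (gameInstance (p.machine clk) en pl e n) ↔ (clk = true ↔ p.Halts n) := by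
  rw [not_answerGt_gameInstance_iff (p.machine clk) en pl e n pu (clk = true) C hC]
  constructor
  · rintro ⟨σ, hσ, hcl, hst, h0⟩
    obtain ⟨hbad, hfin⟩ := soundness hσ hst h0
    cases clk with
    | false => simpa using machine_bad_iff.1 hbad
    | true =>
      refine iff_of_true rfl ?_
      by_contra hn
      refine Set.infinite_univ.mono ?_ (hfin (fun i => (hcl i).2 rfl) (.inr true))
      rintro t -
      exact ⟨t, machine_clock hn⟩
  · intro h
    have hbad : ∀ t, (p.machine clk).bad ((p.machine clk).cfg n t).1 = false := by
      cases clk with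
      | false => exact machine_bad_iff.2 (by simpa using h)
      | true => exact fun t => machine_bad_clock _
    obtain ⟨σ, hσ, hpu, hfs, hst, h0⟩ := completeness (en := en) (pl := pl) hbad
    refine ⟨σ, hσ, fun i => ⟨fun _ => hpu i, fun hclk => ?_⟩, hst, h0⟩
    subst hclk
    exact hfs (machine_eventually_const (h.1 rfl)) i

open Nat.Partrec in
/-- A program which halts on an input if and only if the partial recursive function encoded by this
input is defined at zero. -/
theorem exists_universal_prog :
    ∃ p : Prog, ∀ n, p.Halts n ↔ ((Denumerable.ofNat Code n).eval 0).Dom := by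
  have hprim : Primrec₂ fun n t : ℕ =>
      bif (Code.evaln t (Denumerable.ofNat Code n) 0).isSome then 0 else 1 := by
    refine Primrec.cond (Primrec.option_isSome.comp (Code.primrec_evaln.comp
      ((Primrec.snd.pair ((Primrec.ofNat Code).comp Primrec.fst)).pair (Primrec.const 0))))
      (Primrec.const 0) (Primrec.const 1)
  obtain ⟨p, hp⟩ := exists_prog_halts hprim fun n t => by
    cases (Code.evaln t (Denumerable.ofNat Code n) 0).isSome <;> simp
  refine ⟨p, fun n => (hp n).trans ?_⟩
  rw [Part.dom_iff_mem]
  constructor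
  · rintro ⟨t, ht⟩
    cases h : Code.evaln t (Denumerable.ofNat Code n) 0 with
    | none => simp [h] at ht
    | some y => exact ⟨y, Code.evaln_sound h⟩
  · rintro ⟨y, hy⟩
    obtain ⟨t, ht⟩ := Code.evaln_complete.1 hy
    exact ⟨t, by rw [Option.mem_def.1 ht]; rfl⟩

theorem undecidable_answerGt (pu : Prop) (clk : Bool) (C : {n : ℕ} → Strategy (Fin n) → Prop)
    (hC : ∀ {n : ℕ} (σ : Strategy (Fin n)), C σ ↔ (pu → σ.Pure) ∧ (clk = true → σ.FiniteState)) :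
    Undecidable (langOf encodeTRInstance (TRInstance.AnswerGt C)) := by
  classical
  rintro ⟨M, hM⟩
  obtain ⟨p, hp⟩ := exists_universal_prog
  have en := (Fintype.equivFin (Option (p.Reg × Bool))).symm
  have pl := Fintype.equivFin (Option (p.Reg × Bool × Bool))
  have e := Fintype.equivFin (GV p.Ctl p.Reg (Fintype.card (Option (p.Reg × Bool))))
  have hmem : ∀ n, encodeTRInstance (gameInstance (p.machine clk) en pl e n) ∈
      langOf encodeTRInstance (TRInstance.AnswerGt C) ↔
      TRInstance.AnswerGt C (gameInstance (p.machine clk) en pl e n) := fun n =>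
    ⟨fun ⟨_, hI, hA⟩ => encodeTRInstance_injective hI ▸ hA, fun hA => ⟨_, rfl, hA⟩⟩
  have hcomp : ComputablePred fun n => TRInstance.AnswerGt C (gameInstance (p.machine clk) en pl e n) := by
    obtain ⟨_, h⟩ := M.computablePred_of_decides hM
    refine ⟨inferInstance, (h.comp (primrec_encode_gameInstance (p.machine clk) en pl e).to_comp).of_eq ?_⟩
    intro n
    simp only [hmem]
  have hiff : ∀ n, p.Halts n ↔
      ((¬ TRInstance.AnswerGt C (gameInstance (p.machine clk) en pl e n)) ↔ clk = true) := by
    intro n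
    rw [not_answerGt_machine_iff p clk en pl e n pu C hC]
    tauto
  have hhalt : ComputablePred fun n => p.Halts n := by
    cases clk with
    | false => exact hcomp.of_eq fun n => by rw [hiff]; simp
    | true => exact hcomp.not.of_eq fun n => by rw [hiff]; simp
  refine ComputablePred.halting_problem 0 ?_
  obtain ⟨_, h⟩ := hhalt
  refine ⟨inferInstance, (h.comp (Computable.encode (α := Nat.Partrec.Code))).of_eq fun c => ?_⟩
  simp only [hp, Denumerable.ofNat_encode]

/-- TR-NCRSP_> is undecidable for pure finite-state,
finite-state, pure, and unrestricted strategies. -/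
theorem TR_NCRSPgt_undecidable :
    Undecidable (langOf encodeTRInstance
      (TRInstance.AnswerGt (fun {_} σ => Strategy.Pure σ ∧ Strategy.FiniteState σ))) ∧
    Undecidable (langOf encodeTRInstance
      (TRInstance.AnswerGt (fun {_} σ => Strategy.FiniteState σ))) ∧
    Undecidable (langOf encodeTRInstance
      (TRInstance.AnswerGt (fun {_} σ => Strategy.Pure σ))) ∧
    Undecidable (langOf encodeTRInstance
      (TRInstance.AnswerGt (fun {_} _ => True))) :=
  ⟨undecidable_answerGt True true _ (by simp), undecidable_answerGt False true _ (by simp),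
    undecidable_answerGt True false _ (by simp), undecidable_answerGt False false _ (by simp)⟩

end NCRSPPaper
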